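/- Let H be a non-semisimple Hopf algebra of dimension 4p over an algebraically closed field k of characteristic zero, where p ∈ {3, 5, 7, 11}. Then both H and its dual H* have a non-trivial skew primitive element. -/

import Mathlib

open scoped TensorProduct

/-- An element of a coalgebra (with comultiplication `Δ`) is group-like if it is
nonzero and `Δ a = a ⊗ a`. -/
def IsGroupLikeOf {k H : Type} [CommRing k] [AddCommGroup H] [Module k H]
    (Δ : H →ₗ[k] H ⊗[k] H) (a : H) : Prop :=
  a ≠ 0 ∧ Δ a = a ⊗ₜ[k] a

/-- A `k`-subspace `C` of a coalgebra with comultiplication `Δ` is a subcoalgebra if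
`Δ C ⊆ C ⊗ C`. -/
def IsSubcoalgebraOf {k H : Type} [CommRing k] [AddCommGroup H] [Module k H]
    (Δ : H →ₗ[k] H ⊗[k] H) (C : Submodule k H) : Prop :=
  ∀ c ∈ C, Δ c ∈ LinearMap.range (TensorProduct.map C.subtype C.subtype)

/-- A subcoalgebra is simple if it is nonzero and has no proper nonzero subcoalgebras. -/
def IsSimpleSubcoalgebraOf {k H : Type} [CommRing k] [AddCommGroup H] [Module k H]
    (Δ : H →ₗ[k] H ⊗[k] H) (C : Submodule k H) : Prop :=
  IsSubcoalgebraOf Δ C ∧ C ≠ ⊥ ∧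
    ∀ D : Submodule k H, IsSubcoalgebraOf Δ D → D ≤ C → D = ⊥ ∨ D = C

/-- A coalgebra is pointed if every simple subcoalgebra is one-dimensional. -/
def IsPointedOf {k H : Type} [CommRing k] [AddCommGroup H] [Module k H]
    (Δ : H →ₗ[k] H ⊗[k] H) : Prop :=
  ∀ C : Submodule k H, IsSimpleSubcoalgebraOf Δ C → Module.finrank k C = 1

/-- A linear functional on `H` (with multiplication `m` and unit `u`) is a group-like element
of the dual Hopf algebra `H*` precisely when it is an algebra character. -/
def IsDualGroupLikeOf {k H : Type} [CommRing k] [AddCommGroup H] [Module k H]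
    (m : H →ₗ[k] H →ₗ[k] H) (u : H) (φ : Module.Dual k H) : Prop :=
  φ u = 1 ∧ ∀ a b : H, φ (m a b) = φ a * φ b

/-- A subspace `C` of `H* = Dual k H` is a subcoalgebra of the dual Hopf algebra iff the dual
comultiplication (dual to the multiplication `m` of `H`) of every `f ∈ C` lies in `C ⊗ C`,
i.e. `f ∘ m` decomposes as a finite sum `∑ uᵢ ⊗ vᵢ` with `uᵢ, vᵢ ∈ C`. -/
def IsDualSubcoalgebraOf {k H : Type} [CommRing k] [AddCommGroup H] [Module k H]
    (m : H →ₗ[k] H →ₗ[k] H) (C : Submodule k (Module.Dual k H)) : Prop :=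
  ∀ f ∈ C, ∃ (n : ℕ) (u v : Fin n → Module.Dual k H),
    (∀ i, u i ∈ C ∧ v i ∈ C) ∧ ∀ a b : H, f (m a b) = ∑ i, u i a * v i b

/-- A simple subcoalgebra of the dual Hopf algebra. -/
def IsDualSimpleSubcoalgebraOf {k H : Type} [CommRing k] [AddCommGroup H] [Module k H]
    (m : H →ₗ[k] H →ₗ[k] H) (C : Submodule k (Module.Dual k H)) : Prop :=
  IsDualSubcoalgebraOf m C ∧ C ≠ ⊥ ∧
    ∀ D : Submodule k (Module.Dual k H), IsDualSubcoalgebraOf m D → D ≤ C → D = ⊥ ∨ D = C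

/-- The dual Hopf algebra `H*` is pointed iff all its simple subcoalgebras are
one-dimensional. -/
def IsDualPointedOf {k H : Type} [CommRing k] [AddCommGroup H] [Module k H]
    (m : H →ₗ[k] H →ₗ[k] H) : Prop :=
  ∀ C : Submodule k (Module.Dual k H), IsDualSimpleSubcoalgebraOf m C → Module.finrank k C = 1

/-- `H` (with comultiplication `Δ`) has a non-trivial skew primitive element:  an element `y`
with `Δ y = y ⊗ g + h ⊗ y` for group-likes `g, h`, which does not lie in the linear span of the
group-like elements. -/
def HasNontrivialSkewPrimitiveOf {k H : Type} [CommRing k] [AddCommGroup H] [Module k H]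
    (Δ : H →ₗ[k] H ⊗[k] H) : Prop :=
  ∃ y g h : H, IsGroupLikeOf Δ g ∧ IsGroupLikeOf Δ h ∧
    Δ y = y ⊗ₜ[k] g + h ⊗ₜ[k] y ∧ y ∉ Submodule.span k {a : H | IsGroupLikeOf Δ a}

/-- The dual Hopf algebra `H*` has a non-trivial skew primitive element:  a functional `f`
which is `(g,h)`-skew primitive for algebra characters `g, h` (the group-likes of `H*`), and
does not lie in the linear span of the characters.  (The comultiplication of `H*` is dual to
the multiplication `m` of `H`, with unit `u`.) -/
def DualHasNontrivialSkewPrimitiveOf {k H : Type} [CommRing k] [AddCommGroup H] [Module k H]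
    (m : H →ₗ[k] H →ₗ[k] H) (u : H) : Prop :=
  ∃ f g h : Module.Dual k H, IsDualGroupLikeOf m u g ∧ IsDualGroupLikeOf m u h ∧
    (∀ a b : H, f (m a b) = f a * g b + h a * f b) ∧
    f ∉ Submodule.span k {φ : Module.Dual k H | IsDualGroupLikeOf m u φ}

namespace HopfFour
open Coalgebra LinearMap WithConv
set_option linter.unusedSectionVars false

section Conv
variable {k : Type} [Field k] {C : Type} [AddCommGroup C] [Module k C] [Coalgebra k C]
  {R : Type} [Ring R] [Algebra k R] {R' : Type} [Ring R'] [Algebra k R']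

/-- Convolution product of linear maps. -/
noncomputable def cv (f g : C →ₗ[k] R) : C →ₗ[k] R := (toConv f * toConv g).ofConv

/-- A functional, viewed as a scalar-valued map. -/
noncomputable def sc (R : Type) [Ring R] [Algebra k R] (f : C →ₗ[k] k) : C →ₗ[k] R :=
  Algebra.linearMap k R ∘ₗ f

@[simp] lemma sc_apply (f : C →ₗ[k] k) (c : C) : sc R f c = algebraMap k R (f c) := rfl

lemma cv_apply {ι : Type*} {c : C} (r : Repr k c ι) (f g : C →ₗ[k] R) :
    cv f g c = ∑ i ∈ r.index, f (r.left i) * g (r.right i) :=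
  r.convMul_apply (toConv f) (toConv g)

lemma cv_assoc (f g h : C →ₗ[k] R) : cv (cv f g) h = cv f (cv g h) :=
  congrArg WithConv.ofConv (mul_assoc (toConv f) (toConv g) (toConv h))

@[simp] lemma cv_counit (f : C →ₗ[k] R) : cv f (sc R counit) = f :=
  congrArg WithConv.ofConv (mul_one (toConv f))

@[simp] lemma counit_cv (f : C →ₗ[k] R) : cv (sc R counit) f = f :=
  congrArg WithConv.ofConv (one_mul (toConv f))

lemma algHom_comp_cv (h : R →ₐ[k] R') (f g : C →ₗ[k] R) :
    h.toLinearMap ∘ₗ cv f g = cv (h.toLinearMap ∘ₗ f) (h.toLinearMap ∘ₗ g) := by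
  ext c
  simp [cv_apply (ℛ k c)]

lemma algHom_comp_sc (h : R →ₐ[k] R') (f : C →ₗ[k] k) :
    h.toLinearMap ∘ₗ sc R f = sc R' f := by
  ext c; simp

lemma cv_eq_of_left_inv {f g h : C →ₗ[k] R} (h1 : cv f g = sc R counit)
    (h2 : cv g h = sc R counit) : f = h := by
  rw [← cv_counit f, ← h2, ← cv_assoc, h1, counit_cv]

lemma cv_sc_sc (f g : C →ₗ[k] k) : cv (sc R f) (sc R g) = sc R (cv f g) := by
  ext c
  simp [cv_apply (ℛ k c)]

lemma cv_comp_apply (L : R →ₗ[k] R') (f g : C →ₗ[k] R) (c : C) :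
    L (cv f g c) = ∑ i ∈ (ℛ k c).index, L (f ((ℛ k c).left i) * g ((ℛ k c).right i)) := by
  simp [cv_apply (ℛ k c)]

end Conv

section Hopf
variable {k : Type} [Field k] {A : Type} [Ring A] [HopfAlgebra k A]

local notation "𝒮" => HopfAlgebra.antipode k (A := A)

lemma cv_S_id : cv 𝒮 LinearMap.id = sc A (counit (R := k)) :=
  congrArg WithConv.ofConv (LinearMap.antipode_mul_id (R := k) (C := A))

lemma cv_id_S : cv LinearMap.id 𝒮 = sc A (counit (R := k)) :=
  congrArg WithConv.ofConv (LinearMap.id_mul_antipode (R := k) (C := A))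

lemma comul_eq_cv : comul (R := k) (A := A) =
    cv (Algebra.TensorProduct.includeLeft (R := k) (S := k) (A := A) (B := A)).toLinearMap
      (Algebra.TensorProduct.includeRight (R := k) (A := A) (B := A)).toLinearMap := by
  ext a
  rw [cv_apply (ℛ k a), ← (ℛ k a).eq]
  simp

lemma S_mul (a b : A) : 𝒮 (a * b) = 𝒮 b * 𝒮 a := HopfAlgebra.antipode_mul_antidistrib a b

lemma S_one : 𝒮 1 = 1 := HopfAlgebra.antipode_one

lemma comul_mul_repr (a b : A) : comul (R := k) (a * b) =
    ∑ i ∈ (ℛ k a).index, ∑ j ∈ (ℛ k b).index,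
      ((ℛ k a).left i * (ℛ k b).left j) ⊗ₜ[k] ((ℛ k a).right i * (ℛ k b).right j) := by
  rw [Bialgebra.comul_mul, ← (ℛ k a).eq, ← (ℛ k b).eq, Finset.sum_mul_sum]
  simp

/-- The antipode reverses comultiplication. -/
lemma comul_S (a : A) : comul (R := k) (𝒮 a) =
    ∑ i ∈ (ℛ k a).index, 𝒮 ((ℛ k a).right i) ⊗ₜ[k] 𝒮 ((ℛ k a).left i) := by
  set iL := (Algebra.TensorProduct.includeLeft (R := k) (S := k) (A := A) (B := A))
  set iR := (Algebra.TensorProduct.includeRight (R := k) (A := A) (B := A))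
  have h1 : cv (comul (R := k) ∘ₗ 𝒮) (comul (R := k)) = sc (A ⊗[k] A) (counit (R := k)) := by
    have := algHom_comp_cv (Bialgebra.comulAlgHom k A) 𝒮 LinearMap.id
    rw [cv_S_id, algHom_comp_sc] at this
    exact this.symm
  have h2 : cv (comul (R := k) (A := A)) (cv (iR.toLinearMap ∘ₗ 𝒮) (iL.toLinearMap ∘ₗ 𝒮)) =
      sc (A ⊗[k] A) (counit (R := k)) := by
    rw [comul_eq_cv, cv_assoc, ← cv_assoc iR.toLinearMap]
    have e1 := algHom_comp_cv iR LinearMap.id 𝒮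
    rw [cv_id_S, algHom_comp_sc, LinearMap.comp_id] at e1
    have e2 := algHom_comp_cv iL LinearMap.id 𝒮
    rw [cv_id_S, algHom_comp_sc, LinearMap.comp_id] at e2
    rw [← e1, counit_cv, ← e2]
  have := LinearMap.congr_fun (cv_eq_of_left_inv h1 h2) a
  rw [cv_apply (ℛ k a)] at this
  simpa [iL, iR] using this

/-- `a ↦ f(a₂) a₁`. -/
noncomputable def hitR (f : A →ₗ[k] k) : A →ₗ[k] A := cv LinearMap.id (sc A f)

/-- `a ↦ f(a₁) a₂`. -/
noncomputable def hitL (f : A →ₗ[k] k) : A →ₗ[k] A := cv (sc A f) LinearMap.id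

lemma hitR_apply {ι : Type*} {a : A} (r : Repr k a ι) (f : A →ₗ[k] k) :
    hitR f a = ∑ i ∈ r.index, f (r.right i) • r.left i := by
  rw [hitR, cv_apply r]
  exact Finset.sum_congr rfl fun i _ => by simp [Algebra.smul_def, Algebra.commutes]

lemma hitL_apply {ι : Type*} {a : A} (r : Repr k a ι) (f : A →ₗ[k] k) :
    hitL f a = ∑ i ∈ r.index, f (r.left i) • r.right i := by
  rw [hitL, cv_apply r]
  exact Finset.sum_congr rfl fun i _ => by simp [Algebra.smul_def]

lemma hitR_hitL (f h : A →ₗ[k] k) (a : A) : hitR f (hitL h a) = hitL h (hitR f a) := by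
  have e : cv (sc A h) (hitR f) = cv (hitL h) (sc A f) := by rw [hitR, hitL, cv_assoc]
  have e1 : hitR f (hitL h a) = cv (sc A h) (hitR f) a := by
    rw [hitL_apply (ℛ k a), map_sum, cv_apply (ℛ k a)]
    simp [← Algebra.smul_def]
  have e2 : hitL h (hitR f a) = cv (hitL h) (sc A f) a := by
    rw [hitR_apply (ℛ k a), map_sum, cv_apply (ℛ k a)]
    simp [← Algebra.commutes, ← Algebra.smul_def]
  rw [e1, e2, e]

lemma hitR_one_counit (a : A) : hitR (counit (R := k)) a = a := by
  simp [hitR]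

lemma hitL_counit (a : A) : hitL (counit (R := k)) a = a := by
  simp [hitL]

lemma dual_hitL (f h : A →ₗ[k] k) (a : A) : f (hitL h a) = h (hitR f a) := by
  simp [hitL_apply (ℛ k a), hitR_apply (ℛ k a), mul_comm]

lemma cv_eq_dual_hitR (f h : A →ₗ[k] k) (a : A) : cv h f a = h (hitR f a) := by
  simp [cv_apply (ℛ k a), hitR_apply (ℛ k a), mul_comm]

lemma hitR_mul (f : A →ₗ[k] k) (b a : A) : hitR f (b * a) =
    ∑ i ∈ (ℛ k b).index, ∑ j ∈ (ℛ k a).index,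
      f ((ℛ k b).right i * (ℛ k a).right j) • ((ℛ k b).left i * (ℛ k a).left j) := by
  have : ∀ c, hitR f c = TensorProduct.lift ((LinearMap.lsmul k A ∘ₗ f).flip) (comul (R := k) c) := by
    intro c
    rw [hitR_apply (ℛ k c), ← (ℛ k c).eq]
    simp
  rw [this, comul_mul_repr]
  simp

lemma hitL_mul (f : A →ₗ[k] k) (b a : A) : hitL f (b * a) =
    ∑ i ∈ (ℛ k b).index, ∑ j ∈ (ℛ k a).index,
      f ((ℛ k b).left i * (ℛ k a).left j) • ((ℛ k b).right i * (ℛ k a).right j) := by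
  have : ∀ c, hitL f c = TensorProduct.lift (LinearMap.lsmul k A ∘ₗ f) (comul (R := k) c) := by
    intro c
    rw [hitL_apply (ℛ k c), ← (ℛ k c).eq]
    simp
  rw [this, comul_mul_repr]
  simp

/-- Left integrals on `A`. -/
def IsInt (lam : A →ₗ[k] k) : Prop := ∀ a, hitR lam a = lam a • 1

/-- `a₁ λ(b a₂) = 𝒮(b₁) λ(b₂ a)`. -/
lemma IsInt.hitR_mulLeft {lam : A →ₗ[k] k} (hl : IsInt lam) (b a : A) :
    hitR (lam ∘ₗ LinearMap.mulLeft k b) a =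
      cv 𝒮 (sc A (lam ∘ₗ LinearMap.mulRight k a)) b := by
  set P : A →ₗ[k] A := ∑ j ∈ (ℛ k a).index,
    (lam ∘ₗ LinearMap.mulRight k ((ℛ k a).right j)).smulRight ((ℛ k a).left j) with hP
  have hPb : ∀ b, P b = hitR (lam ∘ₗ LinearMap.mulLeft k b) a := by
    intro b
    rw [hitR_apply (ℛ k a), hP]
    simp
  have h : cv LinearMap.id P = sc A (lam ∘ₗ LinearMap.mulRight k a) := by
    ext b
    have := hl (b * a)
    rw [hitR_mul] at this
    rw [cv_apply (ℛ k b)]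
    simp only [hPb, hitR_apply (ℛ k a), LinearMap.id_apply, Finset.mul_sum, sc_apply,
      LinearMap.comp_apply, LinearMap.mulRight_apply, LinearMap.mulLeft_apply, mul_smul_comm]
    rw [this, Algebra.algebraMap_eq_smul_one]
  rw [← h, ← cv_assoc, cv_S_id, counit_cv, hPb]

lemma IsInt.cv_zero {lam : A →ₗ[k] k} {a : A} (ha : ∀ b, hitR (lam ∘ₗ LinearMap.mulLeft k b) a = 0)
    [FiniteDimensional k A] (M : A →ₗ[k] A) : lam (cv M LinearMap.id a) = 0 := by
  have hz : ∑ i ∈ (ℛ k a).index, (ℛ k a).left i ⊗ₜ[k]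
      ((lam ∘ₗ LinearMap.mul' k A) ∘ₗ (TensorProduct.comm k A A).toLinearMap ∘ₗ
        TensorProduct.mk k A A ((ℛ k a).right i)) = 0 := by
    apply (TensorProduct.comm k _ _).injective
    apply (dualTensorHomEquiv k A A).injective
    ext b
    have := ha b
    rw [hitR_apply (ℛ k a)] at this
    simpa using this
  have := congrArg (TensorProduct.lift ((LinearMap.id (R := k) (M := Module.Dual k A)).flip ∘ₗ M)) hz
  rw [cv_apply (ℛ k a)]
  simpa using this

end Hopf

section Reps
variable {k : Type} [Field k] {A : Type} [Ring A] [HopfAlgebra k A]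
  {V : Type} [AddCommGroup V] [Module k V] {W : Type} [AddCommGroup W] [Module k W]

local notation "𝒮" => HopfAlgebra.antipode k (A := A)

/-- Tensor product of representations. -/
noncomputable def tens (σ : A →ₐ[k] Module.End k V) (τ : A →ₐ[k] Module.End k W) :
    A →ₐ[k] Module.End k (V ⊗[k] W) :=
  ((Module.endTensorEndAlgHom (R := k) (S := k) (A := k) (M := V) (N := W)).comp
    (Algebra.TensorProduct.map σ τ)).comp (Bialgebra.comulAlgHom k A)

lemma tens_apply {ι : Type*} {a : A} (r : Repr k a ι) (σ : A →ₐ[k] Module.End k V)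
    (τ : A →ₐ[k] Module.End k W) :
    tens σ τ a = ∑ i ∈ r.index, TensorProduct.map (σ (r.left i)) (τ (r.right i)) := by
  simp only [tens, AlgHom.comp_apply, Bialgebra.comulAlgHom_apply, ← r.eq, map_sum]
  rfl

/-- Dual representation. -/
noncomputable def dualRep (σ : A →ₐ[k] Module.End k V) :
    A →ₐ[k] Module.End k (Module.Dual k V) :=
  AlgHom.ofLinearMap (Module.Dual.transpose ∘ₗ σ.toLinearMap ∘ₗ 𝒮)
    (by ext f v; simp [Module.Dual.transpose_apply])
    (by intro a b; ext f v; simp [S_mul, Module.Dual.transpose_apply])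

lemma dualRep_apply (σ : A →ₐ[k] Module.End k V) (a : A) :
    dualRep σ a = Module.Dual.transpose (σ (𝒮 a)) := rfl

/-- The left regular representation. -/
noncomputable abbrev lreg (k A : Type) [Field k] [Ring A] [Algebra k A] :
    A →ₐ[k] Module.End k A := Algebra.lmul k A

/-- `V ⊗ W* ≃ Hom(W, V)`. -/
noncomputable def homEquiv (V W : Type) [AddCommGroup V] [Module k V] [AddCommGroup W]
    [Module k W] [FiniteDimensional k W] : (V ⊗[k] Module.Dual k W) ≃ₗ[k] (W →ₗ[k] V) :=
  (TensorProduct.comm k _ _).trans (dualTensorHomEquiv k W V)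

@[simp] lemma homEquiv_tmul [FiniteDimensional k W] (v : V) (f : Module.Dual k W) (w : W) :
    homEquiv V W (v ⊗ₜ[k] f) w = f w • v := by simp [homEquiv]

/-- Under `V ⊗ W* ≃ Hom(W, V)` the action is `a · F = σ(a₁) F τ(S a₂)`. -/
lemma homEquiv_tens [FiniteDimensional k W] {ι : Type*} {a : A} (r : Repr k a ι) (σ : A →ₐ[k] Module.End k V)
    (τ : A →ₐ[k] Module.End k W) (c : V ⊗[k] Module.Dual k W) :
    homEquiv V W (tens σ (dualRep τ) a c) =
      ∑ i ∈ r.index, σ (r.left i) ∘ₗ homEquiv V W c ∘ₗ τ (𝒮 (r.right i)) := by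
  induction c with
  | zero => simp
  | add x y hx hy => simp [hx, hy, Finset.sum_add_distrib, LinearMap.add_comp, LinearMap.comp_add]
  | tmul v f =>
    ext w
    simp [tens_apply r, dualRep_apply, LinearMap.sum_apply, Module.Dual.transpose_apply]

/-- The map `x ⊗ v ↦ x₁ ⊗ σ(x₂) v`. -/
noncomputable def Umap (σ : A →ₐ[k] Module.End k V) : A ⊗[k] V →ₗ[k] A ⊗[k] V :=
  TensorProduct.lift (((TensorProduct.mk k A V 1).lcomp k (A ⊗[k] V)) ∘ₗ
    (tens (lreg k A) σ).toLinearMap)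

lemma Umap_tmul (σ : A →ₐ[k] Module.End k V) (x : A) (v : V) :
    Umap σ (x ⊗ₜ v) = tens (lreg k A) σ x (1 ⊗ₜ v) := rfl

lemma Umap_comp (σ : A →ₐ[k] Module.End k V) (a : A) :
    tens (lreg k A) σ a ∘ₗ Umap σ = Umap σ ∘ₗ (TensorProduct.map (lreg k A a) LinearMap.id) := by
  ext x v
  simp [Umap_tmul]

/-- `T ↦ id ⊗ T`. -/
noncomputable def rightAct (k V W : Type) [Field k] [AddCommGroup V] [Module k V]
    [AddCommGroup W] [Module k W] : Module.End k W →ₐ[k] Module.End k (V ⊗[k] W) :=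
  (Module.endTensorEndAlgHom (R := k) (S := k) (A := k) (M := V) (N := W)).comp
    Algebra.TensorProduct.includeRight

/-- `T ↦ T ⊗ id`. -/
noncomputable def leftAct (k V W : Type) [Field k] [AddCommGroup V] [Module k V]
    [AddCommGroup W] [Module k W] : Module.End k V →ₐ[k] Module.End k (V ⊗[k] W) :=
  (Module.endTensorEndAlgHom (R := k) (S := k) (A := k) (M := V) (N := W)).comp
    Algebra.TensorProduct.includeLeft

lemma rightAct_apply (T : Module.End k W) :
    rightAct k V W T = TensorProduct.map LinearMap.id T := rfl

lemma leftAct_apply (T : Module.End k V) :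
    leftAct k V W T = TensorProduct.map T LinearMap.id := rfl

lemma tens_cv (σ : A →ₐ[k] Module.End k V) (τ : A →ₐ[k] Module.End k W) :
    (tens σ τ).toLinearMap =
      cv ((leftAct k V W).comp σ).toLinearMap ((rightAct k V W).comp τ).toLinearMap := by
  ext1 a
  rw [cv_apply (ℛ k a), AlgHom.toLinearMap_apply, tens_apply (ℛ k a)]
  refine Finset.sum_congr rfl fun i _ => ?_
  simp [leftAct_apply, rightAct_apply, Module.End.mul_eq_comp, ← TensorProduct.map_comp]

lemma Umap_surjective (σ : A →ₐ[k] Module.End k V) : Function.Surjective (Umap σ) := by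
  intro y
  induction y with
  | zero => exact ⟨0, map_zero _⟩
  | add x y hx hy =>
    obtain ⟨u, rfl⟩ := hx
    obtain ⟨v, rfl⟩ := hy
    exact ⟨u + v, map_add _ _ _⟩
  | tmul x v =>
    refine ⟨∑ i ∈ (ℛ k x).index, (ℛ k x).left i ⊗ₜ σ (𝒮 ((ℛ k x).right i)) v, ?_⟩
    have h : cv (R := Module.End k (A ⊗[k] V)) (tens (lreg k A) σ).toLinearMap
        (((rightAct k A V).comp σ).toLinearMap ∘ₗ 𝒮) =
        ((leftAct k A V).comp (lreg k A)).toLinearMap := by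
      have hr := algHom_comp_cv (R' := Module.End k (A ⊗[k] V)) ((rightAct k A V).comp σ) LinearMap.id 𝒮
      have hs := algHom_comp_sc (R' := Module.End k (A ⊗[k] V)) ((rightAct k A V).comp σ) (counit (R := k) (A := A))
      rw [cv_id_S, LinearMap.comp_id] at hr
      have hr := hs.symm.trans hr
      rw [tens_cv, cv_assoc, ← hr, cv_counit]
    have := congrArg (fun z => z (1 ⊗ₜ[k] v)) (LinearMap.congr_fun h x)
    simp only [cv_apply (ℛ k x)] at this
    simpa [Umap_tmul, rightAct_apply, leftAct_apply] using this

variable [FiniteDimensional k V] [FiniteDimensional k W] [FiniteDimensional k A]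

lemma Umap_bijective (σ : A →ₐ[k] Module.End k V) : Function.Bijective (Umap σ) :=
  ⟨LinearMap.injective_iff_surjective.2 (Umap_surjective σ), Umap_surjective σ⟩

/-- The character of a representation. -/
noncomputable def chr (σ : A →ₐ[k] Module.End k V) : A →ₗ[k] k :=
  LinearMap.trace k V ∘ₗ σ.toLinearMap

lemma chr_apply (σ : A →ₐ[k] Module.End k V) (a : A) : chr σ a = LinearMap.trace k V (σ a) := rfl

lemma chr_tens (σ : A →ₐ[k] Module.End k V) (τ : A →ₐ[k] Module.End k W) :
    chr (tens σ τ) = cv (chr σ) (chr τ) := by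
  ext a
  simp [chr_apply, tens_apply (ℛ k a), cv_apply (ℛ k a), LinearMap.trace_tensorProduct']

/-- The regular character absorbs every character. -/
lemma chr_lreg_cv (σ : A →ₐ[k] Module.End k V) :
    cv (chr (lreg k A)) (chr σ) = (Module.finrank k V : k) • chr (lreg k A) := by
  ext a
  rw [← chr_tens, chr_apply]
  have h := Umap_comp σ a
  let e := LinearEquiv.ofBijective (Umap σ) (Umap_bijective σ)
  have h2 : tens (lreg k A) σ a = e.conj (TensorProduct.map (lreg k A a) LinearMap.id) := by
    rw [LinearEquiv.conj_apply]
    apply LinearMap.ext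
    intro y
    obtain ⟨z, rfl⟩ := e.surjective y
    have := LinearMap.congr_fun h z
    simp only [LinearMap.comp_apply] at this
    simp only [LinearMap.comp_apply, LinearEquiv.coe_coe, LinearEquiv.symm_apply_apply]
    exact this
  rw [h2, LinearMap.trace_conj', LinearMap.trace_tensorProduct']
  simp [chr_apply, mul_comm]

/-- Left integrals in the algebra exist. -/
lemma exists_left_integral_elem [Nontrivial A] :
    ∃ t : A, t ≠ 0 ∧ ∀ a, a * t = counit (R := k) a • t := by
  let σ := dualRep (lreg k A)
  let c : A ⊗[k] Module.Dual k A := (homEquiv A A).symm LinearMap.id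
  have hc : ∀ a, tens (lreg k A) σ a c = counit (R := k) a • c := by
    intro a
    apply (homEquiv A A).injective
    rw [homEquiv_tens (ℛ k a)]
    ext x
    have h := HopfAlgebra.sum_mul_antipode_eq_smul (ℛ k a)
    have := congrArg (· * x) h
    simp only [Finset.sum_mul] at this
    simpa [c, LinearMap.sum_apply, mul_assoc] using this
  have hc0 : c ≠ 0 := by
    intro h
    have : (LinearMap.id : A →ₗ[k] A) = 0 := (LinearEquiv.map_eq_zero_iff _).1 h
    exact one_ne_zero (α := A) (LinearMap.congr_fun this 1)
  obtain ⟨z, hz⟩ := (Umap_bijective σ).2 c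
  have hz2 : ∀ a, TensorProduct.map (lreg k A a) LinearMap.id z = counit (R := k) a • z := by
    intro a
    apply (Umap_bijective σ).1
    have := LinearMap.congr_fun (Umap_comp σ a) z
    simp only [LinearMap.comp_apply] at this
    rw [← this, hz, hc, map_smul, hz]
  obtain ⟨x, hf⟩ : ∃ x, homEquiv A A z x ≠ 0 := by
    by_contra! h
    have h1 : homEquiv A A z = 0 := LinearMap.ext h
    have h2 := (LinearEquiv.map_eq_zero_iff _).1 h1
    exact hc0 (by rw [← hz, h2, map_zero])
  refine ⟨_, hf, fun a => ?_⟩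
  rw [← LinearMap.smul_apply, ← map_smul, ← hz2]
  clear * -
  generalize z = y
  induction y with
  | zero => simp
  | add x y hx hy => simp only [map_add, LinearMap.add_apply, mul_add, hx, hy]
  | tmul v f => simp

end Reps

section Integrals
variable {k : Type} [Field k] {A : Type} [Ring A] [HopfAlgebra k A]

local notation "𝒮" => HopfAlgebra.antipode k (A := A)

lemma hitR_comp_apply (h f : A →ₗ[k] k) (a : A) : hitR (h ∘ₗ hitR f) a = hitR h (hitR f a) := by
  have e : h ∘ₗ hitR f = cv h f := by ext x; simp [cv_eq_dual_hitR]
  have e2 : hitR h (hitR f a) = cv (hitR h) (sc A f) a := by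
    rw [hitR_apply (ℛ k a) f, map_sum, cv_apply (ℛ k a)]
    simp [← Algebra.commutes, ← Algebra.smul_def]
  rw [e2, e, hitR, hitR, cv_assoc, cv_sc_sc]

lemma hitR_eq_cv (h f : A →ₗ[k] k) : hitR (cv h f) = hitR h ∘ₗ hitR f := by
  have e : h ∘ₗ hitR f = cv h f := by ext x; simp [cv_eq_dual_hitR]
  ext a
  rw [← e, hitR_comp_apply, LinearMap.comp_apply]

lemma hitR_antipode (f : A →ₗ[k] k) (a : A) : hitR f (𝒮 a) = 𝒮 (hitL (f ∘ₗ 𝒮) a) := by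
  have : ∀ c, hitR f c = TensorProduct.lift ((LinearMap.lsmul k A ∘ₗ f).flip) (comul (R := k) c) := by
    intro c
    rw [hitR_apply (ℛ k c), ← (ℛ k c).eq]
    simp
  rw [this, comul_S, hitL_apply (ℛ k a)]
  simp

lemma hitL_antipode (f : A →ₗ[k] k) (a : A) : hitL f (𝒮 a) = 𝒮 (hitR (f ∘ₗ 𝒮) a) := by
  have : ∀ c, hitL f c = TensorProduct.lift (LinearMap.lsmul k A ∘ₗ f) (comul (R := k) c) := by
    intro c
    rw [hitL_apply (ℛ k c), ← (ℛ k c).eq]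
    simp
  rw [this, comul_S, hitR_apply (ℛ k a)]
  simp

lemma comul_eq_tmul_of_hitR [FiniteDimensional k A] {g : A}
    (hg : ∀ f : A →ₗ[k] k, hitR f g = f g • g) : comul (R := k) g = g ⊗ₜ[k] g := by
  apply (TensorProduct.congr (LinearEquiv.refl k A) (Module.evalEquiv k A)).injective
  apply (homEquiv A (Module.Dual k A)).injective
  ext f
  have := hg f
  rw [hitR_apply (ℛ k g)] at this
  rw [← (ℛ k g).eq]
  simpa using this

variable [FiniteDimensional k A] {lam : A →ₗ[k] k}

lemma IsInt.nondeg (hl : IsInt lam) (h0 : lam ≠ 0) {a : A} (ha : ∀ b, lam (b * a) = 0) : a = 0 := by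
  have h1 : lam ∘ₗ LinearMap.mulRight k a = 0 := by ext b; simpa using ha b
  have h2 : ∀ b, hitR (lam ∘ₗ LinearMap.mulLeft k b) a = 0 := by
    intro b
    rw [hl.hitR_mulLeft, h1, cv_apply (ℛ k b)]
    simp
  obtain ⟨b, hb⟩ : ∃ b, lam b ≠ 0 := by
    by_contra! h
    exact h0 (LinearMap.ext h)
  by_contra hne
  obtain ⟨f, hf⟩ : ∃ f : Module.Dual k A, f a ≠ 0 := by
    by_contra! h
    exact hne ((Module.forall_dual_apply_eq_zero_iff k a).1 h)
  have := IsInt.cv_zero h2 (cv (f.smulRight b) 𝒮)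
  rw [cv_assoc, cv_S_id, cv_counit] at this
  simp [hf, hb] at this

lemma IsInt.antipode_surjective (hl : IsInt lam) (h0 : lam ≠ 0) : Function.Surjective 𝒮 := by
  rw [← LinearMap.range_eq_top]
  by_contra hne
  obtain ⟨f, hf0, hf⟩ := Submodule.exists_le_ker_of_lt_top _ (lt_top_iff_ne_top.2 hne)
  apply hf0
  ext a
  have h : hitL f a = 0 := by
    refine hl.nondeg h0 fun b => ?_
    have := dual_hitL (lam ∘ₗ LinearMap.mulLeft k b) f a
    rw [hl.hitR_mulLeft, cv_comp_apply] at this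
    rw [← LinearMap.mulLeft_apply (R := k), ← LinearMap.comp_apply, this]
    refine Finset.sum_eq_zero fun i _ => ?_
    rw [sc_apply, ← Algebra.commutes, ← Algebra.smul_def, map_smul]
    have : f (𝒮 ((ℛ k b).left i)) = 0 := hf ⟨_, rfl⟩
    rw [this, smul_zero]
  have := dual_hitL (counit (R := k)) f a
  rw [h, hitR_one_counit, map_zero] at this
  exact this.symm

lemma IsInt.antipode_bijective (hl : IsInt lam) (h0 : lam ≠ 0) : Function.Bijective 𝒮 :=
  ⟨LinearMap.injective_iff_surjective.2 (hl.antipode_surjective h0), hl.antipode_surjective h0⟩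

/-- The right regular pairing `a ↦ λ(· a)`. -/
noncomputable def pairR (lam : A →ₗ[k] k) : A →ₗ[k] Module.Dual k A :=
  ((LinearMap.mul k A).compr₂ lam).flip

/-- The left regular pairing `a ↦ λ(a ·)`. -/
noncomputable def pairL (lam : A →ₗ[k] k) : A →ₗ[k] Module.Dual k A :=
  (LinearMap.mul k A).compr₂ lam

lemma IsInt.pairR_bijective (hl : IsInt lam) (h0 : lam ≠ 0) : Function.Bijective (pairR lam) := by
  have h : Function.Injective (pairR lam) :=
    (injective_iff_map_eq_zero _).2 fun a ha => hl.nondeg h0 fun b => LinearMap.congr_fun ha b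
  exact ⟨h, (LinearMap.injective_iff_surjective_of_finrank_eq_finrank
    (Subspace.dual_finrank_eq).symm).1 h⟩

lemma IsInt.nondeg' (hl : IsInt lam) (h0 : lam ≠ 0) {a : A} (ha : ∀ b, lam (a * b) = 0) : a = 0 := by
  refine (Module.forall_dual_apply_eq_zero_iff k a).1 fun f => ?_
  obtain ⟨c, rfl⟩ := (hl.pairR_bijective h0).2 f
  exact ha c

lemma IsInt.pairL_bijective (hl : IsInt lam) (h0 : lam ≠ 0) : Function.Bijective (pairL lam) := by
  have h : Function.Injective (pairL lam) :=
    (injective_iff_map_eq_zero _).2 fun a ha => hl.nondeg' h0 fun b => LinearMap.congr_fun ha b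
  exact ⟨h, (LinearMap.injective_iff_surjective_of_finrank_eq_finrank
    (Subspace.dual_finrank_eq).symm).1 h⟩

end Integrals

/-- A nonzero left integral `λ` on `A` with the element `t` normalised by `λ(b t) = ε(b)`. -/
structure IntData (k A : Type) [Field k] [Ring A] [HopfAlgebra k A] where
  lam : A →ₗ[k] k
  t : A
  isInt : IsInt lam
  ne_zero : lam ≠ 0
  lam_mul_t : ∀ b, lam (b * t) = counit (R := k) b

namespace IntData
variable {k : Type} [Field k] {A : Type} [Ring A] [HopfAlgebra k A] [FiniteDimensional k A]

local notation "𝒮" => HopfAlgebra.antipode k (A := A)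

lemma exists_of_isInt {lam : A →ₗ[k] k} (hl : IsInt lam) (h0 : lam ≠ 0) :
    Nonempty (IntData k A) := by
  obtain ⟨t, ht⟩ := (hl.pairR_bijective h0).2 (counit (R := k))
  exact ⟨⟨lam, t, hl, h0, fun b => LinearMap.congr_fun ht b⟩⟩

variable (d : IntData k A)

lemma cancelR {a b : A} (h : ∀ c, d.lam (c * a) = d.lam (c * b)) : a = b :=
  (d.isInt.pairR_bijective d.ne_zero).1 (LinearMap.ext h)

lemma cancelL {a b : A} (h : ∀ c, d.lam (a * c) = d.lam (b * c)) : a = b :=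
  (d.isInt.pairL_bijective d.ne_zero).1 (LinearMap.ext h)

lemma mul_t (a : A) : a * d.t = counit (R := k) a • d.t :=
  d.cancelR fun c => by
    rw [← mul_assoc, d.lam_mul_t, Bialgebra.counit_mul, mul_smul_comm, map_smul, d.lam_mul_t,
      smul_eq_mul, mul_comm]

lemma lam_t : d.lam d.t = 1 := by
  have := d.lam_mul_t 1
  rwa [one_mul, Bialgebra.counit_one] at this

lemma S_eq (b : A) : 𝒮 b = hitR (d.lam ∘ₗ LinearMap.mulLeft k b) d.t := by
  have h : d.lam ∘ₗ LinearMap.mulRight k d.t = counit (R := k) := by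
    ext x; simp [d.lam_mul_t]
  rw [d.isInt.hitR_mulLeft, h, cv_counit]

lemma eq_smul_t {x : A} (hx : ∀ a, a * x = counit (R := k) a • x) : x = d.lam x • d.t :=
  d.cancelR fun c => by
    rw [hx, map_smul, mul_smul_comm, map_smul, d.lam_mul_t, smul_eq_mul, smul_eq_mul, mul_comm]

lemma t_mul (a : A) : d.t * a = d.lam (d.t * a) • d.t :=
  d.eq_smul_t fun b => by rw [← mul_assoc, d.mul_t, smul_mul_assoc]

/-- The distinguished character. -/
noncomputable def α : A →ₐ[k] k :=
  AlgHom.ofLinearMap (d.lam ∘ₗ LinearMap.mulLeft k d.t) (by simp [d.lam_t]) (by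
    intro a b
    simp only [LinearMap.comp_apply, LinearMap.mulLeft_apply]
    rw [← mul_assoc, d.t_mul a, smul_mul_assoc, map_smul, smul_eq_mul, map_smul, d.lam_t]
    simp)

lemma α_apply (a : A) : d.α a = d.lam (d.t * a) := rfl

lemma t_mul' (a : A) : d.t * a = d.α a • d.t := d.t_mul a

lemma exists_pairL (κ : A →ₗ[k] k) : ∃ b, ∀ x, κ x = d.lam (b * x) := by
  obtain ⟨b, hb⟩ := (d.isInt.pairL_bijective d.ne_zero).2 κ
  exact ⟨b, fun x => (LinearMap.congr_fun hb x).symm⟩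

include d in
lemma S_bijective : Function.Bijective 𝒮 := d.isInt.antipode_bijective d.ne_zero

lemma isInt_unique {κ : A →ₗ[k] k} (hκ : IsInt κ) : κ = κ d.t • d.lam := by
  set κ' := κ - κ d.t • d.lam with hκ'
  have h1 : IsInt κ' := by
    intro a
    have h : ∀ f : A →ₗ[k] k, hitR f a = ∑ i ∈ (ℛ k a).index, f ((ℛ k a).right i) • (ℛ k a).left i :=
      fun f => hitR_apply _ f
    have e : hitR κ' a = hitR κ a - κ d.t • hitR d.lam a := by
      simp [h, hκ', sub_smul, Finset.sum_sub_distrib, Finset.smul_sum, smul_smul]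
    rw [e, hκ, d.isInt, hκ']
    simp [sub_smul, smul_smul]
  have h2 : κ' d.t = 0 := by simp [hκ', d.lam_t]
  obtain ⟨b, hb⟩ := d.exists_pairL κ'
  have h3 : 𝒮 b = 0 := by
    refine (Module.forall_dual_apply_eq_zero_iff k _).1 fun f => ?_
    rw [d.S_eq, ← dual_hitL]
    simp only [LinearMap.comp_apply, LinearMap.mulLeft_apply]
    rw [← hb, dual_hitL, h1, h2]
    simp
  have h4 : b = 0 := d.S_bijective.1 (by rw [h3, map_zero])
  have h5 : κ' = 0 := by ext x; simp [hb, h4]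
  exact sub_eq_zero.1 h5

/-- The distinguished group-like element. -/
noncomputable def g : A := hitL d.lam d.t

lemma hitL_lam (a : A) : hitL d.lam a = d.lam a • d.g := by
  rw [← sub_eq_zero]
  refine (Module.forall_dual_apply_eq_zero_iff k _).1 fun f => ?_
  have h : IsInt (d.lam ∘ₗ hitR f) := by
    intro a
    rw [hitR_comp_apply, d.isInt]
    rfl
  have := LinearMap.congr_fun (d.isInt_unique h) a
  simp only [LinearMap.comp_apply, LinearMap.smul_apply, ← dual_hitL, smul_eq_mul] at this
  rw [map_sub, this, map_smul, g, smul_eq_mul, mul_comm, sub_self]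

lemma comul_g : comul (R := k) d.g = d.g ⊗ₜ[k] d.g := by
  refine comul_eq_tmul_of_hitR fun f => ?_
  rw [g, hitR_hitL, d.hitL_lam, ← dual_hitL]
  rfl

lemma counit_g : counit (R := k) d.g = 1 := by
  rw [g, dual_hitL, hitR_one_counit, d.lam_t]

lemma isGroupLike_g : IsGroupLikeElem k d.g := ⟨d.counit_g, d.comul_g⟩

lemma lam_S (c : A) : d.lam (𝒮 c) = d.lam (c * d.g) := by
  rw [d.S_eq, ← dual_hitL]
  rfl

lemma g_mul_S : d.g * 𝒮 d.g = 1 := by simpa using d.isGroupLike_g.mul_antipode_cancel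
lemma S_mul_g : 𝒮 d.g * d.g = 1 := by simpa using d.isGroupLike_g.antipode_mul_cancel

/-- The Nakayama automorphism, as a linear equivalence. -/
noncomputable def ηe : A ≃ₗ[k] A :=
  (LinearEquiv.ofBijective _ (d.isInt.pairR_bijective d.ne_zero)).trans
    (LinearEquiv.ofBijective _ (d.isInt.pairL_bijective d.ne_zero)).symm

lemma lam_ηe (a x : A) : d.lam (d.ηe a * x) = d.lam (x * a) := by
  have : pairL d.lam (d.ηe a) = pairR d.lam a := by
    simp only [ηe, LinearEquiv.trans_apply]
    exact LinearEquiv.apply_symm_apply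
      (LinearEquiv.ofBijective _ (d.isInt.pairL_bijective d.ne_zero)) _
  exact LinearMap.congr_fun this x

/-- The Nakayama automorphism: `λ(x a) = λ(η(a) x)`. -/
noncomputable def η : A ≃ₐ[k] A :=
  AlgEquiv.ofLinearEquiv d.ηe
    (d.cancelL fun c => by rw [d.lam_ηe, mul_one, one_mul])
    (fun a b => d.cancelL fun c => by
      rw [d.lam_ηe, mul_assoc, d.lam_ηe, mul_assoc (d.ηe b), d.lam_ηe, mul_assoc])

lemma lam_η (a x : A) : d.lam (d.η a * x) = d.lam (x * a) := d.lam_ηe a x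

/-- Winding maps of the distinguished character. -/
noncomputable def R : A →ₗ[k] A := hitR d.α.toLinearMap
noncomputable def L : A →ₗ[k] A := hitL (d.α.toLinearMap ∘ₗ 𝒮)

lemma SSη (a : A) : 𝒮 (𝒮 (d.η a)) = d.R a := by
  have h := d.isInt.hitR_mulLeft d.t a
  have h1 : d.lam ∘ₗ LinearMap.mulLeft k d.t = d.α.toLinearMap := by ext x; simp [d.α_apply]
  rw [h1] at h
  rw [R, h, d.S_eq (d.η a), hitR_apply (ℛ k d.t), cv_apply (ℛ k d.t), map_sum]
  refine Finset.sum_congr rfl fun i _ => ?_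
  simp only [LinearMap.comp_apply, LinearMap.mulLeft_apply, LinearMap.mulRight_apply, d.lam_η,
    sc_apply, map_smul]
  rw [← Algebra.commutes, ← Algebra.smul_def]

lemma ηSη (a : A) : d.η (𝒮 (d.η a)) = 𝒮 (d.g * a * 𝒮 d.g) :=
  d.cancelL fun c => by
    obtain ⟨b, rfl⟩ := d.S_bijective.2 c
    rw [d.lam_η, ← S_mul, d.lam_S, mul_assoc, d.lam_η, ← S_mul, d.lam_S]
    simp only [mul_assoc]
    rw [d.S_mul_g, mul_one]

lemma RS (a : A) : d.R (𝒮 a) = 𝒮 (d.L a) := hitR_antipode _ a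

lemma α_S_S (a : A) : d.α (𝒮 (𝒮 a)) = d.α a := by
  have e1 := algHom_comp_cv d.α LinearMap.id 𝒮
  rw [cv_id_S, algHom_comp_sc, LinearMap.comp_id] at e1
  have e2 : cv (d.α.toLinearMap ∘ₗ 𝒮) (d.α.toLinearMap ∘ₗ 𝒮 ∘ₗ 𝒮) = sc k (counit (R := k)) := by
    ext x
    have h := HopfAlgebra.sum_mul_antipode_eq_algebraMap_counit (R := k) (ℛ k x)
    have := congrArg (fun z => d.α (𝒮 z)) h
    simp only [map_sum, S_mul, map_mul] at this
    rw [cv_apply (ℛ k x)]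
    simp only [LinearMap.comp_apply, AlgHom.toLinearMap_apply]
    simpa [mul_comm, Algebra.algebraMap_eq_smul_one, S_one] using this
  exact (LinearMap.congr_fun (cv_eq_of_left_inv e1.symm e2) a).symm

lemma LS (a : A) : d.L (𝒮 a) = 𝒮 (d.R a) := by
  have : (d.α.toLinearMap ∘ₗ 𝒮) ∘ₗ 𝒮 = d.α.toLinearMap := by
    ext x; simp [d.α_S_S]
  rw [L, hitL_antipode, this, R]

lemma RL (a : A) : d.R (d.L a) = d.L (d.R a) := hitR_hitL _ _ a

lemma SS_g : 𝒮 (𝒮 d.g) = d.g := by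
  have h := congrArg 𝒮 d.g_mul_S
  rw [S_mul, S_one] at h
  calc 𝒮 (𝒮 d.g) = 𝒮 (𝒮 d.g) * (𝒮 d.g * d.g) := by rw [d.S_mul_g, mul_one]
    _ = d.g := by rw [← mul_assoc, h, one_mul]

/-- Radford's formula. -/
lemma radford (a : A) : d.L (d.R a) = d.g * 𝒮 (𝒮 (𝒮 (𝒮 a))) * 𝒮 d.g := by
  have hg := d.SS_g
  have h : 𝒮 (𝒮 (d.η (𝒮 (d.η a)))) = 𝒮 (𝒮 (𝒮 (d.g * a * 𝒮 d.g))) := by rw [d.ηSη]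
  rw [d.SSη, d.RS] at h
  have h2 := d.S_bijective.1 h
  have h3 : d.L (𝒮 (𝒮 (d.η a))) = 𝒮 (𝒮 (𝒮 (𝒮 (d.g * a * 𝒮 d.g)))) := by
    rw [d.LS, d.RS, h2]
  rw [d.SSη] at h3
  rw [h3]
  simp only [S_mul, hg]

lemma S_pow {N : ℕ} (hg : d.g ^ N = 1) (hR : (d.R : Module.End k A) ^ N = 1) :
    (𝒮 : Module.End k A) ^ (4 * N) = 1 := by
  set s : Module.End k A := 𝒮 with hs
  set L : Module.End k A := d.L with hL
  set R : Module.End k A := d.R with hR'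
  set G : Module.End k A := LinearMap.mulLeft k d.g * LinearMap.mulRight k (𝒮 d.g) with hG
  have hsL : SemiconjBy s L R := LinearMap.ext fun a => (d.RS a).symm
  have hLN : L ^ N = 1 := by
    have h := hsL.pow_right N
    rw [hR, SemiconjBy, one_mul] at h
    ext a
    exact d.S_bijective.1 (LinearMap.congr_fun h a)
  have hLR : Commute L R := LinearMap.ext fun a => (d.RL a).symm
  have hGs : L * R = G * s ^ 4 := by
    ext a
    simp only [Module.End.mul_apply, pow_succ, pow_zero, one_mul, hG, hs, mulLeft_apply,
      mulRight_apply]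
    rw [← mul_assoc]
    exact d.radford a
  have hcom : Commute G (s ^ 2) := by
    ext a
    simp only [Module.End.mul_apply, pow_succ, pow_zero, one_mul, hG, hs, mulLeft_apply,
      mulRight_apply, S_mul, d.SS_g]
  have hcom4 : Commute G (s ^ 4) := by
    rw [show 4 = 2 * 2 from rfl, pow_mul]
    exact hcom.pow_right 2
  have hGN : G ^ N = 1 := by
    have hc : Commute (LinearMap.mulLeft k d.g) (LinearMap.mulRight k (𝒮 d.g)) :=
      LinearMap.commute_mulLeft_right ..
    have h1 : (𝒮 d.g) ^ N = 1 := by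
      have hc : Commute d.g (𝒮 d.g) := by rw [Commute, SemiconjBy, d.g_mul_S, d.S_mul_g]
      have := hc.mul_pow N
      rw [d.g_mul_S, one_pow, hg, one_mul] at this
      exact this.symm
    rw [hG, hc.mul_pow, LinearMap.pow_mulLeft, LinearMap.pow_mulRight, hg, h1,
      LinearMap.mulLeft_one, LinearMap.mulRight_one]
    rfl
  have := congrArg (· ^ N) hGs
  simp only [hLR.mul_pow, hcom4.mul_pow, hLN, hR, hGN, one_mul] at this
  rw [pow_mul, ← this]

/-- The trace formula `Tr(L_c ∘ S²) = λ(c) ε(t)`. -/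
lemma trace_mulLeft_SS (c : A) :
    LinearMap.trace k A (LinearMap.mulLeft k c ∘ₗ 𝒮 ∘ₗ 𝒮) = d.lam c * counit (R := k) d.t := by
  have h : LinearMap.mulLeft k c ∘ₗ 𝒮 ∘ₗ 𝒮 = ∑ i ∈ (ℛ k d.t).index,
      (d.lam ∘ₗ LinearMap.mulRight k ((ℛ k d.t).right i)).smulRight
        (c * 𝒮 ((ℛ k d.t).left i)) := by
    ext x
    simp only [LinearMap.comp_apply, LinearMap.mulLeft_apply]
    rw [d.S_eq x, hitR_apply (ℛ k d.t)]
    simp [Finset.mul_sum, LinearMap.sum_apply]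
  have h2 := HopfAlgebra.sum_antipode_mul_eq_smul (ℛ k d.t)
  rw [h, map_sum]
  simp only [LinearMap.trace_smulRight, LinearMap.comp_apply, LinearMap.mulRight_apply, mul_assoc]
  rw [← map_sum, ← Finset.mul_sum, h2, mul_smul_comm, mul_one, map_smul, smul_eq_mul, mul_comm]

end IntData

/-- The linear dual, with convolution product. -/
def DualH (k A : Type) [Field k] [Ring A] [HopfAlgebra k A] : Type := WithConv (A →ₗ[k] k)

noncomputable instance (k A : Type) [Field k] [Ring A] [HopfAlgebra k A] : Ring (DualH k A) :=
  inferInstanceAs (Ring (WithConv (A →ₗ[k] k)))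

noncomputable instance (k A : Type) [Field k] [Ring A] [HopfAlgebra k A] :
    Algebra k (DualH k A) :=
  inferInstanceAs (Algebra k (WithConv (A →ₗ[k] k)))

namespace DualH
variable {k : Type} [Field k] {A : Type} [Ring A] [HopfAlgebra k A]
  {V : Type} [AddCommGroup V] [Module k V] {W : Type} [AddCommGroup W] [Module k W]

local notation "𝒮" => HopfAlgebra.antipode k (A := A)

/-- The underlying functional. -/
noncomputable def eqv : DualH k A ≃ₗ[k] (A →ₗ[k] k) where
  toFun := WithConv.ofConv
  invFun := WithConv.toConv
  map_add' _ _ := rfl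
  map_smul' _ _ := rfl
  left_inv _ := rfl
  right_inv _ := rfl

/-- The underlying functional. -/
noncomputable abbrev fn (f : DualH k A) : A →ₗ[k] k := eqv f

/-- The element of the dual given by a functional. -/
noncomputable abbrev mk (f : A →ₗ[k] k) : DualH k A := eqv.symm f

lemma fn_injective : Function.Injective (fn (k := k) (A := A)) := eqv.injective

lemma mul_fn (f h : DualH k A) : (f * h).fn = cv f.fn h.fn := rfl

lemma one_fn : (1 : DualH k A).fn = counit (R := k) := rfl

variable [FiniteDimensional k A]

/-- `V ⊗ A° ≃ Hom(A, V)`. -/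
noncomputable def sliceEquiv (V : Type) [AddCommGroup V] [Module k V] :
    (V ⊗[k] DualH k A) ≃ₗ[k] (A →ₗ[k] V) :=
  (TensorProduct.congr (LinearEquiv.refl k V) eqv).trans
    (homEquiv V A)

/-- Evaluation of the second leg. -/
noncomputable def slice (b : A) : (V ⊗[k] DualH k A) →ₗ[k] V :=
  LinearMap.applyₗ b ∘ₗ (sliceEquiv V).toLinearMap

@[simp] lemma slice_tmul (b : A) (v : V) (f : DualH k A) : slice b (v ⊗ₜ[k] f) = f.fn b • v := by
  simp [slice, sliceEquiv]

lemma slice_ext {x y : V ⊗[k] DualH k A} (h : ∀ b, slice b x = slice b y) : x = y :=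
  (sliceEquiv V).injective (LinearMap.ext h)

/-- Right translation. -/
noncomputable def tr (b : A) : DualH k A →ₗ[k] DualH k A :=
  eqv.symm.toLinearMap ∘ₗ
    ((LinearMap.mulRight k b).lcomp k k) ∘ₗ (eqv (k := k) (A := A)).toLinearMap

@[simp] lemma tr_apply (b a : A) (f : DualH k A) : (tr b f).fn a = f.fn (a * b) := rfl

noncomputable def trHom : DualH k A →ₗ[k] (A →ₗ[k] DualH k A) :=
  LinearMap.mk₂ k (fun f b => tr b f) (fun _ _ _ => map_add _ _ _) (fun _ _ _ => map_smul _ _ _)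
    (fun f b c => by apply fn_injective; ext a; simp [mul_add])
    (fun s f b => by apply fn_injective; ext a; simp)

noncomputable instance : CoalgebraStruct k (DualH k A) where
  comul := (sliceEquiv (DualH k A)).symm.toLinearMap ∘ₗ trHom
  counit := LinearMap.applyₗ (1 : A) ∘ₗ (eqv (k := k) (A := A)).toLinearMap

@[simp] lemma slice_comul (b : A) (f : DualH k A) : slice b (comul (R := k) f) = tr b f := by
  show (sliceEquiv (DualH k A)) ((sliceEquiv (DualH k A)).symm (trHom f)) b = tr b f
  rw [LinearEquiv.apply_symm_apply]
  rfl

@[simp] lemma counit_apply (f : DualH k A) : counit (R := k) f = f.fn 1 := rfl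

lemma slice_map_left (T : V →ₗ[k] W) (b : A) (x : V ⊗[k] DualH k A) :
    slice b (TensorProduct.map T LinearMap.id x) = T (slice b x) := by
  induction x with
  | zero => simp
  | add x y hx hy => simp [hx, hy]
  | tmul v f => simp

lemma slice_map_tr (c b : A) (x : V ⊗[k] DualH k A) :
    slice b (TensorProduct.map LinearMap.id (tr c) x) = slice (b * c) x := by
  induction x with
  | zero => simp
  | add x y hx hy => simp [hx, hy]
  | tmul v f => simp

lemma slice_assoc_symm (c : A) (y : V ⊗[k] (W ⊗[k] DualH k A)) :
    slice c ((TensorProduct.assoc k V W (DualH k A)).symm y) =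
      TensorProduct.map LinearMap.id (slice c) y := by
  induction y with
  | zero => simp
  | add x y hx hy => simp [hx, hy]
  | tmul v y =>
    induction y with
    | zero => simp
    | add x y hx hy => simp only [TensorProduct.tmul_add, map_add, hx, hy]
    | tmul w f => simp

noncomputable instance : Coalgebra k (DualH k A) where
  coassoc := by
    ext1 f
    rw [LinearMap.comp_apply, LinearEquiv.coe_coe, LinearMap.comp_apply, LinearMap.comp_apply,
      ← LinearEquiv.eq_symm_apply]
    refine slice_ext fun c => slice_ext fun b => ?_
    have h1 : slice c ((comul (R := k) (A := DualH k A)).rTensor (DualH k A) (comul (R := k) f)) =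
        comul (R := k) (tr c f) := by
      rw [LinearMap.rTensor, slice_map_left, slice_comul]
    have h2 : slice c ((TensorProduct.assoc k (DualH k A) (DualH k A) (DualH k A)).symm
        ((comul (R := k) (A := DualH k A)).lTensor (DualH k A) (comul (R := k) f))) =
        TensorProduct.map LinearMap.id (tr c) (comul (R := k) f) := by
      rw [slice_assoc_symm, LinearMap.lTensor, ← LinearMap.comp_apply, ← TensorProduct.map_comp]
      congr 2
      ext1 h
      simp
    rw [h1, h2, slice_map_tr, slice_comul, slice_comul]
    apply fn_injective
    ext a
    simp [mul_assoc]
  rTensor_counit_comp_comul := by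
    ext1 f
    refine slice_ext fun b => ?_
    rw [LinearMap.comp_apply, LinearMap.rTensor, slice_map_left, slice_comul]
    simp
  lTensor_counit_comp_comul := by
    ext1 f
    have h : ∀ x : DualH k A ⊗[k] DualH k A,
        (counit (R := k) (A := DualH k A)).lTensor (DualH k A) x = slice 1 x ⊗ₜ[k] (1 : k) := by
      intro x
      induction x with
      | zero => simp
      | add x y hx hy => simp [hx, hy, TensorProduct.add_tmul]
      | tmul v f =>
        simp only [lTensor_tmul, counit_apply, slice_tmul, TensorProduct.smul_tmul]
        simp
    rw [LinearMap.comp_apply, h, slice_comul]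
    congr 1
    apply fn_injective
    ext a
    simp

lemma slice_mul (b : A) (x y : DualH k A ⊗[k] DualH k A) :
    slice b (x * y) = ∑ i ∈ (ℛ k b).index, slice ((ℛ k b).left i) x * slice ((ℛ k b).right i) y := by
  induction x with
  | zero =>
    have e : (0 : DualH k A ⊗[k] DualH k A) * y = 0 := zero_mul y
    rw [e]
    simp
  | add x x' hx hx' =>
    have e : (x + x') * y = x * y + x' * y := add_mul x x' y
    rw [e]
    simp only [map_add, hx, hx', add_mul, Finset.sum_add_distrib]
  | tmul v f =>
    induction y with
    | zero =>
      have e : (v ⊗ₜ[k] f) * (0 : DualH k A ⊗[k] DualH k A) = 0 := mul_zero _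
      rw [e]
      simp
    | add y y' hy hy' =>
      have e : (v ⊗ₜ[k] f) * (y + y') = v ⊗ₜ[k] f * y + v ⊗ₜ[k] f * y' := mul_add _ _ _
      rw [e]
      simp only [map_add, hy, hy', mul_add, Finset.sum_add_distrib]
    | tmul w h =>
      simp only [Algebra.TensorProduct.tmul_mul_tmul, slice_tmul, mul_fn, cv_apply (ℛ k b),
        Finset.sum_smul, smul_mul_smul_comm]

noncomputable instance : Bialgebra k (DualH k A) :=
  Bialgebra.mk' k (DualH k A)
    (by rw [counit_apply, one_fn, Bialgebra.counit_one])
    (by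
      intro f h
      simp only [counit_apply]
      have e : ∀ f : A →ₗ[k] k, hitR f 1 = f 1 • 1 := fun f => by
        have : hitR f 1 = TensorProduct.lift ((LinearMap.lsmul k A ∘ₗ f).flip) (comul (R := k) 1) := by
          rw [hitR_apply (ℛ k 1), ← (ℛ k 1).eq]
          simp
        rw [this, Bialgebra.comul_one, Algebra.TensorProduct.one_def]
        simp
      rw [mul_fn, cv_eq_dual_hitR, e, map_smul, smul_eq_mul, mul_comm])
    (by
      refine slice_ext fun b => ?_
      rw [slice_comul, Algebra.TensorProduct.one_def, slice_tmul, one_fn]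
      apply fn_injective
      ext a
      simp [one_fn, mul_comm])
    (by
      intro f h
      refine slice_ext fun b => ?_
      rw [slice_mul]
      simp only [slice_comul]
      apply fn_injective
      ext a
      rw [tr_apply, mul_fn]
      simp only [fn, map_sum, LinearMap.sum_apply]
      have e : cv f.fn h.fn (a * b) =
          TensorProduct.lift ((LinearMap.mul k k).compl₁₂ f.fn h.fn)
            (comul (R := k) (a * b)) := by
        rw [cv_apply (ℛ k (a * b)), ← (ℛ k (a * b)).eq]
        simp
      rw [e, comul_mul_repr]
      simp only [mul_fn, cv_apply (ℛ k a), map_sum, TensorProduct.lift.tmul,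
        compl₁₂_apply, mul_apply', tr_apply]
      exact Finset.sum_comm)

noncomputable instance : HopfAlgebraStruct k (DualH k A) where
  antipode := eqv.symm.toLinearMap ∘ₗ
    (LinearMap.lcomp k k 𝒮) ∘ₗ (eqv (k := k) (A := A)).toLinearMap

lemma antipode_apply (f : DualH k A) (a : A) :
    (HopfAlgebra.antipode k f).fn a = f.fn (𝒮 a) := rfl

noncomputable instance : HopfAlgebra k (DualH k A) where
  mul_antipode_rTensor_comul := by
    have h : ∀ (x : DualH k A ⊗[k] DualH k A) (a : A),
        (LinearMap.mul' k (DualH k A) ((HopfAlgebra.antipode k (A := DualH k A)).rTensor _ x)).fn a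
        = ∑ i ∈ (ℛ k a).index, (slice ((ℛ k a).right i) x).fn (𝒮 ((ℛ k a).left i)) := by
      intro x a
      induction x with
      | zero => simp
      | add x y hx hy => simp [hx, hy, Finset.sum_add_distrib]
      | tmul v f => simp [mul_fn, cv_apply (ℛ k a), antipode_apply, mul_comm]
    ext1 f
    apply fn_injective
    ext a
    have h2 := HopfAlgebra.sum_antipode_mul_eq_smul (ℛ k a)
    rw [LinearMap.comp_apply, LinearMap.comp_apply, h]
    simp only [slice_comul, tr_apply]
    rw [← map_sum, h2]
    simp [Algebra.algebraMap_eq_smul_one, one_fn, mul_comm]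
  mul_antipode_lTensor_comul := by
    have h : ∀ (x : DualH k A ⊗[k] DualH k A) (a : A),
        (LinearMap.mul' k (DualH k A) ((HopfAlgebra.antipode k (A := DualH k A)).lTensor _ x)).fn a
        = ∑ i ∈ (ℛ k a).index, (slice (𝒮 ((ℛ k a).right i)) x).fn ((ℛ k a).left i) := by
      intro x a
      induction x with
      | zero => simp
      | add x y hx hy => simp [hx, hy, Finset.sum_add_distrib]
      | tmul v f => simp [mul_fn, cv_apply (ℛ k a), antipode_apply, mul_comm]
    ext1 f
    apply fn_injective
    ext a
    have h2 := HopfAlgebra.sum_mul_antipode_eq_smul (ℛ k a)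
    rw [LinearMap.comp_apply, LinearMap.comp_apply, h]
    simp only [slice_comul, tr_apply]
    rw [← map_sum, h2]
    simp [Algebra.algebraMap_eq_smul_one, one_fn, mul_comm]

instance : FiniteDimensional k (DualH k A) :=
  Module.Finite.equiv (eqv (k := k) (A := A)).symm

lemma finrank_eq : Module.finrank k (DualH k A) = Module.finrank k A :=
  (eqv (k := k) (A := A)).finrank_eq.trans Subspace.dual_finrank_eq

end DualH

namespace IntData
variable (k A : Type) [Field k] [Ring A] [HopfAlgebra k A] [FiniteDimensional k A] [Nontrivial A]

lemma exists_intData : Nonempty (IntData k A) := by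
  have : Nontrivial (DualH k A) := by
    rw [← Module.finrank_pos_iff (R := k), DualH.finrank_eq, Module.finrank_pos_iff]
    infer_instance
  obtain ⟨l, hl0, hl⟩ := exists_left_integral_elem (k := k) (A := DualH k A)
  refine exists_of_isInt (lam := l.fn) (fun a => ?_) (by simpa using hl0)
  rw [← sub_eq_zero]
  refine (Module.forall_dual_apply_eq_zero_iff k _).1 fun f => ?_
  have := congrArg (fun z => z.fn a) (hl (DualH.mk f))
  simp only [DualH.mul_fn, cv_eq_dual_hitR, DualH.counit_apply] at this
  have e : (DualH.mk f).fn = f := LinearEquiv.apply_symm_apply _ _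
  rw [e] at this
  rw [map_sub, this]
  simp [mul_comm]

end IntData

section Roots
variable {k : Type} [Field k] [IsAlgClosed k] [CharZero k]
  {V : Type} [AddCommGroup V] [Module k V] [FiniteDimensional k V]

/-- An integer polynomial vanishing at a primitive root of unity of `k` vanishes at the
corresponding complex roots of unity, and conversely. -/
lemma aeval_primitiveRoot_transfer {K L : Type} [Field K] [CharZero K] [Field L] [CharZero L]
    {m : ℕ} (hm : 0 < m) {ζ : K} (hζ : IsPrimitiveRoot ζ m) {ξ : L} (hξ : IsPrimitiveRoot ξ m)
    {Q : Polynomial ℤ} (h : Polynomial.aeval ζ Q = 0) : Polynomial.aeval ξ Q = 0 := by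
  have h1 : Polynomial.cyclotomic m ℤ ∣ Q := by
    rw [Polynomial.cyclotomic_eq_minpoly hζ hm]
    exact minpoly.isIntegrallyClosed_dvd (hζ.isIntegral hm) h
  obtain ⟨q, rfl⟩ := h1
  have h2 : Polynomial.aeval ξ (Polynomial.cyclotomic m ℤ) = 0 := by
    rw [Polynomial.cyclotomic_eq_minpoly hξ hm]
    exact minpoly.aeval _ _
  rw [map_mul, h2, zero_mul]

lemma finrank_range_of_isIdempotentElem {P : Module.End k V} (hP : IsIdempotentElem P) :
    LinearMap.trace k V P = (Module.finrank k (LinearMap.range P) : k) :=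
  ((LinearMap.isProj_range_iff_isIdempotentElem P).2 hP).trace

lemma eq_zero_of_trace_eq_zero {P : Module.End k V} (hP : IsIdempotentElem P)
    (h : LinearMap.trace k V P = 0) : P = 0 := by
  rw [finrank_range_of_isIdempotentElem hP, Nat.cast_eq_zero, Submodule.finrank_eq_zero] at h
  exact LinearMap.range_eq_bot.1 h

/-- Spectral decomposition of an endomorphism with `T ^ m` idempotent. -/
lemma exists_spectral {m : ℕ} (hm : 0 < m) {ζ : k} (hζ : IsPrimitiveRoot ζ m)
    {T E : Module.End k V} (hE : T * E = T) (hT : T ^ m = E) :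
    ∃ P : ℕ → Module.End k V, (∀ a, IsIdempotentElem (P a)) ∧
      ∀ j, T ^ j * E = ∑ a ∈ Finset.range m, ζ ^ (a * j) • P a := by
  have hm0 : (m : k) ≠ 0 := by exact_mod_cast hm.ne'
  have hζ0 : ζ ≠ 0 := hζ.ne_zero hm.ne'
  have hEE : E * E = E := by
    obtain ⟨n, rfl⟩ : ∃ n, m = n + 1 := ⟨m - 1, by omega⟩
    conv_lhs => enter [1]; rw [← hT]
    rw [pow_succ, mul_assoc, hE, ← pow_succ, hT]
  have hc : Commute E T := by rw [← hT]; exact Commute.pow_self _ _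
  let P : ℕ → Module.End k V := fun a =>
    (m : k)⁻¹ • ∑ j ∈ Finset.range m, (ζ⁻¹ ^ a) ^ j • (T ^ j * E)
  have hTP : ∀ a, T * P a = ζ ^ a • P a := by
    intro a
    have e1 : ∀ j, T * ((ζ⁻¹ ^ a) ^ j • (T ^ j * E)) =
        ζ ^ a • ((ζ⁻¹ ^ a) ^ (j + 1) • (T ^ (j + 1) * E)) := by
      intro j
      rw [smul_smul, mul_smul_comm, ← mul_assoc, ← pow_succ' T]
      congr 1
      rw [pow_succ, mul_comm (_ ^ j), ← mul_assoc, ← mul_pow, mul_inv_cancel₀ hζ0, one_pow, one_mul]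
    simp only [P]
    rw [mul_smul_comm, Finset.mul_sum, Finset.sum_congr rfl fun j _ => e1 j, ← Finset.smul_sum,
      smul_comm]
    congr 2
    have := Finset.sum_range_succ' (fun j => (ζ⁻¹ ^ a) ^ j • (T ^ j * E)) m
    rw [Finset.sum_range_succ] at this
    have e2 : (ζ⁻¹ ^ a) ^ m = 1 := by rw [← pow_mul, mul_comm, pow_mul, inv_pow, hζ.pow_eq_one]; simp
    rw [e2, hT, pow_zero, pow_zero, one_mul, hEE] at this
    exact (add_right_cancel this).symm
  have hTjP : ∀ a j, T ^ j * P a = ζ ^ (a * j) • P a := by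
    intro a j
    induction j with
    | zero => simp
    | succ j ih => rw [pow_succ, mul_assoc, hTP, mul_smul_comm, ih, smul_smul]; congr 1; ring
  have hEP : ∀ a, E * P a = P a := by
    intro a
    rw [← hT, hTjP, mul_comm, pow_mul, hζ.pow_eq_one, one_pow, one_smul]
  have hsum : ∑ a ∈ Finset.range m, P a = E := by
    simp only [P]
    rw [← Finset.smul_sum, Finset.sum_comm]
    have e3 : ∀ j ∈ Finset.range m, ∑ a ∈ Finset.range m, (ζ⁻¹ ^ a) ^ j • (T ^ j * E) =
        if j = 0 then (m : k) • E else 0 := by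
      intro j hj
      rw [← Finset.sum_smul]
      split_ifs with h
      · subst h; simp
      · have h1 : ζ⁻¹ ^ j ≠ 1 := by
          rw [inv_pow, Ne, inv_eq_one]
          intro h2
          exact absurd (Nat.le_of_dvd (Nat.pos_of_ne_zero h) (hζ.dvd_of_pow_eq_one j h2))
            (by simpa using hj)
        have h2 : ∑ a ∈ Finset.range m, (ζ⁻¹ ^ a) ^ j = 0 := by
          have h3 := mul_geom_sum (ζ⁻¹ ^ j) m
          rw [← pow_mul, mul_comm j, pow_mul, inv_pow ζ m, hζ.pow_eq_one, inv_one, one_pow, sub_self] at h3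
          have := (mul_eq_zero.1 h3).resolve_left (sub_ne_zero.2 h1)
          rw [← this]
          exact Finset.sum_congr rfl fun a _ => by rw [← pow_mul, ← pow_mul, mul_comm]
        rw [h2, zero_smul]
    rw [Finset.sum_congr rfl e3, Finset.sum_ite_eq' (Finset.range m) 0]
    rw [if_pos (by simpa using hm), smul_smul, inv_mul_cancel₀ hm0, one_smul]
  refine ⟨P, fun a => ?_, fun j => ?_⟩
  · change P a * P a = P a
    conv_lhs => enter [1]; simp only [P]
    rw [smul_mul_assoc, Finset.sum_mul]
    have e4 : ∀ j ∈ Finset.range m, (ζ⁻¹ ^ a) ^ j • (T ^ j * E) * P a = P a := by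
      intro j _
      rw [smul_mul_assoc, mul_assoc, hEP, hTjP, smul_smul, ← pow_mul, ← mul_pow,
        inv_mul_cancel₀ hζ0, one_pow, one_smul]
    rw [Finset.sum_congr rfl e4, Finset.sum_const, Finset.card_range, ← Nat.cast_smul_eq_nsmul k,
      smul_smul, inv_mul_cancel₀ hm0, one_smul]
  · rw [← hsum, Finset.mul_sum]
    exact Finset.sum_congr rfl fun a _ => hTjP a j

/-- The multiplicities of the eigenvalues. -/
lemma exists_mults {m : ℕ} (hm : 0 < m) {ζ : k} (hζ : IsPrimitiveRoot ζ m)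
    {T E : Module.End k V} (hE : T * E = T) (hT : T ^ m = E) :
    ∃ c : ℕ → ℕ, ∀ j, LinearMap.trace k V (T ^ j * E) =
      ∑ a ∈ Finset.range m, (c a : k) * ζ ^ (a * j) := by
  obtain ⟨P, hP, h⟩ := exists_spectral hm hζ hE hT
  refine ⟨fun a => Module.finrank k (LinearMap.range (P a)), fun j => ?_⟩
  rw [h, map_sum]
  exact Finset.sum_congr rfl fun a _ => by
    rw [map_smul, finrank_range_of_isIdempotentElem (hP a), smul_eq_mul, mul_comm]

lemma exists_primitiveRoot (k : Type) [Field k] [IsAlgClosed k] [CharZero k] {m : ℕ} (hm : 0 < m) :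
    ∃ ζ : k, IsPrimitiveRoot ζ m := by
  have : NeZero (m : k) := ⟨by exact_mod_cast hm.ne'⟩
  exact HasEnoughRootsOfUnity.exists_primitiveRoot k m

lemma eq_one_of_trace_eq_finrank {m : ℕ} (hm : 0 < m) {T : Module.End k V} (hT : T ^ m = 1)
    (h : LinearMap.trace k V T = Module.finrank k V) : T = 1 := by
  obtain ⟨ζ, hζ⟩ := exists_primitiveRoot k hm
  obtain ⟨P, hP, hj⟩ := exists_spectral hm hζ (mul_one T) hT
  set c : ℕ → ℕ := fun a => Module.finrank k (LinearMap.range (P a)) with hc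
  have e0 : (Module.finrank k V : k) = ∑ a ∈ Finset.range m, (c a : k) := by
    have := congrArg (LinearMap.trace k V) (hj 0)
    rw [pow_zero, one_mul, LinearMap.trace_one, map_sum] at this
    rw [this]
    exact Finset.sum_congr rfl fun a _ => by
      simp [hc, finrank_range_of_isIdempotentElem (hP a)]
  have e1 : LinearMap.trace k V T = ∑ a ∈ Finset.range m, (c a : k) * ζ ^ a := by
    have := congrArg (LinearMap.trace k V) (hj 1)
    rw [pow_one, mul_one, map_sum] at this
    rw [this]
    exact Finset.sum_congr rfl fun a _ => by
      simp [hc, finrank_range_of_isIdempotentElem (hP a), mul_comm]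
  have hQ : Polynomial.aeval ζ (∑ a ∈ Finset.range m,
      (c a : Polynomial ℤ) * (Polynomial.X ^ a - 1)) = 0 := by
    simp only [map_sum, map_mul, map_sub, map_natCast, map_pow, Polynomial.aeval_X,
      mul_sub, mul_one, Finset.sum_sub_distrib]
    rw [← e1, h, e0, sub_self]
  obtain ⟨ξ, hξ⟩ := exists_primitiveRoot ℂ hm
  have hQ' := aeval_primitiveRoot_transfer hm hζ hξ hQ
  simp only [map_sum, map_mul, map_sub, map_natCast, map_pow, Polynomial.aeval_X, map_one] at hQ'
  have hnorm : ∀ a, ‖ξ ^ a‖ = 1 := fun a => by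
    rw [norm_pow, hξ.norm'_eq_one hm.ne', one_pow]
  have hre : ∑ a ∈ Finset.range m, (c a : ℝ) * (1 - (ξ ^ a).re) = 0 := by
    have := congrArg Complex.re hQ'
    simp only [Complex.re_sum, Complex.zero_re] at this
    rw [← neg_eq_zero, ← Finset.sum_neg_distrib, ← this]
    refine Finset.sum_congr rfl fun a _ => ?_
    simp [Complex.mul_re]
    ring
  have hre0 : ∀ a, (ξ ^ a).re ≤ 1 := fun a => (Complex.re_le_norm _).trans (hnorm a).le
  have hz := (Finset.sum_eq_zero_iff_of_nonneg fun a _ =>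
    mul_nonneg (Nat.cast_nonneg (c a)) (sub_nonneg.2 (hre0 a))).1 hre
  have hPz : ∀ a ∈ Finset.range m, a ≠ 0 → P a = 0 := by
    intro a ha ha0
    refine eq_zero_of_trace_eq_zero (hP a) ?_
    rw [finrank_range_of_isIdempotentElem (hP a)]
    rcases mul_eq_zero.1 (hz a ha) with h0 | h0
    · exact_mod_cast h0
    · exfalso
      have h1 : (ξ ^ a).re = 1 := by linarith
      have h2 : ξ ^ a = 1 := by
        have h3 := Complex.normSq_apply (ξ ^ a)
        rw [Complex.normSq_eq_norm_sq, hnorm, h1] at h3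
        have h4 : (ξ ^ a).im = 0 := by nlinarith
        exact Complex.ext h1 h4
      exact absurd (Nat.le_of_dvd (Nat.pos_of_ne_zero ha0) (hξ.dvd_of_pow_eq_one a h2))
        (by simpa using ha)
  have hall : ∀ j, T ^ j = P 0 := by
    intro j
    have := hj j
    rw [mul_one] at this
    rw [this, Finset.sum_eq_single_of_mem 0 (by simpa using hm)]
    · simp
    · intro a ha ha0
      rw [hPz a ha ha0, smul_zero]
  rw [← pow_one T, hall 1, ← hall 0, pow_zero]

/-- Positivity of `∑ tr T · tr T⁻¹`. -/
lemma trace_eq_zero_of_sum_trace_mul {ι : Type} {s : Finset ι} {W : ι → Type}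
    [∀ i, AddCommGroup (W i)] [∀ i, Module k (W i)] [∀ i, FiniteDimensional k (W i)]
    {m : ℕ} (hm : 0 < m) (T : ∀ i, Module.End k (W i)) (hT : ∀ i, T i ^ m = 1)
    (h : ∑ i ∈ s, LinearMap.trace k _ (T i) * LinearMap.trace k _ (T i ^ (m - 1)) = 0) :
    ∀ i ∈ s, LinearMap.trace k _ (T i) = 0 := by
  obtain ⟨ζ, hζ⟩ := exists_primitiveRoot k hm
  obtain ⟨ξ, hξ⟩ := exists_primitiveRoot ℂ hm
  choose c hc using fun i => exists_mults hm hζ (mul_one (T i)) (hT i)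
  simp only [mul_one] at hc
  let Q : ι → Polynomial ℤ := fun i => ∑ a ∈ Finset.range m, (c i a : Polynomial ℤ) * Polynomial.X ^ a
  let Q' : ι → Polynomial ℤ := fun i =>
    ∑ a ∈ Finset.range m, (c i a : Polynomial ℤ) * Polynomial.X ^ (a * (m - 1))
  have h1 : ∀ i, LinearMap.trace k _ (T i) = Polynomial.aeval ζ (Q i) := by
    intro i
    have := hc i 1
    rw [pow_one] at this
    simp [this, Q]
  have h2 : ∀ i, LinearMap.trace k _ (T i ^ (m - 1)) = Polynomial.aeval ζ (Q' i) := by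
    intro i
    rw [hc i (m - 1)]
    simp [Q']
  have h3 : Polynomial.aeval ζ (∑ i ∈ s, Q i * Q' i) = 0 := by
    rw [← h, map_sum]
    exact Finset.sum_congr rfl fun i _ => by rw [map_mul, h1, h2]
  have h4 := aeval_primitiveRoot_transfer hm hζ hξ h3
  have h5 : ∀ i, Polynomial.aeval ξ (Q' i) = (starRingEnd ℂ) (Polynomial.aeval ξ (Q i)) := by
    intro i
    simp only [Q, Q', map_sum, map_mul, map_natCast, map_pow, Polynomial.aeval_X]
    refine Finset.sum_congr rfl fun a _ => ?_
    have : ξ ^ (m - 1) = (starRingEnd ℂ) ξ := by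
      rw [← Complex.inv_eq_conj (hξ.norm'_eq_one hm.ne')]
      apply eq_inv_of_mul_eq_one_left
      rw [← pow_succ, Nat.sub_add_cancel hm, hξ.pow_eq_one]
    rw [mul_comm a, pow_mul, this]
  have h6 : ∑ i ∈ s, Complex.normSq (Polynomial.aeval ξ (Q i)) = 0 := by
    rw [map_sum] at h4
    have : ((∑ i ∈ s, Complex.normSq (Polynomial.aeval ξ (Q i)) : ℝ) : ℂ) = 0 := by
      rw [← h4, Complex.ofReal_sum]
      exact Finset.sum_congr rfl fun i _ => by rw [map_mul, h5, Complex.mul_conj]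
    exact_mod_cast this
  intro i hi
  have h7 := (Finset.sum_eq_zero_iff_of_nonneg fun i _ => Complex.normSq_nonneg _).1 h6 i hi
  rw [Complex.normSq_eq_zero] at h7
  rw [h1]
  exact aeval_primitiveRoot_transfer hm hξ hζ h7

/-- A traceless operator with `T ^ 8 = E` idempotent has even rank. -/
lemma exists_trace_eq_two_mul {T E : Module.End k V} (hE : T * E = T) (hT : T ^ 8 = E)
    (h : LinearMap.trace k V T = 0) : ∃ r : ℕ, LinearMap.trace k V E = (2 * r : ℕ) := by
  obtain ⟨ζ, hζ⟩ := exists_primitiveRoot k (m := 8) (by norm_num)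
  obtain ⟨c, hc⟩ := exists_mults (by norm_num) hζ hE hT
  let Q : Polynomial ℤ := ∑ a ∈ Finset.range 8, (c a : Polynomial ℤ) * Polynomial.X ^ a
  have h1 : Polynomial.aeval ζ Q = 0 := by
    have := hc 1
    rw [pow_one, hE, h] at this
    simp [Q, this]
  have h2 : Polynomial.cyclotomic 8 ℤ ∣ Q := by
    rw [Polynomial.cyclotomic_eq_minpoly hζ (by norm_num)]
    exact minpoly.isIntegrallyClosed_dvd (hζ.isIntegral (by norm_num)) h1
  obtain ⟨q, hq⟩ := h2
  have h3 : (Polynomial.cyclotomic 8 ℤ).eval 1 = 2 := by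
    have : Fact (Nat.Prime 2) := ⟨Nat.prime_two⟩
    simpa using Polynomial.eval_one_cyclotomic_prime_pow (R := ℤ) 2 (p := 2)
  have h4 : ((∑ a ∈ Finset.range 8, c a : ℕ) : ℤ) = 2 * q.eval 1 := by
    have := congrArg (Polynomial.eval 1) hq
    rw [Polynomial.eval_mul, h3] at this
    rw [← this]
    simp [Q, Polynomial.eval_finsetSum]
  have h5 : 2 ∣ ∑ a ∈ Finset.range 8, c a := by
    rw [← Int.natCast_dvd_natCast]
    exact ⟨_, h4⟩
  obtain ⟨r, hr⟩ := h5
  refine ⟨r, ?_⟩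
  have := hc 0
  rw [pow_zero, one_mul] at this
  rw [this, ← hr]
  simp

end Roots

section GroupLikes
variable {k : Type} [Field k] {A : Type} [Ring A] [HopfAlgebra k A] [FiniteDimensional k A]

local notation "𝒮" => HopfAlgebra.antipode k (A := A)

instance finite_groupLike : Finite (GroupLike k A) :=
  (linearIndep_groupLikeVal (R := k) (A := A)).finite

variable [IsAlgClosed k] [CharZero k]

lemma groupLike_pow_card (g : GroupLike k A) : g.val ^ Nat.card (GroupLike k A) = 1 := by
  rw [← GroupLike.val_pow, pow_card_eq_one', GroupLike.val_one]

lemma chr_lreg_groupLike {g : GroupLike k A} (hg : g ≠ 1) : chr (lreg k A) g.val = 0 := by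
  have h := LinearMap.congr_fun (chr_lreg_cv (k := k) (A := A) (lreg k A)) g.val
  have h1 : cv (chr (lreg k A)) (chr (lreg k A)) g.val =
      chr (lreg k A) g.val * chr (lreg k A) g.val := by
    let r : Repr k g.val Unit := ⟨Finset.univ, fun _ => g.val, fun _ => g.val, by simp⟩
    simp [cv_apply r, r]
  rw [h1, LinearMap.smul_apply, smul_eq_mul] at h
  by_contra h0
  have h2 := mul_right_cancel₀ h0 h
  refine hg (GroupLike.val_injective ?_)
  have h3 : lreg k A g.val = 1 := by
    refine eq_one_of_trace_eq_finrank (m := Nat.card (GroupLike k A)) Nat.card_pos ?_ h2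
    rw [← map_pow, groupLike_pow_card, map_one]
  simpa using LinearMap.congr_fun h3 1

lemma card_subgroup_dvd (G : Subgroup (GroupLike k A)) : Nat.card G ∣ Module.finrank k A := by
  classical
  have := Fintype.ofFinite G
  have hc : (Nat.card G : k) ≠ 0 := by exact_mod_cast Nat.card_pos.ne'
  set e : A := (Nat.card G : k)⁻¹ • ∑ g : G, g.1.val with he
  have hge : ∀ g : G, g.1.val * e = e := by
    intro g
    rw [he, mul_smul_comm, Finset.mul_sum]
    congr 1
    exact Fintype.sum_equiv (Equiv.mulLeft g) _ _ fun x => by simp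
  have hee : e * e = e := by
    conv_lhs => enter [1]; rw [he]
    rw [smul_mul_assoc, Finset.sum_mul, Finset.sum_congr rfl fun g _ => hge g, Finset.sum_const,
      Finset.card_univ, ← Nat.card_eq_fintype_card, ← Nat.cast_smul_eq_nsmul k, smul_smul,
      inv_mul_cancel₀ hc, one_smul]
  have h1 : LinearMap.trace k A (lreg k A e) = (Nat.card G : k)⁻¹ * Module.finrank k A := by
    rw [he, map_smul, map_smul, map_sum, map_sum, Finset.sum_eq_single (1 : G)]
    · rw [OneMemClass.coe_one, GroupLike.val_one, map_one, LinearMap.trace_one, smul_eq_mul]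
    · intro g _ hg
      exact chr_lreg_groupLike (g := g.1) (by simpa using hg)
    · simp
  have h2 : IsIdempotentElem (lreg k A e) := by
    rw [IsIdempotentElem, ← map_mul, hee]
  rw [finrank_range_of_isIdempotentElem h2, eq_inv_mul_iff_mul_eq₀ hc] at h1
  exact ⟨_, by exact_mod_cast h1.symm⟩

lemma card_groupLike_dvd : Nat.card (GroupLike k A) ∣ Module.finrank k A := by
  simpa using card_subgroup_dvd (k := k) (A := A) ⊤

end GroupLikes

/-- The group of characters of `A`. -/
abbrev Ch (k A : Type) [Field k] [Ring A] [HopfAlgebra k A] [FiniteDimensional k A] : Type :=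
  GroupLike k (DualH k A)

namespace Ch
variable {k : Type} [Field k] {A : Type} [Ring A] [HopfAlgebra k A] [FiniteDimensional k A]

local notation "𝒮" => HopfAlgebra.antipode k (A := A)

/-- The underlying functional. -/
noncomputable abbrev fn (χ : Ch k A) : A →ₗ[k] k := χ.val.fn

lemma fn_one (χ : Ch k A) : χ.fn 1 = 1 := by
  rw [← DualH.counit_apply]; exact χ.2.counit_eq_one

lemma fn_mul (χ : Ch k A) (a b : A) : χ.fn (a * b) = χ.fn a * χ.fn b := by
  have h := congrArg (fun x => (DualH.slice b x).fn a) χ.2.comul_eq_tmul_self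
  simp only [DualH.slice_comul, DualH.slice_tmul, map_smul, LinearMap.smul_apply] at h
  rw [mul_comm, ← smul_eq_mul (χ.fn b)]
  exact h

/-- A group-like element of the dual, as a character. -/
noncomputable def toAlg (χ : Ch k A) : A →ₐ[k] k :=
  AlgHom.ofLinearMap χ.fn χ.fn_one χ.fn_mul

/-- A character, as a group-like element of the dual. -/
noncomputable def ofAlg (f : A →ₐ[k] k) : Ch k A :=
  ⟨DualH.mk f.toLinearMap, by
    constructor
    · rw [DualH.counit_apply]; simp
    · refine DualH.slice_ext fun b => ?_
      rw [DualH.slice_comul, DualH.slice_tmul]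
      apply DualH.fn_injective
      ext a
      simp [DualH.tr, mul_comm]⟩

@[simp] lemma fn_ofAlg (f : A →ₐ[k] k) : (ofAlg f).fn = f.toLinearMap := by
  simp [fn, ofAlg]

lemma fn_injective : Function.Injective (fn (k := k) (A := A)) :=
  DualH.fn_injective.comp GroupLike.val_injective

lemma fn_mul' (χ ψ : Ch k A) : (χ * ψ).fn = cv χ.fn ψ.fn := rfl

lemma fn_one' : (1 : Ch k A).fn = counit (R := k) := rfl

lemma hitL_cv (h f : A →ₗ[k] k) (a : A) : hitL f (hitL h a) = hitL (cv h f) a := by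
  rw [← sub_eq_zero]
  refine (Module.forall_dual_apply_eq_zero_iff k _).1 fun φ => ?_
  have e : ∀ (u v : A →ₗ[k] k) a, v (hitL u a) = cv u v a := fun u v a => by
    rw [dual_hitL, cv_eq_dual_hitR]
  rw [map_sub, e, e, e, cv_assoc, sub_self]

/-- The automorphism `a ↦ χ(a₁) a₂`. -/
noncomputable def aut (χ : Ch k A) : A ≃ₐ[k] A :=
  AlgEquiv.ofLinearEquiv
    (LinearEquiv.ofLinearMap (hitL χ.fn) (hitL (χ⁻¹).fn)
      (by ext a; simp [hitL_cv, ← fn_mul', fn_one', hitL_counit])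
      (by ext a; simp [hitL_cv, ← fn_mul', fn_one', hitL_counit]))
    (by
      let r : Repr k (1 : A) Unit := ⟨Finset.univ, fun _ => 1, fun _ => 1, by
        simp [Algebra.TensorProduct.one_def]⟩
      simp [hitL_apply r, r, fn_one])
    (fun a b => by
      simp only [LinearEquiv.coe_ofLinearMap, hitL_mul, fn_mul, hitL_apply (ℛ k a),
        hitL_apply (ℛ k b), Finset.sum_mul_sum, smul_mul_smul_comm])

lemma aut_apply (χ : Ch k A) (a : A) : χ.aut a = hitL χ.fn a := rfl

lemma fn_aut (χ : Ch k A) (f : A →ₗ[k] k) (a : A) : f (χ.aut a) = cv χ.fn f a := by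
  rw [aut_apply, dual_hitL, cv_eq_dual_hitR]

lemma aut_mul (χ ψ : Ch k A) (a : A) : (χ * ψ).aut a = ψ.aut (χ.aut a) := by
  rw [aut_apply, aut_apply, aut_apply, hitL_cv, fn_mul']

lemma aut_one (a : A) : (1 : Ch k A).aut a = a := by
  rw [aut_apply, fn_one', hitL_counit]

lemma hitR_pow (χ : Ch k A) (N : ℕ) :
    (hitR (χ ^ N).fn : A →ₗ[k] A) = (hitR χ.fn : Module.End k A) ^ N := by
  induction N with
  | zero => ext a; simp [fn_one', hitR_one_counit]
  | succ N ih => rw [pow_succ, pow_succ, fn_mul', hitR_eq_cv, ih]; rfl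

end Ch

namespace IntData
variable {k : Type} [Field k] {A : Type} [Ring A] [HopfAlgebra k A] [FiniteDimensional k A]

local notation "𝒮" => HopfAlgebra.antipode k (A := A)

/-- The distinguished group-like element. -/
noncomputable def gl (d : IntData k A) : GroupLike k A := ⟨d.g, d.isGroupLike_g⟩

lemma S_pow_of_pow (d : IntData k A) {N : ℕ} (hg : d.gl ^ N = 1) (hα : Ch.ofAlg d.α ^ N = 1) :
    (𝒮 : Module.End k A) ^ (4 * N) = 1 := by
  refine d.S_pow ?_ ?_
  · have := congrArg GroupLike.val hg
    simpa [gl] using this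
  · have h := Ch.hitR_pow (Ch.ofAlg d.α) N
    rw [hα, Ch.fn_ofAlg, Ch.fn_one'] at h
    rw [R, ← h]
    ext a
    simp [hitR_one_counit]

lemma exists_S_pow (d : IntData k A) : ∃ N, 0 < N ∧ (𝒮 : Module.End k A) ^ N = 1 := by
  refine ⟨4 * (Nat.card (GroupLike k A) * Nat.card (Ch k A)), ?_, ?_⟩
  · have h1 : 0 < Nat.card (GroupLike k A) := Nat.card_pos
    have h2 : 0 < Nat.card (Ch k A) := Nat.card_pos
    positivity
  · refine d.S_pow_of_pow ?_ ?_
    · rw [pow_mul, pow_card_eq_one', one_pow]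
    · rw [mul_comm, pow_mul, pow_card_eq_one', one_pow]

end IntData

/-- Wedderburn data for a finite-dimensional algebra. -/
structure Wed (k A : Type) [Field k] [Ring A] [Algebra k A] where
  n : ℕ
  δ : Fin n → ℕ
  δ_pos : ∀ i, 0 < δ i
  ρ : ∀ i, A →ₐ[k] Module.End k (Fin (δ i) → k)
  surj : ∀ f : ∀ i, Module.End k (Fin (δ i) → k), ∃ a, ∀ i, ρ i a = f i
  nil : ∃ m, (⨅ i, LinearMap.ker (ρ i).toLinearMap) ^ m = (⊥ : Submodule k A)

lemma exists_wed (k A : Type) [Field k] [IsAlgClosed k] [Ring A] [Algebra k A]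
    [FiniteDimensional k A] : Nonempty (Wed k A) := by
  have : IsArtinianRing A := IsArtinianRing.of_finite k A
  have : FiniteDimensional k (A ⧸ Ring.jacobson A) :=
    Module.Finite.of_surjective (Ideal.Quotient.mkₐ k (Ring.jacobson A)).toLinearMap
      (Ideal.Quotient.mkₐ_surjective k _)
  obtain ⟨n, δ, hδ, ⟨e⟩⟩ :=
    IsSemisimpleRing.exists_algEquiv_pi_matrix_of_isAlgClosed k (A ⧸ Ring.jacobson A)
  let q := Ideal.Quotient.mkₐ k (Ring.jacobson A)
  let ρ : ∀ i, A →ₐ[k] Module.End k (Fin (δ i) → k) := fun i =>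
    (Matrix.toLinAlgEquiv' : Matrix (Fin (δ i)) (Fin (δ i)) k ≃ₐ[k] _).toAlgHom.comp
      ((Pi.evalAlgHom k _ i).comp (e.toAlgHom.comp q))
  refine ⟨⟨n, δ, fun i => Nat.pos_of_ne_zero (hδ i).out, ρ, fun f => ?_, ?_⟩⟩
  · obtain ⟨a, ha⟩ := Ideal.Quotient.mkₐ_surjective k (Ring.jacobson A)
      (e.symm fun i => Matrix.toLinAlgEquiv'.symm (f i))
    refine ⟨a, fun i => ?_⟩
    change Matrix.toLinAlgEquiv' (e (q a) i) = f i
    rw [show q a = _ from ha, e.apply_symm_apply, AlgEquiv.apply_symm_apply]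
  · obtain ⟨m, hm⟩ := IsSemiprimaryRing.isNilpotent (R := A)
    refine ⟨m, ?_⟩
    have h1 : ∀ x ∈ ⨅ i, LinearMap.ker (ρ i).toLinearMap, x ∈ Ring.jacobson A := by
      intro x hx
      rw [Submodule.mem_iInf] at hx
      rw [← Ideal.Quotient.eq_zero_iff_mem]
      apply e.injective
      rw [map_zero]
      funext i
      exact Matrix.toLinAlgEquiv'.injective ((hx i).trans (map_zero _).symm)
    have h2 : ∀ m, ∀ x ∈ (⨅ i, LinearMap.ker (ρ i).toLinearMap) ^ m, x ∈ Ring.jacobson A ^ m := by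
      intro m
      induction m with
      | zero =>
        intro x _
        rw [Submodule.pow_zero, Ideal.one_eq_top]
        trivial
      | succ m ih =>
        intro x hx
        rw [pow_succ] at hx
        rw [Submodule.pow_succ]
        induction hx using Submodule.mul_induction_on' with
        | mem_mul_mem a ha b hb => exact Ideal.mul_mem_mul (ih a ha) (h1 b hb)
        | add x _ y _ hx hy => exact add_mem hx hy
    rw [eq_bot_iff]
    intro x hx
    have := h2 m x hx
    rw [hm] at this
    simpa using this

namespace Wed
variable {k : Type} [Field k] {A : Type} [Ring A] [Algebra k A] (w : Wed k A)

/-- The underlying space of the `i`-th irreducible representation. -/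
abbrev V (i : Fin w.n) : Type := Fin (w.δ i) → k

instance (i : Fin w.n) : NeZero (w.δ i) := ⟨(w.δ_pos i).ne'⟩

/-- The radical. -/
def J : Submodule k A := ⨅ i, LinearMap.ker (w.ρ i).toLinearMap

lemma mem_J {x : A} : x ∈ w.J ↔ ∀ i, w.ρ i x = 0 := by
  simp [J, Submodule.mem_iInf]

lemma mul_mem_J (a : A) {x : A} (hx : x ∈ w.J) : a * x ∈ w.J := by
  rw [mem_J] at *; intro i; rw [map_mul, hx, mul_zero]

lemma mem_J_mul (a : A) {x : A} (hx : x ∈ w.J) : x * a ∈ w.J := by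
  rw [mem_J] at *; intro i; rw [map_mul, hx, zero_mul]

lemma exists_J_pow : ∃ m, w.J ^ m = ⊥ := w.nil

lemma isNilpotent_of_mem {x : A} (hx : x ∈ w.J) : IsNilpotent x := by
  obtain ⟨m, hm⟩ := w.nil
  refine ⟨m, ?_⟩
  have : x ^ m ∈ w.J ^ m := Submodule.pow_mem_pow _ hx m
  rw [J, hm] at this
  simpa using this

lemma mul_mem_J_pow (a : A) {x : A} {m : ℕ} (hm : m ≠ 0) (hx : x ∈ w.J ^ m) : a * x ∈ w.J ^ m := by
  obtain ⟨m, rfl⟩ := Nat.exists_eq_succ_of_ne_zero hm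
  rw [Nat.succ_eq_add_one, pow_succ'] at hx ⊢
  induction hx using Submodule.mul_induction_on' with
  | mem_mul_mem y hy z hz =>
    rw [← mul_assoc]
    exact Submodule.mul_mem_mul (w.mul_mem_J a hy) hz
  | add x _ y _ hx hy => rw [mul_add]; exact add_mem hx hy

lemma mem_J_pow_mul (a : A) {x : A} {m : ℕ} (hm : m ≠ 0) (hx : x ∈ w.J ^ m) : x * a ∈ w.J ^ m := by
  obtain ⟨m, rfl⟩ := Nat.exists_eq_succ_of_ne_zero hm
  rw [Nat.succ_eq_add_one, pow_succ] at hx ⊢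
  induction hx using Submodule.mul_induction_on' with
  | mem_mul_mem y hy z hz =>
    rw [mul_assoc]
    exact Submodule.mul_mem_mul hy (w.mem_J_mul a hz)
  | add x _ y _ hx hy => rw [add_mul]; exact add_mem hx hy

/-- Lifting idempotents, inside a subalgebra. -/
lemma exists_lift (B : Subalgebra k A) {x : A} (hx : x ∈ B)
    (h : ∀ i, IsIdempotentElem (w.ρ i x)) :
    ∃ e ∈ B, IsIdempotentElem e ∧ ∀ i, w.ρ i e = w.ρ i x := by
  let f : B →ₐ[k] (∀ i, Module.End k (w.V i)) := (AlgHom.pi w.ρ).comp B.val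
  have hf : ∀ y : B, ∀ i, f y i = w.ρ i y := fun _ _ => rfl
  obtain ⟨e, he, hfe⟩ := exists_isIdempotentElem_eq_of_ker_isNilpotent (f : B →+* _) (fun y hy => by
      have hyJ : (y : A) ∈ w.J := w.mem_J.2 fun i => congrFun (RingHom.mem_ker.1 hy) i
      obtain ⟨m, hm⟩ := w.isNilpotent_of_mem hyJ
      exact ⟨m, Subtype.ext (by simpa using hm)⟩) (f ⟨x, hx⟩) ⟨⟨x, hx⟩, rfl⟩ (funext fun i => h i)
  refine ⟨e, e.2, congrArg Subtype.val he, fun i => ?_⟩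
  have := congrFun hfe i
  exact this

/-- A rank one idempotent. -/
noncomputable def E0 (i : Fin w.n) : Module.End k (w.V i) :=
  (LinearMap.proj 0 : w.V i →ₗ[k] k).smulRight (Pi.single 0 1)

lemma E0_idem (i : Fin w.n) : IsIdempotentElem (w.E0 i) := by
  ext v; simp [E0]

lemma trace_E0 (i : Fin w.n) : LinearMap.trace k _ (w.E0 i) = 1 := by
  rw [E0, LinearMap.trace_smulRight]; simp

lemma exists_e (i : Fin w.n) : ∃ e : A, IsIdempotentElem e ∧ w.ρ i e = w.E0 i ∧
    ∀ j, j ≠ i → w.ρ j e = 0 := by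
  classical
  obtain ⟨x, hx⟩ := w.surj (Pi.single i (w.E0 i))
  obtain ⟨e, -, he, h⟩ := w.exists_lift ⊤ (x := x) trivial (fun j => by
    rw [hx]
    by_cases hj : j = i
    · subst hj; rw [Pi.single_eq_same]; exact w.E0_idem j
    · rw [Pi.single_eq_of_ne hj]; exact .zero)
  refine ⟨e, he, ?_, fun j hj => ?_⟩
  · rw [h, hx, Pi.single_eq_same]
  · rw [h, hx, Pi.single_eq_of_ne hj]

/-- Primitive idempotents. -/
noncomputable def e (i : Fin w.n) : A := (w.exists_e i).choose

lemma e_idem (i : Fin w.n) : w.e i * w.e i = w.e i := (w.exists_e i).choose_spec.1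
lemma ρ_e (i : Fin w.n) : w.ρ i (w.e i) = w.E0 i := (w.exists_e i).choose_spec.2.1
lemma ρ_e_ne {i j : Fin w.n} (h : j ≠ i) : w.ρ j (w.e i) = 0 := (w.exists_e i).choose_spec.2.2 j h

/-- The irreducible characters. -/
noncomputable def χ (i : Fin w.n) : A →ₗ[k] k := LinearMap.trace k _ ∘ₗ (w.ρ i).toLinearMap

lemma χ_apply (i : Fin w.n) (a : A) : w.χ i a = LinearMap.trace k _ (w.ρ i a) := rfl

lemma χ_e (i j : Fin w.n) : w.χ i (w.e j) = if i = j then 1 else 0 := by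
  split_ifs with h
  · subst h; rw [χ_apply, ρ_e, trace_E0]
  · rw [χ_apply, w.ρ_e_ne h, map_zero]

lemma χ_J (i : Fin w.n) {x : A} (hx : x ∈ w.J) : w.χ i x = 0 := by
  rw [χ_apply, w.mem_J.1 hx, map_zero]

lemma χ_one (i : Fin w.n) : w.χ i 1 = w.δ i := by
  rw [χ_apply, map_one, LinearMap.trace_one]; simp

lemma χ_injective : Function.Injective w.χ := by
  intro i j h
  by_contra hij
  have h1 := w.χ_e i i
  rw [h, χ_e, if_neg (Ne.symm hij)] at h1
  simp at h1

lemma trace_functional {n : ℕ} [NeZero n] (f : Module.End k (Fin n → k) →ₗ[k] k)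
    (h : ∀ a b, f (a * b) = f (b * a)) (T : Module.End k (Fin n → k)) :
    f T = f ((LinearMap.proj 0 : (Fin n → k) →ₗ[k] k).smulRight (Pi.single 0 1)) *
      LinearMap.trace k _ T := by
  classical
  let U : Fin n → Fin n → Module.End k (Fin n → k) := fun a b =>
    (LinearMap.proj b : (Fin n → k) →ₗ[k] k).smulRight (Pi.single a 1)
  have hU : ∀ a b c d, U a b * U c d = if b = c then U a d else 0 := by
    intro a b c d
    refine LinearMap.ext fun v => ?_
    simp only [U, Module.End.mul_apply, LinearMap.smulRight_apply, LinearMap.proj_apply, Pi.smul_apply,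
      smul_eq_mul, Pi.single_apply]
    split_ifs <;> simp
  have hT : T = ∑ a, ∑ b, T (Pi.single b 1) a • U a b := by
    refine LinearMap.pi_ext' fun j => LinearMap.ext_ring ?_
    funext i
    simp [U, Pi.single_apply, Finset.sum_apply]
  have hf : ∀ a b, f (U a b) = if a = b then f (U 0 0) else 0 := by
    intro a b
    have h1 : U a b = U a 0 * U 0 b := by rw [hU, if_pos rfl]
    rw [h1, h, hU]
    split_ifs with h2 h3 h3
    · rfl
    · exact absurd h2.symm h3
    · exact absurd h3.symm h2
    · exact map_zero f
  have ht : ∀ a b, LinearMap.trace k _ (U a b) = if a = b then 1 else 0 := by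
    intro a b
    rw [LinearMap.trace_smulRight]
    simp [Pi.single_apply, eq_comm]
  change f T = f (U 0 0) * _
  generalize f (U 0 0) = c at hf ⊢
  have h1 := congrArg f hT
  have h2 := congrArg (LinearMap.trace k (Fin n → k)) hT
  simp only [map_sum, map_smul, hf, ht, smul_eq_mul, mul_ite, mul_one, mul_zero,
    Finset.sum_ite_eq, Finset.mem_univ, if_true] at h1 h2
  rw [h1, h2, Finset.mul_sum]
  exact Finset.sum_congr rfl fun _ _ => mul_comm _ _

/-- A trace function vanishing on the radical is a combination of irreducible characters. -/
lemma eq_sum_χ (f : A →ₗ[k] k) (hc : ∀ a b, f (a * b) = f (b * a)) (hJ : ∀ x ∈ w.J, f x = 0) :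
    f = ∑ i, f (w.e i) • w.χ i := by
  classical
  let π : A →ₗ[k] (∀ i, Module.End k (w.V i)) := LinearMap.pi fun i => (w.ρ i).toLinearMap
  have hπ : ∀ a i, π a i = w.ρ i a := fun _ _ => rfl
  obtain ⟨s, hs⟩ := π.exists_rightInverse_of_surjective (LinearMap.range_eq_top.2 fun f => by
    obtain ⟨a, ha⟩ := w.surj f
    exact ⟨a, funext ha⟩)
  have hs' : ∀ x i, w.ρ i (s x) = x i := fun x i => congrFun (LinearMap.congr_fun hs x) i
  have hfa : ∀ a b, (∀ i, w.ρ i a = w.ρ i b) → f a = f b := by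
    intro a b h
    rw [← sub_eq_zero, ← map_sub]
    exact hJ _ (w.mem_J.2 fun i => by rw [map_sub, h, sub_self])
  ext a
  have h1 : f a = ∑ i, f (s (Pi.single i (w.ρ i a))) := by
    rw [← map_sum, ← map_sum]
    refine hfa _ _ fun i => ?_
    rw [hs', Finset.sum_apply, Finset.sum_pi_single]
    simp
  rw [h1, LinearMap.sum_apply]
  refine Finset.sum_congr rfl fun i _ => ?_
  let g : Module.End k (w.V i) →ₗ[k] k := f ∘ₗ s ∘ₗ LinearMap.single k (fun i => Module.End k (w.V i)) i
  have hg : ∀ T, g T = f (s (Pi.single i T)) := fun _ => rfl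
  have hgc : ∀ a b, g (a * b) = g (b * a) := by
    intro a b
    have h2 : ∀ a b, g (a * b) = f (s (Pi.single i a) * s (Pi.single i b)) := by
      intro a b
      rw [hg]
      refine hfa _ _ fun j => ?_
      rw [hs', map_mul, hs', hs', Pi.single_mul, Pi.mul_apply]
    rw [h2, h2, hc]
  have h3 := trace_functional g hgc (w.ρ i a)
  rw [← hg, h3, LinearMap.smul_apply, smul_eq_mul, χ_apply]
  congr 1
  change g (w.E0 i) = _
  rw [hg]
  refine hfa _ _ fun j => ?_
  rw [hs']
  by_cases hj : j = i
  · subst hj; rw [Pi.single_eq_same, ρ_e]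
  · rw [Pi.single_eq_of_ne hj, w.ρ_e_ne hj]

end Wed

section EndFacts
variable {k : Type} [Field k] {V : Type} [AddCommGroup V] [Module k V] [FiniteDimensional k V]

lemma end_eq_zero_of_isNilpotent {g : Module.End k V} (h : ∀ f, IsNilpotent (f * g)) : g = 0 := by
  refine LinearMap.ext fun v => (Module.forall_dual_apply_eq_zero_iff k _).1 fun φ => ?_
  have h1 : φ.smulRight v * g = (φ ∘ₗ g).smulRight v := rfl
  have h2 := LinearMap.isNilpotent_trace_of_isNilpotent (h (φ.smulRight v))
  rw [h1, LinearMap.trace_smulRight] at h2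
  exact h2.eq_zero

lemma end_prime {E g : Module.End k V} (hE : E ≠ 0) (h : ∀ f, E * f * g = 0) : g = 0 := by
  obtain ⟨v, hv⟩ : ∃ v, E v ≠ 0 := by
    by_contra! hc
    exact hE (LinearMap.ext hc)
  refine LinearMap.ext fun u => (Module.forall_dual_apply_eq_zero_iff k _).1 fun φ => ?_
  have h1 : φ (g u) • E v = 0 := by
    have := LinearMap.congr_fun (h (φ.smulRight v)) u
    simpa using this
  exact (smul_eq_zero.1 h1).resolve_right hv

end EndFacts

namespace Wed
variable {k : Type} [Field k] {A : Type} [Ring A] [Algebra k A] (w : Wed k A)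

lemma surjective_ρ (i : Fin w.n) : Function.Surjective (w.ρ i) := by
  classical
  intro f
  obtain ⟨a, ha⟩ := w.surj (Pi.single i f)
  exact ⟨a, by rw [ha, Pi.single_eq_same]⟩

lemma mem_J_of_isNilpotent {x : A} (h : ∀ a, IsNilpotent (a * x)) : x ∈ w.J := by
  refine w.mem_J.2 fun i => end_eq_zero_of_isNilpotent fun f => ?_
  obtain ⟨a, rfl⟩ := w.surjective_ρ i f
  rw [← map_mul]
  exact (h a).map (w.ρ i)

variable {W : Type} [AddCommGroup W] [Module k W] [FiniteDimensional k W]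

lemma chr_J (σ : A →ₐ[k] Module.End k W) {x : A} (hx : x ∈ w.J) :
    LinearMap.trace k W (σ x) = 0 :=
  (LinearMap.isNilpotent_trace_of_isNilpotent ((w.isNilpotent_of_mem hx).map σ)).eq_zero

lemma apply_J {σ : A →ₐ[k] Module.End k W} (hσ : Function.Surjective σ) {x : A} (hx : x ∈ w.J) :
    σ x = 0 := by
  refine end_eq_zero_of_isNilpotent fun f => ?_
  obtain ⟨a, rfl⟩ := hσ f
  rw [← map_mul]
  exact (w.isNilpotent_of_mem (w.mul_mem_J a hx)).map σ

/-- Composition multiplicities. -/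
noncomputable def mult (σ : A →ₐ[k] Module.End k W) (i : Fin w.n) : ℕ :=
  Module.finrank k (LinearMap.range (σ (w.e i)))

lemma idem_e (σ : A →ₐ[k] Module.End k W) (i : Fin w.n) : IsIdempotentElem (σ (w.e i)) := by
  rw [IsIdempotentElem, ← map_mul, w.e_idem]

lemma sum_e_ne_zero [Nontrivial W] [CharZero k] {σ : A →ₐ[k] Module.End k W} : ∃ i, σ (w.e i) ≠ 0 := by
  by_contra! hc
  have h := w.eq_sum_χ (LinearMap.trace k W ∘ₗ σ.toLinearMap)
    (fun a b => by
      simp only [LinearMap.comp_apply, AlgHom.toLinearMap_apply, map_mul σ]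
      exact LinearMap.trace_mul_comm k _ _)
    (fun x hx => w.chr_J σ hx)
  have h1 := LinearMap.congr_fun h 1
  simp [hc] at h1
  exact Module.finrank_pos.ne' h1

/-- Every surjective matrix representation is one of the `ρ i`. -/
lemma exists_class [Nontrivial W] [CharZero k] {σ : A →ₐ[k] Module.End k W} (hσ : Function.Surjective σ) :
    ∃ i, ∃ T : W ≃ₗ[k] w.V i, ∀ a, w.ρ i a = T.conjAlgEquiv k (σ a) := by
  classical
  obtain ⟨i, hi⟩ := w.sum_e_ne_zero (σ := σ)
  have hker : ∀ x, w.ρ i x = 0 → σ x = 0 := by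
    intro x hx
    refine end_prime hi fun f => ?_
    obtain ⟨a, rfl⟩ := hσ f
    rw [← map_mul, ← map_mul]
    refine w.apply_J hσ (w.mem_J.2 fun j => ?_)
    by_cases hj : j = i
    · subst hj; rw [map_mul, hx, mul_zero]
    · rw [map_mul, map_mul, w.ρ_e_ne hj, zero_mul, zero_mul]
  have hker' : ∀ x, σ x = 0 → w.ρ i x = 0 := by
    intro x hx
    by_contra h0
    obtain ⟨v, hv⟩ : ∃ v, w.ρ i x v ≠ 0 := by
      by_contra! hc
      exact h0 (LinearMap.ext hc)
    obtain ⟨φ, hφ⟩ : ∃ φ : Module.Dual k (w.V i), φ (w.ρ i x v) ≠ 0 := by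
      by_contra! hc
      exact hv ((Module.forall_dual_apply_eq_zero_iff k _).1 hc)
    obtain ⟨b, hb⟩ := w.surjective_ρ i ((LinearMap.proj 0 : w.V i →ₗ[k] k).smulRight v)
    obtain ⟨a, ha⟩ := w.surjective_ρ i
      (φ.smulRight ((φ (w.ρ i x v))⁻¹ • (Pi.single 0 1 : w.V i)))
    refine hi ?_
    have h1 : w.ρ i (a * x * b - w.e i) = 0 := by
      rw [map_sub, map_mul, map_mul, ha, hb, w.ρ_e, sub_eq_zero]
      refine LinearMap.ext fun u => ?_
      simp only [Module.End.mul_apply, LinearMap.smulRight_apply, E0, map_smul, smul_smul,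
        mul_assoc, mul_inv_cancel₀ hφ, mul_one]
    have h2 := hker _ h1
    rwa [map_sub, map_mul, map_mul, hx, mul_zero, zero_mul, zero_sub, neg_eq_zero] at h2
  obtain ⟨s, hs⟩ := σ.toLinearMap.exists_rightInverse_of_surjective (LinearMap.range_eq_top.2 hσ)
  have hs' : ∀ f, σ (s f) = f := LinearMap.congr_fun hs
  have hρs : ∀ a, w.ρ i (s (σ a)) = w.ρ i a := fun a => by
    rw [← sub_eq_zero, ← map_sub]
    exact hker' _ (by rw [map_sub, hs', sub_self])
  let φ : Module.End k W →ₐ[k] Module.End k (w.V i) :=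
    AlgHom.ofLinearMap ((w.ρ i).toLinearMap ∘ₗ s)
      (by
        have := hρs 1
        rw [map_one σ, map_one (w.ρ i)] at this
        exact this)
      (fun f g => by
        change w.ρ i (s (f * g)) = w.ρ i (s f) * w.ρ i (s g)
        rw [← map_mul (w.ρ i), ← hρs (s f * s g), map_mul σ, hs', hs'])
  have hφ : Function.Bijective φ := by
    constructor
    · rw [injective_iff_map_eq_zero]
      intro f hf
      have := hker _ hf
      rwa [hs'] at this
    · intro f
      obtain ⟨a, rfl⟩ := w.surjective_ρ i f
      exact ⟨σ a, hρs a⟩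
  obtain ⟨T, hT⟩ := (AlgEquiv.ofBijective φ hφ).eq_linearEquivConjAlgEquiv
  refine ⟨i, T, fun a => ?_⟩
  rw [← hT]
  exact (hρs a).symm

lemma trace_conjAlgEquiv {V : Type} [AddCommGroup V] [Module k V] (T : W ≃ₗ[k] V) (f : Module.End k W) :
    LinearMap.trace k V (T.conjAlgEquiv k f) = LinearMap.trace k W f :=
  LinearMap.trace_conj' f T

/-- Class of a surjective representation. -/
lemma exists_class_chr [Nontrivial W] [CharZero k] {σ : A →ₐ[k] Module.End k W}
    (hσ : Function.Surjective σ) :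
    ∃ i, (∀ a, w.χ i a = LinearMap.trace k W (σ a)) ∧ w.δ i = Module.finrank k W ∧
      ∀ a, w.ρ i a = 0 ↔ σ a = 0 := by
  obtain ⟨i, T, hT⟩ := w.exists_class hσ
  refine ⟨i, fun a => ?_, ?_, fun a => ?_⟩
  · rw [χ_apply, hT, trace_conjAlgEquiv]
  · rw [T.finrank_eq]; simp
  · rw [hT, map_eq_zero_iff _ (T.conjAlgEquiv k).injective]

lemma map_mem_J [CharZero k] (φ : A ≃ₐ[k] A) {x : A} (hx : x ∈ w.J) : φ x ∈ w.J := by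
  refine w.mem_J.2 fun i => ?_
  have hs : Function.Surjective ((w.ρ i).comp φ.toAlgHom) :=
    (w.surjective_ρ i).comp φ.surjective
  exact w.apply_J hs hx

lemma map_mem_J_pow [CharZero k] (φ : A ≃ₐ[k] A) (m : ℕ) {x : A} (hx : x ∈ w.J ^ m) :
    φ x ∈ w.J ^ m := by
  have h : w.J.map φ.toLinearMap ≤ w.J := by
    rintro _ ⟨y, hy, rfl⟩
    exact w.map_mem_J φ hy
  have h2 : (w.J ^ m).map φ.toAlgHom.toLinearMap ≤ w.J ^ m := by
    rw [Submodule.map_pow]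
    exact pow_le_pow_left' h m
  exact h2 ⟨x, hx, rfl⟩

/-- The permutation of simple representations induced by an automorphism. -/
lemma exists_perm [CharZero k] (φ : A ≃ₐ[k] A) (i : Fin w.n) :
    ∃ j, (∀ a, w.χ j a = w.χ i (φ a)) ∧ w.δ j = w.δ i ∧ ∀ a, w.ρ j a = 0 ↔ w.ρ i (φ a) = 0 := by
  have hs : Function.Surjective ((w.ρ i).comp φ.toAlgHom) :=
    (w.surjective_ρ i).comp φ.surjective
  obtain ⟨j, h1, h2, h3⟩ := w.exists_class_chr hs
  exact ⟨j, h1, by simpa using h2, h3⟩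

noncomputable def perm [CharZero k] (φ : A ≃ₐ[k] A) (i : Fin w.n) : Fin w.n := (w.exists_perm φ i).choose

section
variable [CharZero k]

lemma χ_perm (φ : A ≃ₐ[k] A) (i : Fin w.n) (a : A) : w.χ (w.perm φ i) a = w.χ i (φ a) :=
  (w.exists_perm φ i).choose_spec.1 a
lemma δ_perm (φ : A ≃ₐ[k] A) (i : Fin w.n) : w.δ (w.perm φ i) = w.δ i :=
  (w.exists_perm φ i).choose_spec.2.1
lemma ρ_perm (φ : A ≃ₐ[k] A) (i : Fin w.n) (a : A) : w.ρ (w.perm φ i) a = 0 ↔ w.ρ i (φ a) = 0 :=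
  (w.exists_perm φ i).choose_spec.2.2 a
lemma perm_eq (φ : A ≃ₐ[k] A) {i j : Fin w.n} (h : ∀ a, w.χ j a = w.χ i (φ a)) : w.perm φ i = j :=
  w.χ_injective (LinearMap.ext fun a => by rw [χ_perm, h])
end

end Wed

namespace Wed
variable {k : Type} [Field k] {A : Type} [Ring A] [Algebra k A] (w : Wed k A)

lemma isSemisimpleRing_of_J [FiniteDimensional k A] (h : w.J = ⊥) : IsSemisimpleRing A := by
  have : IsArtinianRing A := IsArtinianRing.of_finite k A
  rw [IsArtinianRing.isSemisimpleRing_iff_jacobson]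
  rw [eq_bot_iff]
  intro x hx
  obtain ⟨m, hm⟩ := IsSemiprimaryRing.isNilpotent (R := A)
  have h1 : x ∈ w.J := by
    refine w.mem_J_of_isNilpotent fun a => ⟨m, ?_⟩
    have h2 : (a * x) ^ m ∈ Ring.jacobson A ^ m :=
      Ideal.pow_mem_pow (Ideal.mul_mem_left _ a hx) m
    rw [hm] at h2
    simpa using h2
  rw [h] at h1
  simpa using h1

lemma J_of_isSemisimpleRing [FiniteDimensional k A] (h : IsSemisimpleRing A) : w.J = ⊥ := by
  have : IsArtinianRing A := IsArtinianRing.of_finite k A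
  rw [IsArtinianRing.isSemisimpleRing_iff_jacobson] at h
  rw [eq_bot_iff]
  intro x hx
  have h1 : x ∈ Ring.jacobson A := by
    rw [← Ideal.jacobson_bot, Ideal.mem_jacobson_iff]
    intro y
    obtain ⟨u, hu⟩ := (w.isNilpotent_of_mem (w.mul_mem_J y hx)).isUnit_one_add
    refine ⟨↑u⁻¹, ?_⟩
    have h2 : (↑u⁻¹ : A) * y * x + ↑u⁻¹ = ↑u⁻¹ * (1 + y * x) := by noncomm_ring
    rw [h2, ← hu, Units.inv_mul, sub_self]
    exact Ideal.zero_mem _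
  rw [h] at h1
  simpa using h1

end Wed

namespace IntData
variable {k : Type} [Field k] {A : Type} [Ring A] [HopfAlgebra k A] [FiniteDimensional k A]
variable (d : IntData k A)
local notation "𝒮" => HopfAlgebra.antipode k (A := A)

/-- The squared antipode as an automorphism. -/
noncomputable def SS : A ≃ₐ[k] A :=
  AlgEquiv.ofLinearEquiv (LinearEquiv.ofBijective (𝒮 ∘ₗ 𝒮)
    (d.S_bijective.comp d.S_bijective)) (by simp)
    (fun a b => by simp [S_mul])

lemma SS_apply (a : A) : d.SS a = 𝒮 (𝒮 a) := rfl

variable [CharZero k] (w : Wed k A)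

lemma trace_SS_of_mem_J (d : IntData k A) {c : A} (hc : c ∈ w.J) :
    LinearMap.trace k A (LinearMap.mulLeft k c ∘ₗ 𝒮 ∘ₗ 𝒮) = 0 := by
  refine (LinearMap.isNilpotent_trace_of_isNilpotent ?_).eq_zero
  set f : Module.End k A := LinearMap.mulLeft k c ∘ₗ 𝒮 ∘ₗ 𝒮 with hf
  have h : ∀ m a, (f ^ (m + 1)) a ∈ w.J ^ (m + 1) := by
    intro m
    induction m with
    | zero =>
      intro a
      rw [zero_add, pow_one, pow_one]
      exact w.mem_J_mul _ hc
    | succ m ih =>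
      intro a
      rw [pow_succ' f, Module.End.mul_apply, pow_succ' w.J]
      exact Submodule.mul_mem_mul hc (w.map_mem_J_pow d.SS (m + 1) (ih a))
  obtain ⟨m, hm⟩ := w.exists_J_pow
  refine ⟨m + 1, LinearMap.ext fun a => ?_⟩
  have := h m a
  rw [pow_succ w.J, hm, Submodule.bot_mul] at this
  simpa using this

lemma counit_t_of_not_ss [IsAlgClosed k] (h : ¬ IsSemisimpleRing A) : counit (R := k) d.t = 0 := by
  by_contra h0
  obtain ⟨w⟩ := exists_wed k A
  refine h (w.isSemisimpleRing_of_J ?_)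
  rw [eq_bot_iff]
  intro c hc
  have h1 : ∀ b, d.lam (b * c) = 0 := by
    intro b
    have h2 := d.trace_SS_of_mem_J w (w.mul_mem_J b hc)
    rw [d.trace_mulLeft_SS] at h2
    exact (mul_eq_zero.1 h2).resolve_right h0
  exact d.isInt.nondeg d.ne_zero h1

lemma t_mem_J (h : counit (R := k) d.t = 0) : d.t ∈ w.J := by
  refine w.mem_J_of_isNilpotent fun a => ⟨2, ?_⟩
  rw [d.mul_t, pow_two, smul_mul_smul_comm, d.mul_t, h, zero_smul, smul_zero]

lemma t_ne_zero : d.t ≠ 0 := by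
  intro h
  have := d.lam_t
  rw [h, map_zero] at this
  exact zero_ne_one this

end IntData

section EndFacts
variable {k : Type} [Field k]

lemma trace_mulLeft_mulRight {V : Type} [AddCommGroup V] [Module k V] [FiniteDimensional k V]
    (P Q : Module.End k V) :
    LinearMap.trace k (Module.End k V) (LinearMap.mulLeft k P ∘ₗ LinearMap.mulRight k Q) =
      LinearMap.trace k V P * LinearMap.trace k V Q := by
  have h : LinearMap.mulLeft k P ∘ₗ LinearMap.mulRight k Q =
      (homEquiv V V).conj (TensorProduct.map P (Module.Dual.transpose Q)) := by
    rw [LinearEquiv.conj_apply, LinearEquiv.eq_comp_toLinearMap_symm]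
    refine TensorProduct.ext' fun v f => LinearMap.ext fun u => ?_
    simp [Module.Dual.transpose_apply]
  rw [h, LinearMap.trace_conj', LinearMap.trace_tensorProduct', LinearMap.trace_transpose']

lemma exists_smul_of_central {n : ℕ} [NeZero n] {T : Module.End k (Fin n → k)}
    (h : ∀ f, T * f = f * T) : ∃ c : k, T = c • 1 := by
  refine ⟨T (Pi.single 0 1) 0, LinearMap.ext fun v => ?_⟩
  have := LinearMap.congr_fun (h ((LinearMap.proj 0 : (Fin n → k) →ₗ[k] k).smulRight v))
    (Pi.single 0 1)
  simpa using this

lemma trace_pi {ι : Type} [Fintype ι] [DecidableEq ι] {M : ι → Type} [∀ i, AddCommGroup (M i)]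
    [∀ i, Module k (M i)] [∀ i, FiniteDimensional k (M i)] (ψ : Module.End k (∀ i, M i)) :
    LinearMap.trace k _ ψ =
      ∑ i, LinearMap.trace k (M i) (LinearMap.proj i ∘ₗ ψ ∘ₗ LinearMap.single k M i) := by
  have h : ψ = ∑ i, (ψ ∘ₗ LinearMap.single k M i) ∘ₗ LinearMap.proj i := by
    refine LinearMap.ext fun x => ?_
    simp only [LinearMap.sum_apply, LinearMap.comp_apply, ← map_sum]
    congr 1
    exact (Finset.univ_sum_single x).symm
  conv_lhs => rw [h]
  rw [map_sum]
  refine Finset.sum_congr rfl fun i _ => ?_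
  rw [LinearMap.trace_comp_comm']

end EndFacts

namespace Wed
variable {k : Type} [Field k] [CharZero k] {A : Type} [Ring A] [Algebra k A] (w : Wed k A)

lemma exists_conj [IsAlgClosed k] (φ : A ≃ₐ[k] A) {m : ℕ} (hm : 0 < m) (hφ : ∀ a, (φ ^ m) a = a)
    {i : Fin w.n} (hi : w.perm φ i = i) :
    ∃ T : Module.End k (w.V i), T ^ m = 1 ∧ ∀ a, w.ρ i (φ a) * T = T * w.ρ i a := by
  have hs : Function.Surjective ((w.ρ i).comp φ.toAlgHom) :=
    (w.surjective_ρ i).comp φ.surjective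
  obtain ⟨j, T, hT⟩ := w.exists_class hs
  have hj : j = i := by
    rw [← hi]
    refine (w.perm_eq φ fun a => ?_).symm
    rw [χ_apply, hT, trace_conjAlgEquiv]
    rfl
  subst hj
  let T' : Module.End k (w.V j) := T.symm.toLinearMap
  have h1 : ∀ a, w.ρ j (φ a) * T' = T' * w.ρ j a := by
    intro a
    conv_rhs => rw [hT]
    refine LinearMap.ext fun v => ?_
    simp [T', LinearEquiv.conjAlgEquiv_apply]
  have h2 : ∀ r a, w.ρ j ((φ ^ r) a) * T' ^ r = T' ^ r * w.ρ j a := by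
    intro r
    induction r with
    | zero => intro a; simp
    | succ r ih =>
      intro a
      rw [pow_succ φ, AlgEquiv.mul_apply, pow_succ T', ← mul_assoc, ih, mul_assoc, h1, mul_assoc]
  obtain ⟨c, hc⟩ := exists_smul_of_central (T := T' ^ m) fun f => by
    obtain ⟨a, rfl⟩ := w.surjective_ρ j f
    rw [← h2, hφ]
  have hc0 : c ≠ 0 := by
    rintro rfl
    rw [zero_smul] at hc
    have h3 : T' ^ m * (T.toLinearMap : Module.End k (w.V j)) ^ m = 1 := by
      have hcomm : Commute T' T.toLinearMap := by
        refine LinearMap.ext fun v => ?_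
        simp [T']
      rw [← hcomm.mul_pow]
      have : T' * T.toLinearMap = 1 := LinearMap.ext fun v => by simp [T']
      rw [this, one_pow]
    rw [hc, zero_mul] at h3
    exact zero_ne_one h3
  obtain ⟨b, hb⟩ := IsAlgClosed.exists_pow_nat_eq c hm
  have hb0 : b ≠ 0 := by
    rintro rfl
    rw [zero_pow hm.ne'] at hb
    exact hc0 hb.symm
  refine ⟨b⁻¹ • T', ?_, fun a => ?_⟩
  · rw [smul_pow, hc, inv_pow, hb, smul_smul, inv_mul_cancel₀ hc0, one_smul]
  · rw [mul_smul_comm, h1, smul_mul_assoc]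

lemma trace_ne_zero [IsAlgClosed k] [FiniteDimensional k A] (hJ : w.J = ⊥) (φ : A ≃ₐ[k] A) {m : ℕ} (hm : 0 < m)
    (hφ : ∀ a, (φ ^ m) a = a) {i₀ : Fin w.n} (h1 : w.δ i₀ = 1) (h0 : w.perm φ i₀ = i₀) :
    LinearMap.trace k A φ.toLinearMap ≠ 0 := by
  classical
  intro htr
  let π : A →ₗ[k] (∀ i, Module.End k (w.V i)) := LinearMap.pi fun i => (w.ρ i).toLinearMap
  have hπ : Function.Bijective π := by
    constructor
    · rw [injective_iff_map_eq_zero]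
      intro a ha
      have : a ∈ w.J := w.mem_J.2 fun i => congrFun ha i
      rw [hJ] at this
      simpa using this
    · intro f
      obtain ⟨a, ha⟩ := w.surj f
      exact ⟨a, funext ha⟩
  let e := LinearEquiv.ofBijective π hπ
  have he : ∀ x i, w.ρ i (e.symm x) = x i := fun x i =>
    congrFun (e.apply_symm_apply x) i
  choose T hT1 hT2 using fun i : {i // w.perm φ i = i} => w.exists_conj φ hm hφ i.2
  have h2 : ∀ i : {i // w.perm φ i = i}, LinearMap.trace k _ (LinearMap.proj i.1 ∘ₗ e.conj φ.toLinearMap ∘ₗ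
      LinearMap.single k (fun i => Module.End k (w.V i)) i.1) = LinearMap.trace k _ (T i) * LinearMap.trace k _ (T i ^ (m - 1)) := by
    intro i
    rw [← trace_mulLeft_mulRight]
    congr 1
    refine LinearMap.ext fun f => ?_
    have : T i * T i ^ (m - 1) = 1 := by rw [← pow_succ', Nat.sub_add_cancel hm, hT1]
    simp only [LinearMap.comp_apply, LinearEquiv.conj_apply, LinearMap.proj_apply,
      LinearMap.mulLeft_apply, LinearMap.mulRight_apply, LinearMap.single_apply]
    change w.ρ i.1 (φ (e.symm (Pi.single i.1 f))) = _
    calc _ = w.ρ i.1 (φ (e.symm (Pi.single i.1 f))) * (T i * T i ^ (m - 1)) := by rw [this, mul_one]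
      _ = _ := by rw [← mul_assoc, hT2, he, Pi.single_eq_same, mul_assoc]
  have h3 : ∀ i, w.perm φ i ≠ i → LinearMap.proj i ∘ₗ e.conj φ.toLinearMap ∘ₗ
      LinearMap.single k (fun i => Module.End k (w.V i)) i = 0 := by
    intro i hi
    refine LinearMap.ext fun f => ?_
    change w.ρ i (φ (e.symm (Pi.single i f))) = 0
    rw [← ρ_perm, he, Pi.single_eq_of_ne hi]
  have h4 : ∑ i : {i // w.perm φ i = i}, LinearMap.trace k _ (T i) * LinearMap.trace k _ (T i ^ (m - 1)) = 0 := by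
    rw [← LinearMap.trace_conj' φ.toLinearMap e, trace_pi,
      ← Finset.sum_subset (Finset.subset_univ (Finset.univ.filter fun i => w.perm φ i = i)),
      ← Finset.sum_subtype_eq_sum_filter] at htr
    · rw [← htr]
      refine Finset.sum_congr (by ext; simp) fun i _ => (h2 i).symm
    · intro i _ hi
      rw [h3 i (by simpa using hi), map_zero]
  have h5 := trace_eq_zero_of_sum_trace_mul hm T hT1 h4 ⟨i₀, h0⟩ (Finset.mem_univ _)
  generalize hS : T ⟨i₀, h0⟩ = S at h5
  have hS1 : S ^ m = 1 := by rw [← hS, hT1]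
  obtain ⟨c, hc⟩ := exists_smul_of_central (T := S) fun f => by
    have h6 : ∀ g : Module.End k (w.V i₀), ∃ c : k, g = c • 1 := by
      intro g
      have : Module.finrank k (Module.End k (w.V i₀)) = 1 := by
        rw [Module.finrank_linearMap]; simp [h1]
      obtain ⟨c, hc⟩ := (finrank_eq_one_iff_of_nonzero' (1 : Module.End k (w.V i₀)) one_ne_zero).1 this g
      exact ⟨c, hc.symm⟩
    obtain ⟨c, rfl⟩ := h6 f
    simp
  rw [hc, map_smul, LinearMap.trace_one] at h5
  simp [h1] at h5
  rw [hc, h5, zero_smul, zero_pow hm.ne'] at hS1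
  exact zero_ne_one hS1

end Wed

section

variable {k : Type} [Field k] [CharZero k] {A : Type} [Ring A] [HopfAlgebra k A] [FiniteDimensional k A]
  (w : Wed k A)
local notation "𝒮" => HopfAlgebra.antipode k (A := A)

namespace Wed

lemma exists_idx (f : A →ₐ[k] k) : ∃ i, w.δ i = 1 ∧ w.χ i = f.toLinearMap := by
  let σ : A →ₐ[k] Module.End k k := (Algebra.lmul k k).comp f
  have hs : Function.Surjective σ := by
    intro g
    refine ⟨algebraMap k A (g 1), LinearMap.ext_ring ?_⟩
    simp [σ]
  obtain ⟨i, h1, h2, -⟩ := w.exists_class_chr hs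
  refine ⟨i, by simpa using h2, LinearMap.ext fun a => ?_⟩
  rw [h1]
  have : σ a = f a • 1 := LinearMap.ext_ring (by simp [σ])
  rw [this, map_smul, LinearMap.trace_one]
  simp

/-- The index of a one-dimensional representation. -/
noncomputable def idx (χ : Ch k A) : Fin w.n := (w.exists_idx χ.toAlg).choose

lemma δ_idx (χ : Ch k A) : w.δ (w.idx χ) = 1 := (w.exists_idx χ.toAlg).choose_spec.1
lemma χ_idx (χ : Ch k A) : w.χ (w.idx χ) = χ.fn := (w.exists_idx χ.toAlg).choose_spec.2

lemma idx_injective : Function.Injective w.idx := by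
  intro χ ψ h
  apply Ch.fn_injective
  rw [← w.χ_idx, h, w.χ_idx]

lemma idx_eq {χ : Ch k A} {i : Fin w.n} (h : w.χ i = χ.fn) : w.idx χ = i :=
  w.χ_injective (by rw [h, χ_idx])

lemma ρ_of_δ_eq_one {i : Fin w.n} (h : w.δ i = 1) (a : A) : w.ρ i a = w.χ i a • 1 := by
  have h1 : Module.finrank k (Module.End k (w.V i)) = 1 := by
    rw [Module.finrank_linearMap]; simp [h]
  obtain ⟨c, hc⟩ := (finrank_eq_one_iff_of_nonzero' (1 : Module.End k (w.V i)) one_ne_zero).1 h1 (w.ρ i a)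
  rw [χ_apply, ← hc, map_smul, LinearMap.trace_one]
  simp [h]

lemma exists_eq_idx {i : Fin w.n} (h : w.δ i = 1) : ∃ χ : Ch k A, w.idx χ = i := by
  let f : A →ₐ[k] k := AlgHom.ofLinearMap (w.χ i) (by rw [χ_one, h, Nat.cast_one]) (fun a b => by
    rw [χ_apply, map_mul, w.ρ_of_δ_eq_one h a, w.ρ_of_δ_eq_one h b, smul_mul_smul_comm, one_mul,
      map_smul, LinearMap.trace_one]
    simp [h])
  exact ⟨Ch.ofAlg f, w.idx_eq (by rw [Ch.fn_ofAlg]; rfl)⟩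

lemma ρ_idx (χ : Ch k A) (a : A) : w.ρ (w.idx χ) a = χ.fn a • 1 := by
  rw [w.ρ_of_δ_eq_one (w.δ_idx χ), χ_idx]

/-- The index of the trivial representation. -/
noncomputable def i0 : Fin w.n := w.idx 1

end Wed

lemma not_isSemisimpleRing_dualH [IsAlgClosed k] (h : ¬ IsSemisimpleRing A) : ¬ IsSemisimpleRing (DualH k A) := by
  intro hB
  have hA : Nontrivial A := by
    by_contra hA
    rw [not_nontrivial_iff_subsingleton] at hA
    exact h inferInstance
  have : Nontrivial (DualH k A) := by
    rw [← Module.finrank_pos_iff (R := k), DualH.finrank_eq, Module.finrank_pos_iff]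
    exact hA
  obtain ⟨d⟩ := IntData.exists_intData k A
  obtain ⟨d'⟩ := IntData.exists_intData k (DualH k A)
  obtain ⟨w⟩ := exists_wed k (DualH k A)
  obtain ⟨N, hN, hS⟩ := d'.exists_S_pow
  have hpow : ∀ r a, (d'.SS ^ r) a =
      ((HopfAlgebra.antipode k (A := DualH k A) : Module.End k (DualH k A)) ^ (2 * r)) a := by
    intro r
    induction r with
    | zero => intro a; rfl
    | succ r ih =>
      intro a
      rw [pow_succ, AlgEquiv.mul_apply, ih, mul_add, pow_add, Module.End.mul_apply]
      rfl
  refine w.trace_ne_zero (w.J_of_isSemisimpleRing hB) d'.SS hN (fun a => ?_) (w.δ_idx 1)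
    (w.perm_eq _ fun a => ?_) ?_
  · rw [hpow, mul_comm, pow_mul, hS, one_pow, Module.End.one_apply]
  · rw [w.χ_idx, Ch.fn_one', d'.SS_apply, HopfAlgebra.counit_antipode, HopfAlgebra.counit_antipode]
  · have h1 : d'.SS.toLinearMap = DualH.eqv.symm.conj (Module.Dual.transpose (𝒮 ∘ₗ 𝒮)) := by
      rfl
    rw [h1, LinearMap.trace_conj', LinearMap.trace_transpose']
    have h2 := d.trace_mulLeft_SS 1
    rw [LinearMap.mulLeft_one, LinearMap.id_comp, d.counit_t_of_not_ss h, mul_zero] at h2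
    exact h2

end

namespace Wed
section Alg
variable {k : Type} [Field k] [CharZero k] {A : Type} [Ring A] [Algebra k A] (w : Wed k A)
variable {W : Type} [AddCommGroup W] [Module k W] [FiniteDimensional k W]

lemma mult_cast (σ : A →ₐ[k] Module.End k W) (i : Fin w.n) :
    (w.mult σ i : k) = LinearMap.trace k W (σ (w.e i)) :=
  (((LinearMap.isProj_range_iff_isIdempotentElem _).2 (w.idem_e σ i)).trace).symm

lemma trace_eq_sum (σ : A →ₐ[k] Module.End k W) (a : A) :
    LinearMap.trace k W (σ a) = ∑ i, (w.mult σ i : k) * w.χ i a := by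
  have h := w.eq_sum_χ (LinearMap.trace k W ∘ₗ σ.toLinearMap)
    (fun a b => by
      simp only [LinearMap.comp_apply, AlgHom.toLinearMap_apply, map_mul σ]
      exact LinearMap.trace_mul_comm k _ _)
    (fun x hx => w.chr_J σ hx)
  have h1 := LinearMap.congr_fun h a
  simpa [mult_cast] using h1

lemma sum_δ_mult (σ : A →ₐ[k] Module.End k W) : ∑ i, w.δ i * w.mult σ i = Module.finrank k W := by
  have h := w.trace_eq_sum σ 1
  simp only [map_one, LinearMap.trace_one, χ_one] at h
  have h2 : ((∑ i, w.δ i * w.mult σ i : ℕ) : k) = (Module.finrank k W : ℕ) := by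
    rw [h]; push_cast
    exact Finset.sum_congr rfl fun _ _ => mul_comm _ _
  exact_mod_cast h2

lemma mult_eq_zero_iff {σ : A →ₐ[k] Module.End k W} {i : Fin w.n} : w.mult σ i = 0 ↔ σ (w.e i) = 0 := by
  rw [mult, Submodule.finrank_eq_zero, LinearMap.range_eq_bot]

end Alg

section Cartan
variable {k : Type} [Field k] [CharZero k] {A : Type} [Ring A] [Algebra k A] [FiniteDimensional k A]
  (w : Wed k A)

/-- The dimensions of the indecomposable projective representations. -/
noncomputable def D (i : Fin w.n) : ℕ := w.mult (lreg k A) i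

lemma trace_mulLeft (a : A) : LinearMap.trace k A (LinearMap.mulLeft k a) = ∑ i, (w.D i : k) * w.χ i a :=
  w.trace_eq_sum (lreg k A) a

lemma sum_δ_D : ∑ i, w.δ i * w.D i = Module.finrank k A := w.sum_δ_mult _

lemma e_ne_zero (i : Fin w.n) : w.e i ≠ 0 := by
  intro h
  have := w.χ_e i i
  rw [h, map_zero, if_pos rfl] at this
  exact zero_ne_one this

lemma D_pos (i : Fin w.n) : 0 < w.D i := by
  rw [Nat.pos_iff_ne_zero, D, Ne, mult_eq_zero_iff]
  intro h
  have := LinearMap.congr_fun h 1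
  simp [w.e_ne_zero] at this

lemma perm_injective (φ : A ≃ₐ[k] A) : Function.Injective (w.perm φ) := by
  intro i j h
  refine w.χ_injective (LinearMap.ext fun a => ?_)
  obtain ⟨b, rfl⟩ := φ.surjective a
  rw [← χ_perm, h, χ_perm]

lemma D_eq_of_trace {f : A →ₗ[k] A} (hf : ∀ a, LinearMap.trace k A (LinearMap.mulLeft k (f a)) =
    LinearMap.trace k A (LinearMap.mulLeft k a)) {p : Fin w.n → Fin w.n} (hp : Function.Injective p)
    (h : ∀ i a, w.χ (p i) a = w.χ i (f a)) (i : Fin w.n) : w.D (p i) = w.D i := by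
  have h1 := hf (w.e (p i))
  rw [w.trace_mulLeft, w.trace_mulLeft] at h1
  simp only [← h, χ_e, hp.eq_iff, mul_ite, mul_one, mul_zero, Finset.sum_ite_eq', Finset.mem_univ, if_true] at h1
  exact_mod_cast h1.symm

lemma D_perm (φ : A ≃ₐ[k] A) (i : Fin w.n) : w.D (w.perm φ i) = w.D i := by
  refine w.D_eq_of_trace (f := φ.toLinearMap) (fun a => ?_) (w.perm_injective φ) (fun i a => w.χ_perm φ i a) i
  rw [← LinearMap.trace_conj' (LinearMap.mulLeft k a) φ.toLinearEquiv]
  congr 1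
  ext x
  simp [LinearEquiv.conj_apply]

/-- The map `x ↦ e * x * f`. -/
noncomputable def P (e f : A) : Module.End k A := LinearMap.mulLeft k e * LinearMap.mulRight k f

lemma P_apply (e f x : A) : P (k := k) e f x = e * (x * f) := rfl

/-- The Cartan invariants. -/
noncomputable def c (i j : Fin w.n) : ℕ := Module.finrank k (LinearMap.range (P (k := k) (w.e i) (w.e j)))

lemma P_mul (e f e' f' : A) : P (k := k) e f * P e' f' = P (e * e') (f' * f) :=
  LinearMap.ext fun x => by simp [P_apply, mul_assoc]

lemma P_idem {e f : A} (he : e * e = e) (hf : f * f = f) : IsIdempotentElem (P (k := k) e f) := by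
  rw [IsIdempotentElem, P_mul, he, hf]

lemma trace_P_idem {e f : A} (he : e * e = e) (hf : f * f = f) :
    LinearMap.trace k A (P e f) = (Module.finrank k (LinearMap.range (P (k := k) e f)) : k) :=
  ((LinearMap.isProj_range_iff_isIdempotentElem _).2 (P_idem he hf)).trace

lemma P_pow (a b : A) (m : ℕ) : P (k := k) a b ^ m = P (a ^ m) (b ^ m) := by
  induction m with
  | zero => ext x; simp [P_apply]
  | succ m ih => rw [pow_succ, ih, P_mul, ← pow_succ, ← pow_succ']

lemma trace_P_left_J {a : A} (ha : a ∈ w.J) (b : A) : LinearMap.trace k A (P a b) = 0 := by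
  refine (LinearMap.isNilpotent_trace_of_isNilpotent ?_).eq_zero
  obtain ⟨m, hm⟩ := w.isNilpotent_of_mem ha
  exact ⟨m, by rw [P_pow, hm]; ext x; simp [P_apply]⟩

lemma trace_P_right_J (a : A) {b : A} (hb : b ∈ w.J) : LinearMap.trace k A (P a b) = 0 := by
  refine (LinearMap.isNilpotent_trace_of_isNilpotent ?_).eq_zero
  obtain ⟨m, hm⟩ := w.isNilpotent_of_mem hb
  exact ⟨m, by rw [P_pow, hm]; ext x; simp [P_apply]⟩

lemma trace_P_comm_left (a a' b : A) : LinearMap.trace k A (P (a * a') b) = LinearMap.trace k A (P (a' * a) b) := by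
  rw [show P (k := k) (a * a') b = P a 1 * P a' b by rw [P_mul, mul_one],
    show P (k := k) (a' * a) b = P a' b * P a 1 by rw [P_mul, one_mul], LinearMap.trace_mul_comm]

lemma trace_P_comm_right (a b b' : A) : LinearMap.trace k A (P a (b * b')) = LinearMap.trace k A (P a (b' * b)) := by
  rw [show P (k := k) a (b * b') = P a b' * P 1 b by rw [P_mul, mul_one],
    show P (k := k) a (b' * b) = P 1 b * P a b' by rw [P_mul, one_mul], LinearMap.trace_mul_comm]

/-- The bilinear form `(a, b) ↦ tr (x ↦ a * x * b)`. -/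
noncomputable def trP : A →ₗ[k] A →ₗ[k] k :=
  LinearMap.mk₂ k (fun a b => LinearMap.trace k A (P a b))
    (fun a a' b => by rw [← map_add]; congr 1; ext x; simp [P_apply, add_mul])
    (fun c a b => by rw [← map_smul]; congr 1; ext x; simp [P_apply])
    (fun a b b' => by rw [← map_add]; congr 1; ext x; simp [P_apply, mul_add])
    (fun c a b => by rw [← map_smul]; congr 1; ext x; simp [P_apply])

lemma trace_P (a b : A) : LinearMap.trace k A (P a b) =
    ∑ i, ∑ j, (w.c i j : k) * w.χ i a * w.χ j b := by
  have h1 := w.eq_sum_χ ((trP (k := k) (A := A)).flip b) (fun x y => trace_P_comm_left x y b)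
    (fun x hx => w.trace_P_left_J hx b)
  have h1 := LinearMap.congr_fun h1 a
  simp only [LinearMap.sum_apply, LinearMap.smul_apply, LinearMap.flip_apply] at h1
  refine h1.trans (Finset.sum_congr rfl fun i _ => ?_)
  have h2 := w.eq_sum_χ (trP (k := k) (w.e i)) (fun x y => trace_P_comm_right (w.e i) x y)
    (fun x hx => w.trace_P_right_J (w.e i) hx)
  have h2 := LinearMap.congr_fun h2 b
  rw [h2, LinearMap.sum_apply, smul_eq_mul, Finset.sum_mul]
  refine Finset.sum_congr rfl fun j _ => ?_
  have h3 : trP (k := k) (w.e i) (w.e j) = (w.c i j : k) := trace_P_idem (w.e_idem i) (w.e_idem j)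
  rw [LinearMap.smul_apply, h3, smul_eq_mul]
  ring

lemma D_eq_sum (i : Fin w.n) : w.D i = ∑ j, w.c i j * w.δ j := by
  have h : (w.D i : k) = LinearMap.trace k A (P (w.e i) 1) := by
    rw [D, mult_cast]
    congr 1
    ext x; simp [P_apply]
  rw [w.trace_P] at h
  simp only [χ_e, χ_one, mul_ite, mul_one, mul_zero, ite_mul, zero_mul] at h
  rw [Finset.sum_comm] at h
  simp at h
  exact_mod_cast h

lemma finrank_P {e f : A} (he : e * e = e) (hf : f * f = f) {i j : Fin w.n}
    (hi : ∀ l, w.χ l e = if l = i then 1 else 0) (hj : ∀ l, w.χ l f = if l = j then 1 else 0) :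
    Module.finrank k (LinearMap.range (P (k := k) e f)) = w.c i j := by
  have h := trace_P_idem (k := k) he hf
  rw [w.trace_P] at h
  simp only [hi, hj, mul_ite, mul_one, mul_zero] at h
  rw [Finset.sum_comm] at h
  simp at h
  exact_mod_cast h.symm

lemma one_le_finrank_P {e f y : A} (hy : y ≠ 0) (h : e * (y * f) = y) :
    1 ≤ Module.finrank k (LinearMap.range (P (k := k) e f)) := by
  rw [Nat.one_le_iff_ne_zero, Ne, Submodule.finrank_eq_zero]
  intro h0
  have : y ∈ LinearMap.range (P (k := k) e f) := ⟨y, h⟩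
  rw [h0] at this
  exact hy (by simpa using this)

lemma two_le_finrank_P {e f y x : A} (hy : y ≠ 0) (hyJ : y ∈ w.J) (hx : x ∉ w.J)
    (h : e * (y * f) = y) (h' : e * (x * f) = x) :
    2 ≤ Module.finrank k (LinearMap.range (P (k := k) e f)) := by
  have hli : LinearIndependent k ![y, x] := by
    rw [LinearIndependent.pair_iff' hy]
    rintro a rfl
    exact hx (w.J.smul_mem a hyJ)
  have hsp : Submodule.span k (Set.range ![y, x]) ≤ LinearMap.range (P (k := k) e f) := by
    rw [Submodule.span_le]
    rintro _ ⟨i, rfl⟩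
    fin_cases i
    · exact ⟨y, h⟩
    · exact ⟨x, h'⟩
  have := Submodule.finrank_mono hsp
  rwa [finrank_span_eq_card hli, Fintype.card_fin] at this

lemma c_self_pos (i : Fin w.n) : 1 ≤ w.c i i :=
  one_le_finrank_P (w.e_ne_zero i) (by rw [w.e_idem, w.e_idem])

lemma le_c {e f y : A} (he : e * e = e) (hf : f * f = f) {i j : Fin w.n}
    (hi : ∀ l, w.χ l e = if l = i then 1 else 0) (hj : ∀ l, w.χ l f = if l = j then 1 else 0)
    (hy : y ≠ 0) (hyJ : y ∈ w.J) (h : e * (y * f) = y) : 1 + (if i = j then 1 else 0) ≤ w.c i j := by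
  rw [← w.finrank_P he hf hi hj]
  split_ifs with hij
  · subst hij
    have hne : ∀ x : A, w.χ i x ≠ 0 → w.ρ i x ≠ 0 := fun x hx h0 => hx (by rw [χ_apply, h0, map_zero])
    have h1 : ¬ ∀ g, w.ρ i e * g * w.ρ i f = 0 := fun hc =>
      hne f (by rw [hj, if_pos rfl]; exact one_ne_zero)
        (end_prime (hne e (by rw [hi, if_pos rfl]; exact one_ne_zero)) hc)
    push Not at h1
    obtain ⟨g, hg⟩ := h1
    obtain ⟨a, rfl⟩ := w.surjective_ρ i g
    refine w.two_le_finrank_P hy hyJ (x := e * a * f) (fun hx => hg ?_) h ?_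
    · rw [← map_mul, ← map_mul, w.mem_J.1 hx]
    · rw [mul_assoc (e * a), hf, mul_assoc e a f, ← mul_assoc e e, he]
  · exact one_le_finrank_P hy h

lemma χ_e' (j l : Fin w.n) : w.χ l (w.e j) = if l = j then 1 else 0 := w.χ_e l j

lemma le_c_e {i j : Fin w.n} {y : A} (hy : y ≠ 0) (hyJ : y ∈ w.J) (h : w.e i * (y * w.e j) = y) :
    1 + (if i = j then 1 else 0) ≤ w.c i j :=
  w.le_c (w.e_idem i) (w.e_idem j) (w.χ_e' i) (w.χ_e' j) hy hyJ h

end Cartan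
end Wed

section

variable {k : Type} [Field k] [CharZero k] {A : Type} [Ring A] [HopfAlgebra k A] [FiniteDimensional k A]
  (w : Wed k A) (d : IntData k A)
local notation "𝒮" => HopfAlgebra.antipode k (A := A)

namespace IntData
include d in
lemma trace_mulRight (a : A) :
    LinearMap.trace k A (LinearMap.mulRight k a) = LinearMap.trace k A (LinearMap.mulLeft k a) := by
  let e := LinearEquiv.ofBijective _ (d.isInt.pairR_bijective d.ne_zero)
  rw [← LinearMap.trace_transpose' (LinearMap.mulRight k a), ← LinearMap.trace_conj' (LinearMap.mulLeft k a) e]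
  congr 1
  refine LinearMap.ext fun f => ?_
  obtain ⟨b, rfl⟩ := e.surjective f
  ext x
  simp only [LinearEquiv.conj_apply, LinearMap.comp_apply, LinearEquiv.coe_coe, LinearEquiv.symm_apply_apply]
  change d.lam (x * a * b) = d.lam (x * (a * b))
  rw [mul_assoc]

include d in
lemma trace_mulLeft_S (a : A) :
    LinearMap.trace k A (LinearMap.mulLeft k (𝒮 a)) = LinearMap.trace k A (LinearMap.mulLeft k a) := by
  let e := LinearEquiv.ofBijective _ d.S_bijective
  rw [← d.trace_mulRight (𝒮 a), ← LinearMap.trace_conj' (LinearMap.mulLeft k a) e]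
  congr 1
  refine LinearMap.ext fun f => ?_
  obtain ⟨b, rfl⟩ := e.surjective f
  simp only [LinearEquiv.conj_apply, LinearMap.comp_apply, LinearEquiv.coe_coe, LinearEquiv.symm_apply_apply]
  change 𝒮 b * 𝒮 a = 𝒮 (a * b)
  rw [S_mul]
end IntData

lemma dualRep_surjective {V : Type} [AddCommGroup V] [Module k V] [FiniteDimensional k V]
    {σ : A →ₐ[k] Module.End k V} (hS : Function.Surjective 𝒮) (hσ : Function.Surjective σ) :
    Function.Surjective (dualRep σ) := by
  have h2 : ∀ g : Module.End k (Module.Dual k V), ∃ f : Module.End k V, g = Module.Dual.transpose f := by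
    intro g
    refine ⟨(Module.evalEquiv k V).symm.toLinearMap ∘ₗ Module.Dual.transpose g ∘ₗ
      (Module.evalEquiv k V).toLinearMap, ?_⟩
    ext l v
    have h : ∀ x : Module.Dual k (Module.Dual k V), l ((Module.evalEquiv k V).symm x) = x l := fun x => by
      obtain ⟨y, rfl⟩ := (Module.evalEquiv k V).surjective x
      simp
    rw [Module.Dual.transpose_apply]
    simp only [LinearMap.comp_apply, LinearEquiv.coe_coe, h]
    simp [Module.Dual.transpose_apply]
  intro g
  obtain ⟨f, rfl⟩ := h2 g
  obtain ⟨b, rfl⟩ := hσ f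
  obtain ⟨a, rfl⟩ := hS b
  exact ⟨a, rfl⟩

namespace Wed

lemma cv_sum_left {ι : Type*} (s : Finset ι) (f : ι → A →ₗ[k] k) (g : A →ₗ[k] k) (a : A) :
    cv (∑ i ∈ s, f i) g a = ∑ i ∈ s, cv (f i) g a := by
  simp [cv_eq_dual_hitR]

/-- The fusion coefficients. -/
noncomputable def N (i j l : Fin w.n) : ℕ := w.mult (tens (w.ρ i) (w.ρ j)) l

lemma cv_χ (i j : Fin w.n) (a : A) : cv (w.χ i) (w.χ j) a = ∑ l, (w.N i j l : k) * w.χ l a := by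
  have h := w.trace_eq_sum (tens (w.ρ i) (w.ρ j)) a
  rw [← chr_apply, chr_tens] at h
  exact h

lemma sum_δ_N (i j : Fin w.n) : ∑ l, w.δ l * w.N i j l = w.δ i * w.δ j := by
  have h := w.sum_δ_mult (tens (w.ρ i) (w.ρ j))
  rw [Module.finrank_tensorProduct] at h
  simpa [N] using h

lemma N_eq_of {i j : Fin w.n} {c : Fin w.n → k} (h : ∀ a, cv (w.χ i) (w.χ j) a = ∑ l, c l * w.χ l a)
    (l : Fin w.n) : (w.N i j l : k) = c l := by
  have h1 := h (w.e l)
  rw [cv_χ] at h1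
  simpa [χ_e] using h1

lemma sum_D_N (j l : Fin w.n) : ∑ i, w.D i * w.N i j l = w.δ j * w.D l := by
  have h0 : chr (lreg k A) = ∑ i, (w.D i : k) • w.χ i := by
    ext a
    refine (w.trace_mulLeft a).trans ?_
    simp
  have h := LinearMap.congr_fun (chr_lreg_cv (A := A) (w.ρ j)) (w.e l)
  rw [h0, cv_sum_left] at h
  have h2 : ∀ i, cv ((w.D i : k) • w.χ i) (chr (w.ρ j)) (w.e l) = (w.D i : k) * w.N i j l := by
    intro i
    have h3 : cv (w.χ i) (chr (w.ρ j)) (w.e l) = w.N i j l := by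
      have := w.cv_χ i j (w.e l)
      simp only [χ_e, mul_ite, mul_one, mul_zero, Finset.sum_ite_eq', Finset.mem_univ, if_true] at this
      exact this
    rw [cv_eq_dual_hitR] at h3 ⊢
    rw [LinearMap.smul_apply, h3, smul_eq_mul]
  rw [Finset.sum_congr rfl fun i _ => h2 i] at h
  simp [χ_e] at h
  exact_mod_cast h

lemma exists_star (d : IntData k A) (i : Fin w.n) : ∃ j, (∀ a, w.χ j a = w.χ i (𝒮 a)) ∧ w.δ j = w.δ i := by
  have : Nontrivial (Module.Dual k (Fin (w.δ i) → k)) := by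
    apply Module.nontrivial_of_finrank_pos (R := k)
    rw [Subspace.dual_finrank_eq]
    simpa using w.δ_pos i
  obtain ⟨j, h1, h2, -⟩ := w.exists_class_chr (dualRep_surjective d.S_bijective.2 (w.surjective_ρ i))
  refine ⟨j, fun a => ?_, ?_⟩
  · rw [h1, dualRep_apply, LinearMap.trace_transpose', χ_apply]
  · rw [h2, Subspace.dual_finrank_eq]; simp

/-- The dual of a simple representation. -/
noncomputable def star (i : Fin w.n) : Fin w.n := (w.exists_star d i).choose

lemma χ_star (i : Fin w.n) (a : A) : w.χ (w.star d i) a = w.χ i (𝒮 a) := (w.exists_star d i).choose_spec.1 a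
lemma δ_star (i : Fin w.n) : w.δ (w.star d i) = w.δ i := (w.exists_star d i).choose_spec.2

lemma star_star (i : Fin w.n) : w.star d (w.star d i) = w.perm d.SS i :=
  w.χ_injective (LinearMap.ext fun a => by rw [χ_star, χ_star, χ_perm]; rfl)

lemma star_injective : Function.Injective (w.star d) := by
  intro i j h
  refine w.χ_injective (LinearMap.ext fun a => ?_)
  obtain ⟨b, rfl⟩ := d.S_bijective.2 a
  rw [← w.χ_star d, h, χ_star]

lemma D_star (i : Fin w.n) : w.D (w.star d i) = w.D i :=
  w.D_eq_of_trace (fun a => d.trace_mulLeft_S a) (w.star_injective d) (w.χ_star d) i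

lemma D_eq_sum' (d : IntData k A) (j : Fin w.n) : w.D j = ∑ i, w.c i j * w.δ i := by
  have h : (w.D j : k) = LinearMap.trace k A (P 1 (w.e j)) := by
    rw [D, mult_cast]
    refine (d.trace_mulRight (w.e j)).symm.trans ?_
    congr 1
    ext x; simp [P_apply]
  rw [w.trace_P] at h
  simp only [χ_e, χ_one, mul_ite, mul_one, mul_zero] at h
  simp at h
  exact_mod_cast h

lemma perm_symm_perm (φ : A ≃ₐ[k] A) (i : Fin w.n) : w.perm φ.symm (w.perm φ i) = i :=
  w.perm_eq _ fun a => by rw [χ_perm, AlgEquiv.apply_symm_apply]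

/-- The Nakayama permutation. -/
noncomputable def nak (i : Fin w.n) : Fin w.n := w.perm d.η i

lemma δ_nak (i : Fin w.n) : w.δ (w.nak d i) = w.δ i := w.δ_perm _ _

lemma χ_η_symm_e (i l : Fin w.n) : w.χ l (d.η.symm (w.e i)) = if l = w.nak d i then 1 else 0 := by
  rw [← χ_perm, χ_e]
  refine if_congr ⟨fun h => ?_, fun h => ?_⟩ rfl rfl
  · exact w.perm_injective d.η.symm (by rw [h, nak, perm_symm_perm])
  · rw [h, nak, perm_symm_perm]

lemma exists_nak {i : Fin w.n} {y : A} (hy : y ≠ 0) (hyJ : y ∈ w.J) (h : w.e i * y = y) :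
    ∃ z ≠ 0, z ∈ w.J ∧ w.e i * (z * d.η.symm (w.e i)) = z ∧ ∃ x, z = y * x := by
  have h1 : ¬ ∀ z, d.lam (y * z) = 0 := fun h => hy (d.isInt.nondeg' d.ne_zero h)
  push Not at h1
  obtain ⟨z, hz⟩ := h1
  refine ⟨y * z * d.η.symm (w.e i), fun h0 => hz ?_, ?_, ?_, z * d.η.symm (w.e i), by rw [mul_assoc]⟩
  · rw [← h, mul_assoc, ← d.η.apply_symm_apply (w.e i), d.lam_η, h0, map_zero]
  · exact w.mem_J_mul _ (w.mem_J_mul _ hyJ)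
  · rw [mul_assoc (y * z), ← map_mul, w.e_idem, ← mul_assoc, ← mul_assoc, h]

lemma η_symm_e_idem (i : Fin w.n) : d.η.symm (w.e i) * d.η.symm (w.e i) = d.η.symm (w.e i) := by
  rw [← map_mul, w.e_idem]

lemma le_c_nak {i : Fin w.n} {y : A} (hy : y ≠ 0) (hyJ : y ∈ w.J) (h : w.e i * y = y) :
    1 + (if i = w.nak d i then 1 else 0) ≤ w.c i (w.nak d i) := by
  obtain ⟨z, h0, h1, h2, -⟩ := w.exists_nak d hy hyJ h
  exact w.le_c (w.e_idem i) (w.η_symm_e_idem d i) (w.χ_e' i) (w.χ_η_symm_e d i) h0 h1 h2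

lemma exists_rank_one (i : Fin w.n) (a : A) : ∃ s : k, w.e i * (a * w.e i) - s • w.e i ∈ w.J := by
  refine ⟨w.ρ i a (Pi.single 0 1) 0, w.mem_J.2 fun l => ?_⟩
  rw [map_sub, map_smul, map_mul, map_mul]
  by_cases h : l = i
  · subst h
    rw [ρ_e]
    refine LinearMap.ext fun v => ?_
    simp only [E0, LinearMap.sub_apply, LinearMap.smul_apply, Module.End.mul_apply, LinearMap.smulRight_apply,
      LinearMap.proj_apply, LinearMap.zero_apply, map_smul, smul_smul]
    rw [sub_eq_zero]
    congr 1
    simp [mul_comm]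
  · simp [w.ρ_e_ne h]

lemma c_le_of_forall {i : Fin w.n} (h : ∀ y ∈ w.J, w.e i * y = 0) (j : Fin w.n) :
    w.c i j ≤ if i = j then 1 else 0 := by
  split_ifs with hij
  · subst hij
    have : LinearMap.range (P (k := k) (w.e i) (w.e i)) ≤ Submodule.span k {w.e i} := by
      rintro _ ⟨a, rfl⟩
      obtain ⟨s, hs⟩ := w.exists_rank_one i a
      have h1 := h _ hs
      rw [mul_sub, ← mul_assoc, w.e_idem, mul_smul_comm, w.e_idem, sub_eq_zero] at h1
      rw [P_apply, h1]
      exact Submodule.smul_mem _ _ (Submodule.mem_span_singleton_self _)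
    exact (Submodule.finrank_mono this).trans (finrank_span_singleton (w.e_ne_zero i)).le
  · rw [Nat.le_zero, c, Submodule.finrank_eq_zero, LinearMap.range_eq_bot]
    refine LinearMap.ext fun a => ?_
    have h1 : w.e i * (a * w.e j) ∈ w.J := w.mem_J.2 fun l => by
      rw [map_mul, map_mul]
      by_cases hl : l = i
      · subst hl; simp [w.ρ_e_ne hij]
      · simp [w.ρ_e_ne hl]
    have := h _ h1
    rwa [← mul_assoc, w.e_idem] at this

lemma D_eq_or_le (d : IntData k A) (i : Fin w.n) : w.D i = w.δ i ∨ 2 * w.δ i ≤ w.D i := by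
  by_cases h : ∀ y ∈ w.J, w.e i * y = 0
  · left
    apply le_antisymm
    · rw [w.D_eq_sum]
      refine (Finset.sum_le_sum fun j _ => Nat.mul_le_mul_right _ (w.c_le_of_forall h j)).trans ?_
      simp
    · rw [w.D_eq_sum]
      refine le_trans ?_ (Finset.single_le_sum (fun _ _ => Nat.zero_le _) (Finset.mem_univ i))
      exact Nat.le_mul_of_pos_left _ (w.c_self_pos i)
  · right
    push Not at h
    obtain ⟨y, hy, h⟩ := h
    have h1 := w.le_c_nak d (i := i) h (w.mul_mem_J _ hy) (by rw [← mul_assoc, w.e_idem])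
    rw [w.D_eq_sum]
    split_ifs at h1 with hi
    · rw [← hi] at h1
      refine le_trans ?_ (Finset.single_le_sum (fun _ _ => Nat.zero_le _) (Finset.mem_univ i))
      exact Nat.mul_le_mul_right _ h1
    · refine le_trans ?_ (Finset.add_le_sum (fun _ _ => Nat.zero_le _) (Finset.mem_univ i)
        (Finset.mem_univ (w.nak d i)) hi)
      rw [δ_nak, two_mul]
      exact Nat.add_le_add (Nat.le_mul_of_pos_left _ (w.c_self_pos i)) (Nat.le_mul_of_pos_left _ h1)

end Wed

end

namespace Wed
section Alg
variable {k : Type} [Field k] [CharZero k] {A : Type} [Ring A] [Algebra k A] (w : Wed k A)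

/-- The two-sided ideal generated by the idempotents `w.e j`. -/
noncomputable def I : Submodule k A := Submodule.span k {x | ∃ j b c, x = b * (w.e j * c)}

lemma mem_I (j : Fin w.n) (b c : A) : b * (w.e j * c) ∈ w.I := Submodule.subset_span ⟨j, b, c, rfl⟩

lemma mul_mem_I (a : A) {x : A} (hx : x ∈ w.I) : a * x ∈ w.I := by
  induction hx using Submodule.span_induction with
  | mem x h => obtain ⟨j, b, c, rfl⟩ := h; rw [← mul_assoc]; exact w.mem_I _ _ _
  | zero => simp
  | add x y _ _ hx hy => rw [mul_add]; exact add_mem hx hy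
  | smul r x _ hx => rw [mul_smul_comm]; exact w.I.smul_mem r hx

lemma exists_I_J : ∃ s ∈ w.I, 1 - s ∈ w.J := by
  choose X hX using fun (j : Fin w.n) (b : Fin (w.δ j)) =>
    w.surjective_ρ j ((LinearMap.proj 0 : w.V j →ₗ[k] k).smulRight (Pi.single b 1))
  choose Y hY using fun (j : Fin w.n) (b : Fin (w.δ j)) =>
    w.surjective_ρ j ((LinearMap.proj b : w.V j →ₗ[k] k).smulRight (Pi.single 0 1))
  refine ⟨∑ j, ∑ b, X j b * (w.e j * Y j b), Submodule.sum_mem _ fun j _ => Submodule.sum_mem _ fun b _ =>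
    w.mem_I _ _ _, w.mem_J.2 fun l => ?_⟩
  rw [map_sub, map_one, map_sum, Finset.sum_eq_single l, map_sum, sub_eq_zero]
  · refine LinearMap.ext fun v => ?_
    rw [LinearMap.sum_apply]
    have : ∀ b, w.ρ l (X l b * (w.e l * Y l b)) v = v b • Pi.single b 1 := fun b => by
      rw [map_mul, map_mul, hX, hY, ρ_e, E0]
      simp
    simp only [this]
    exact pi_eq_sum_univ' v
  · intro j _ hj
    rw [map_sum]
    exact Finset.sum_eq_zero fun b _ => by rw [map_mul, map_mul, w.ρ_e_ne hj.symm, zero_mul, mul_zero]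
  · simp

lemma one_mem_I : (1 : A) ∈ w.I := by
  obtain ⟨s, hs, hr⟩ := w.exists_I_J
  have h : ∀ m : ℕ, ∃ u ∈ w.I, 1 - u ∈ w.J ^ (m + 1) := by
    intro m
    induction m with
    | zero => exact ⟨s, hs, by simpa using hr⟩
    | succ m ih =>
      obtain ⟨u, hu, hv⟩ := ih
      refine ⟨u + (1 - u) * s, add_mem hu (w.mul_mem_I _ hs), ?_⟩
      rw [show 1 - (u + (1 - u) * s) = (1 - u) * (1 - s) by noncomm_ring, pow_succ]
      exact Submodule.mul_mem_mul hv hr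
  obtain ⟨m, hm⟩ := w.exists_J_pow
  obtain ⟨u, hu, hv⟩ := h m
  rw [pow_succ, hm, Submodule.bot_mul, Submodule.mem_bot, sub_eq_zero] at hv
  rwa [hv]

lemma map_one_mem {M : Type} [AddCommGroup M] [Module k M] (g : A →ₗ[k] M) (K : Submodule k M)
    (h : ∀ j b c, g (b * (w.e j * c)) ∈ K) : g 1 ∈ K := by
  have : w.I ≤ K.comap g := Submodule.span_le.2 (by rintro _ ⟨j, b, c, rfl⟩; exact h j b c)
  exact this w.one_mem_I

end Alg

variable {k : Type} [Field k] [CharZero k] {A : Type} [Ring A] [HopfAlgebra k A] [FiniteDimensional k A]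
  (w : Wed k A) (d : IntData k A)
local notation "𝒮" => HopfAlgebra.antipode k (A := A)

/-- All skew primitive elements of the dual are trivial. -/
def _root_.HopfFour.NoSkew (k A : Type) [Field k] [Ring A] [HopfAlgebra k A] [FiniteDimensional k A] : Prop :=
  ∀ (χ ψ : Ch k A) (f : A →ₗ[k] k), (∀ a b, f (a * b) = f a * ψ.fn b + χ.fn a * f b) →
    f ∈ Submodule.span k (Set.range (Ch.fn (k := k) (A := A)))

lemma e_idx_mul (χ : Ch k A) (a : A) : w.e (w.idx χ) * a - χ.fn a • w.e (w.idx χ) ∈ w.J :=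
  w.mem_J.2 fun l => by
    rw [map_sub, map_mul, map_smul]
    by_cases h : l = w.idx χ
    · subst h; rw [ρ_idx, ρ_idx]; simp
    · simp [w.ρ_e_ne h]

lemma mul_e_idx (χ : Ch k A) (a : A) : a * w.e (w.idx χ) - χ.fn a • w.e (w.idx χ) ∈ w.J :=
  w.mem_J.2 fun l => by
    rw [map_sub, map_mul, map_smul]
    by_cases h : l = w.idx χ
    · subst h; rw [ρ_idx, ρ_idx]; simp [smul_smul, mul_comm]
    · simp [w.ρ_e_ne h]

lemma fn_J (χ : Ch k A) {x : A} (hx : x ∈ w.J) : χ.fn x = 0 := by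
  rw [← w.χ_idx]; exact w.χ_J _ hx

lemma mem_J_sq (hE : NoSkew k A) (χ ψ : Ch k A) {y : A} (hy : y ∈ w.J)
    (h : w.e (w.idx χ) * (y * w.e (w.idx ψ)) = y) : y ∈ w.J ^ 2 := by
  by_contra hn
  obtain ⟨l, hl0, hl⟩ := Submodule.exists_le_ker_of_notMem hn
  refine hl0 ?_
  set e1 := w.e (w.idx χ)
  set e2 := w.e (w.idx ψ)
  have i1 : e1 * e1 = e1 := w.e_idem _
  have i2 : e2 * e2 = e2 := w.e_idem _
  let f : A →ₗ[k] k := l ∘ₗ LinearMap.mulRight k e2 ∘ₗ LinearMap.mulLeft k e1 - l (e1 * e2) • χ.fn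
  have hf : ∀ a, f a = l (e1 * a * e2) - l (e1 * e2) * χ.fn a := fun a => by simp [f]
  have key : ∀ a b, l (e1 * (a * b) * e2) = χ.fn a * l (e1 * b * e2) + ψ.fn b * l (e1 * a * e2)
      - χ.fn a * ψ.fn b * l (e1 * e2) := by
    intro a b
    have h1 : (e1 * a - χ.fn a • e1) * (b * e2 - ψ.fn b • e2) ∈ w.J ^ 2 := by
      rw [pow_two]
      exact Submodule.mul_mem_mul (w.e_idx_mul χ a) (w.mul_e_idx ψ b)
    have h2 := hl h1
    rw [LinearMap.mem_ker, show (e1 * a - χ.fn a • e1) * (b * e2 - ψ.fn b • e2) =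
      e1 * (a * b) * e2 - ψ.fn b • (e1 * a * e2) - χ.fn a • (e1 * b * e2) + (χ.fn a * ψ.fn b) • (e1 * e2) by
        simp only [sub_mul, mul_sub, smul_mul_assoc, mul_smul_comm, smul_sub, smul_smul, mul_assoc, mul_comm (ψ.fn b)]
        abel] at h2
    simp only [map_add, map_sub, map_smul, smul_eq_mul] at h2
    linear_combination h2
  have hspan := hE χ ψ f (fun a b => by
    rw [hf, hf, hf, key, χ.fn_mul]
    ring)
  have h0 : ∀ g ∈ Submodule.span k (Set.range (Ch.fn (k := k) (A := A))), g y = 0 := by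
    intro g hg
    induction hg using Submodule.span_induction with
    | mem x h => obtain ⟨c, rfl⟩ := h; exact w.fn_J c hy
    | zero => rfl
    | add x y _ _ hx hy => rw [LinearMap.add_apply, hx, hy, add_zero]
    | smul r x _ hx => rw [LinearMap.smul_apply, hx, smul_zero]
  have h1 := h0 f hspan
  rwa [hf, w.fn_J χ hy, mul_zero, sub_zero, mul_assoc, h] at h1

section Nil
variable {M : Type} [AddCommGroup M] [Module k M]

lemma apply_eq_zero_of_nonlinear (hE : NoSkew k A) (σ : A →ₐ[k] Module.End k M) {m : M} {ψ : Ch k A}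
    (hm : σ (w.e (w.idx ψ)) m = m) (h : ∀ j, w.δ j ≠ 1 → ∀ x ∈ w.J, σ (w.e j * x) m = 0) {x : A} (hx : x ∈ w.J) :
    σ x m = 0 := by
  let ev : A →ₗ[k] M := LinearMap.applyₗ m ∘ₗ σ.toLinearMap
  have hev : ∀ a, ev a = σ a m := fun _ => rfl
  have h1 : ∀ n : ℕ, ∀ x ∈ w.J, σ x m ∈ (w.J ^ (n + 1)).map ev := by
    intro n
    induction n with
    | zero => intro x hx; exact ⟨x, by simpa using hx, rfl⟩
    | succ n ih =>
      have h2 : ∀ y ∈ w.J ^ 2, σ y m ∈ (w.J ^ (n + 1 + 1)).map ev := by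
        intro y hy
        rw [pow_two] at hy
        induction hy using Submodule.mul_induction_on' with
        | mem_mul_mem a ha b hb =>
          obtain ⟨c, hc, hc'⟩ := ih b hb
          refine ⟨a * c, by rw [pow_succ']; exact Submodule.mul_mem_mul ha hc, ?_⟩
          rw [hev, map_mul σ, map_mul σ, Module.End.mul_apply, Module.End.mul_apply, ← hc', hev]
        | add a _ b _ ha hb => rw [map_add σ, LinearMap.add_apply]; exact add_mem ha hb
      intro x hx
      have := w.map_one_mem (ev ∘ₗ LinearMap.mulRight k x) ((w.J ^ (n + 1 + 1)).map ev) (fun j b c => by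
        rw [LinearMap.comp_apply, LinearMap.mulRight_apply, hev]
        by_cases hj : w.δ j = 1
        · obtain ⟨χ, rfl⟩ := w.exists_eq_idx hj
          have h3 : b * (w.e (w.idx χ) * (c * x * w.e (w.idx ψ))) ∈ w.J ^ 2 := by
            refine w.mul_mem_J_pow _ two_ne_zero (w.mem_J_sq hE χ ψ (w.mul_mem_J _ (w.mem_J_mul _ (w.mul_mem_J _ hx))) ?_)
            simp only [← mul_assoc]
            rw [w.e_idem]
            simp only [mul_assoc]
            rw [w.e_idem]
          have h4 := h2 _ h3
          rw [show b * (w.e (w.idx χ) * (c * x * w.e (w.idx ψ))) =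
            b * (w.e (w.idx χ) * c) * x * w.e (w.idx ψ) by simp only [mul_assoc], map_mul σ,
            Module.End.mul_apply, hm] at h4
          exact h4
        · have h3 := h j hj _ (w.mul_mem_J c hx)
          rw [show b * (w.e j * c) * x = b * (w.e j * (c * x)) by simp only [mul_assoc], map_mul σ,
            Module.End.mul_apply, h3, map_zero]
          exact zero_mem _)
      simpa [hev] using this
  obtain ⟨n, hn⟩ := w.exists_J_pow
  obtain ⟨y, hy, hy'⟩ := h1 n x hx
  rw [pow_succ, hn, Submodule.bot_mul] at hy
  rw [← hy', (Submodule.mem_bot k).1 hy, map_zero]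

lemma comp_eq_zero_of_nonlinear (hE : NoSkew k A) (σ : A →ₐ[k] Module.End k M) {m : M →ₗ[k] k} {ψ : Ch k A}
    (hm : m ∘ₗ σ (w.e (w.idx ψ)) = m) (h : ∀ j, w.δ j ≠ 1 → ∀ x ∈ w.J, m ∘ₗ σ (x * w.e j) = 0) {x : A}
    (hx : x ∈ w.J) : m ∘ₗ σ x = 0 := by
  let ev : A →ₗ[k] (M →ₗ[k] k) := LinearMap.compRight k m ∘ₗ σ.toLinearMap
  have hev : ∀ a, ev a = m ∘ₗ σ a := fun _ => rfl
  have hmul : ∀ a b, m ∘ₗ σ (a * b) = (m ∘ₗ σ a) ∘ₗ σ b := fun a b => by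
    rw [map_mul σ]; rfl
  have h1 : ∀ n : ℕ, ∀ x ∈ w.J, m ∘ₗ σ x ∈ (w.J ^ (n + 1)).map ev := by
    intro n
    induction n with
    | zero => intro x hx; exact ⟨x, by simpa using hx, rfl⟩
    | succ n ih =>
      have h2 : ∀ y ∈ w.J ^ 2, m ∘ₗ σ y ∈ (w.J ^ (n + 1 + 1)).map ev := by
        intro y hy
        rw [pow_two] at hy
        induction hy using Submodule.mul_induction_on' with
        | mem_mul_mem a ha b hb =>
          obtain ⟨c, hc, hc'⟩ := ih a ha
          refine ⟨c * b, by rw [pow_succ]; exact Submodule.mul_mem_mul hc hb, ?_⟩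
          rw [hev, hmul, hmul, ← hc', hev]
        | add a _ b _ ha hb => rw [map_add σ, LinearMap.comp_add]; exact add_mem ha hb
      intro x hx
      have := w.map_one_mem (ev ∘ₗ LinearMap.mulLeft k x) ((w.J ^ (n + 1 + 1)).map ev) (fun j b c => by
        rw [LinearMap.comp_apply, LinearMap.mulLeft_apply, hev]
        by_cases hj : w.δ j = 1
        · obtain ⟨χ, rfl⟩ := w.exists_eq_idx hj
          have h3 : w.e (w.idx ψ) * (x * b * w.e (w.idx χ)) * c ∈ w.J ^ 2 := by
            refine w.mem_J_pow_mul _ two_ne_zero (w.mem_J_sq hE ψ χ (w.mul_mem_J _ (w.mem_J_mul _ (w.mem_J_mul _ hx))) ?_)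
            simp only [← mul_assoc]
            rw [w.e_idem]
            simp only [mul_assoc]
            rw [w.e_idem]
          have h4 := h2 _ h3
          rw [show w.e (w.idx ψ) * (x * b * w.e (w.idx χ)) * c =
            w.e (w.idx ψ) * (x * (b * (w.e (w.idx χ) * c))) by simp only [mul_assoc], hmul, hm] at h4
          exact h4
        · have h3 := h j hj _ (w.mem_J_mul b hx)
          rw [show x * (b * (w.e j * c)) = x * b * w.e j * c by simp only [mul_assoc], hmul,
            h3, LinearMap.zero_comp]
          exact zero_mem _)
      simpa [hev] using this
  obtain ⟨n, hn⟩ := w.exists_J_pow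
  obtain ⟨y, hy, hy'⟩ := h1 n x hx
  rw [pow_succ, hn, Submodule.bot_mul] at hy
  rw [← hy', (Submodule.mem_bot k).1 hy, map_zero]

end Nil

lemma exists_linked (hE : NoSkew k A) (d : IntData k A) (ht : counit (R := k) d.t = 0) :
    ∃ X, w.δ X ≠ 1 ∧ ∃ y ≠ 0, y ∈ w.J ∧ w.e X * (y * w.e (w.idx (Ch.ofAlg d.α))) = y := by
  by_contra! hn
  set eα := w.e (w.idx (Ch.ofAlg d.α))
  have h0 := w.apply_eq_zero_of_nonlinear hE (lreg k A) (m := eα) (ψ := Ch.ofAlg d.α) (w.e_idem _)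
    (fun j hj x hx => by
      by_contra h
      refine hn j hj _ h (w.mem_J_mul _ (w.mul_mem_J _ hx)) ?_
      change w.e j * (w.e j * x * eα * eα) = w.e j * x * eα
      rw [mul_assoc _ eα, w.e_idem, mul_assoc, ← mul_assoc, w.e_idem]) (d.t_mem_J w ht)
  refine d.t_ne_zero ?_
  change d.t * eα = 0 at h0
  rw [d.t_mul'] at h0
  have : d.α eα = 1 := by
    have := w.χ_e (w.idx (Ch.ofAlg d.α)) (w.idx (Ch.ofAlg d.α))
    rw [χ_idx, if_pos rfl] at this
    simpa using this
  simpa [this] using h0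

end Wed

section

variable {k : Type} [Field k] [CharZero k] {A : Type} [Ring A] [HopfAlgebra k A] [FiniteDimensional k A]
  (w : Wed k A) (d : IntData k A)
local notation "𝒮" => HopfAlgebra.antipode k (A := A)

noncomputable instance : Fintype (Ch k A) := Fintype.ofFinite _

namespace Wed

lemma c_perm (φ : A ≃ₐ[k] A) (i j : Fin w.n) : w.c (w.perm φ i) (w.perm φ j) = w.c i j := by
  have h : ∀ a b, LinearMap.trace k A (P (φ a) (φ b)) = LinearMap.trace k A (P a b) := by
    intro a b
    rw [← LinearMap.trace_conj' (P a b) φ.toLinearEquiv]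
    congr 1
    refine LinearMap.ext fun x => ?_
    simp only [LinearEquiv.conj_apply, LinearMap.comp_apply, LinearEquiv.coe_coe, P_apply]
    simp
  have h1 := h (w.e (w.perm φ i)) (w.e (w.perm φ j))
  rw [w.trace_P, w.trace_P] at h1
  simp only [← χ_perm, χ_e, (w.perm_injective φ).eq_iff, mul_ite, mul_one, mul_zero, Finset.sum_ite_eq',
    Finset.mem_univ, if_true] at h1
  exact_mod_cast h1.symm

/-- Tensoring simple representations with characters. -/
noncomputable def act (χ : Ch k A) (i : Fin w.n) : Fin w.n := w.perm χ.aut i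

lemma χ_act (χ : Ch k A) (i : Fin w.n) (a : A) : w.χ (w.act χ i) a = cv χ.fn (w.χ i) a := by
  rw [act, χ_perm, Ch.fn_aut]

lemma act_mul (χ ψ : Ch k A) (i : Fin w.n) : w.act (χ * ψ) i = w.act χ (w.act ψ i) :=
  w.perm_eq _ fun a => by rw [Ch.aut_mul, act, χ_perm, act, χ_perm]

lemma act_one (i : Fin w.n) : w.act 1 i = i := w.perm_eq _ fun a => by rw [Ch.aut_one]

lemma act_idx (χ ψ : Ch k A) : w.act χ (w.idx ψ) = w.idx (χ * ψ) :=
  (w.idx_eq (LinearMap.ext fun a => by rw [χ_act, χ_idx]; rfl)).symm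

lemma δ_act (χ : Ch k A) (i : Fin w.n) : w.δ (w.act χ i) = w.δ i := w.δ_perm _ _
lemma D_act (χ : Ch k A) (i : Fin w.n) : w.D (w.act χ i) = w.D i := w.D_perm _ _

lemma D_idx (χ : Ch k A) : w.D (w.idx χ) = w.D w.i0 := by
  have := w.D_act χ w.i0
  rwa [i0, act_idx, mul_one] at this

/-- The action of the group of characters on the simple representations. -/
noncomputable abbrev action : MulAction (Ch k A) (Fin w.n) where
  smul := w.act
  one_smul := w.act_one
  mul_smul := w.act_mul

/-- The stabilizer of a simple representation. -/
noncomputable def st (i : Fin w.n) : Finset (Ch k A) := Finset.univ.filter fun χ => w.act χ i = i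

lemma mem_st {χ : Ch k A} {i : Fin w.n} : χ ∈ w.st i ↔ w.act χ i = i := by simp [st]

lemma one_mem_st (i : Fin w.n) : 1 ∈ w.st i := w.mem_st.2 (w.act_one i)

lemma one_le_card_st (i : Fin w.n) : 1 ≤ (w.st i).card := Finset.card_pos.2 ⟨1, w.one_mem_st i⟩

/-- The orbit of a simple representation. -/
noncomputable def orb (i : Fin w.n) : Finset (Fin w.n) := Finset.univ.image fun χ => w.act χ i

lemma mem_orb {i j : Fin w.n} : j ∈ w.orb i ↔ ∃ χ, w.act χ i = j := by simp [orb]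

lemma card_st_mul_card_orb (i : Fin w.n) : (w.orb i).card * (w.st i).card = Fintype.card (Ch k A) := by
  classical
  let := w.action
  have h := MulAction.card_orbit_mul_card_stabilizer_eq_card_group (Ch k A) i
  rw [← h]
  congr 1
  · rw [← Set.toFinset_card]
    congr 1
    ext j
    rw [mem_orb, Set.mem_toFinset, MulAction.mem_orbit_iff]
    rfl
  · exact (Fintype.card_subtype fun χ => w.act χ i = i).symm

/-- The common dimension of the projective covers of the characters. -/
noncomputable def d0 : ℕ := w.D w.i0

lemma linked_le {X : Fin w.n} (hX : w.δ X ≠ 1) {ψ : Ch k A} {y : A} (hy : y ≠ 0) (hyJ : y ∈ w.J)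
    (h : w.e X * (y * w.e (w.idx ψ)) = y) (d : IntData k A) : 2 * w.δ X + (w.st X).card ≤ w.D X := by
  have hc : ∀ χ ∈ w.st X, 1 ≤ w.c X (w.idx (χ * ψ)) := by
    intro χ hχ
    rw [mem_st] at hχ
    have h1 := w.c_perm χ.aut X (w.idx ψ)
    change w.c (w.act χ X) (w.act χ (w.idx ψ)) = _ at h1
    rw [hχ, act_idx] at h1
    rw [h1]
    exact le_trans (Nat.le_add_right _ _) (w.le_c_e hy hyJ h)
  rw [w.D_eq_sum, ← Finset.sum_filter_add_sum_filter_not _ (fun j => w.δ j = 1), add_comm]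
  refine Nat.add_le_add ?_ ?_
  · have h1 := w.le_c_nak d (i := X) hy hyJ (by rw [← h, ← mul_assoc, w.e_idem])
    rw [Finset.card_eq_sum_ones]
    have hinj : Set.InjOn (fun χ => w.idx (χ * ψ)) (w.st X : Set (Ch k A)) := fun a _ b _ hab =>
      mul_right_cancel (w.idx_injective hab)
    rw [← Finset.sum_image (f := fun _ => 1) hinj]
    refine (Finset.sum_le_sum (g := fun j => w.c X j * w.δ j) fun j hj => ?_).trans
      (Finset.sum_le_sum_of_subset fun j hj => ?_)
    · obtain ⟨χ, hχ, rfl⟩ := Finset.mem_image.1 hj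
      rw [δ_idx, mul_one]; exact hc χ hχ
    · obtain ⟨χ, hχ, rfl⟩ := Finset.mem_image.1 hj
      simp [δ_idx]
  · have h1 := w.le_c_nak d (i := X) hy hyJ (by rw [← h, ← mul_assoc, w.e_idem])
    have m1 : X ∈ Finset.univ.filter fun j => ¬ w.δ j = 1 := by simp [hX]
    have m2 : w.nak d X ∈ Finset.univ.filter fun j => ¬ w.δ j = 1 := by simp [hX, δ_nak]
    split_ifs at h1 with hi
    · rw [← hi] at h1
      refine le_trans ?_ (Finset.single_le_sum (fun _ _ => Nat.zero_le _) m1)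
      exact Nat.mul_le_mul_right _ h1
    · refine le_trans ?_ (Finset.add_le_sum (fun _ _ => Nat.zero_le _) m1 m2 hi)
      rw [δ_nak, two_mul]
      exact Nat.add_le_add (Nat.le_mul_of_pos_left _ (w.c_self_pos X)) (Nat.le_mul_of_pos_left _ h1)

lemma exists_linked' (hE : NoSkew k A) (d : IntData k A) (ht : counit (R := k) d.t = 0) :
    ∃ X, 2 ≤ w.δ X ∧ 2 * w.δ X + (w.st X).card ≤ w.D X ∧ w.δ X + 2 ≤ w.d0 := by
  obtain ⟨X, hX, y, hy, hyJ, h⟩ := w.exists_linked hE d ht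
  set α := Ch.ofAlg d.α with hα
  have hα1 : d.t * w.e (w.idx α) = d.t := by
    rw [d.t_mul']
    have : d.α (w.e (w.idx α)) = 1 := by
      have := w.χ_e (w.idx α) (w.idx α)
      rw [χ_idx, if_pos rfl, hα] at this
      simpa using this
    rw [this, one_smul]
  have h01 : w.e w.i0 * d.t = d.t := by
    rw [d.mul_t]
    have := w.χ_e w.i0 w.i0
    rw [i0, χ_idx, if_pos rfl, Ch.fn_one'] at this
    rw [i0, this, one_smul]
  have hX2 : 2 ≤ w.δ X := by have := w.δ_pos X; omega
  refine ⟨X, hX2, w.linked_le hX hy hyJ h d, ?_⟩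
  rw [d0, ← w.D_idx α, w.D_eq_sum' d, ← Finset.sum_filter_add_sum_filter_not _ (fun j => w.δ j = 1),
    add_comm (w.δ X)]
  refine Nat.add_le_add ?_ ?_
  · have h1 := w.le_c_e (i := w.i0) (j := w.idx α) d.t_ne_zero (d.t_mem_J w ht) (by rw [hα1, h01])
    have m1 : w.idx α ∈ Finset.univ.filter fun j => w.δ j = 1 := by simp [δ_idx]
    have m2 : w.i0 ∈ Finset.univ.filter fun j => w.δ j = 1 := by simp [i0, δ_idx]
    split_ifs at h1 with hi
    · refine le_trans ?_ (Finset.single_le_sum (fun _ _ => Nat.zero_le _) m1)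
      rw [hi] at h1
      rw [δ_idx, mul_one]; exact h1
    · refine le_trans ?_ (Finset.add_le_sum (fun _ _ => Nat.zero_le _) m1 m2 (Ne.symm hi))
      have := w.c_self_pos (w.idx α)
      rw [i0] at h1 ⊢
      rw [δ_idx, δ_idx]; omega
  · refine le_trans ?_ (Finset.single_le_sum (a := X) (fun _ _ => Nat.zero_le _) (by simp [hX]))
    exact Nat.le_mul_of_pos_left _ (le_trans (Nat.le_add_right _ _) (w.le_c_e hy hyJ h))

lemma sum_δ_D_eq : Fintype.card (Ch k A) * w.d0 + ∑ i with w.δ i ≠ 1, w.δ i * w.D i = Module.finrank k A := by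
  rw [← w.sum_δ_D, ← Finset.sum_filter_add_sum_filter_not Finset.univ (fun j => w.δ j = 1)]
  congr 1
  have : (Finset.univ.filter fun j => w.δ j = 1) = Finset.univ.image w.idx := by
    ext j
    simp only [Finset.mem_filter, Finset.mem_univ, true_and, Finset.mem_image]
    exact ⟨fun h => w.exists_eq_idx h, by rintro ⟨χ, rfl⟩; exact w.δ_idx χ⟩
  rw [this, Finset.sum_image w.idx_injective.injOn]
  simp [δ_idx, D_idx, d0]

lemma N_idx (χ : Ch k A) (j l : Fin w.n) : w.N (w.idx χ) j l = if l = w.act χ j then 1 else 0 := by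
  have h := w.N_eq_of (i := w.idx χ) (j := j) (c := fun l => if l = w.act χ j then 1 else 0) (fun a => by
    rw [χ_idx, ← χ_act]; simp) l
  split_ifs at h ⊢ <;> exact_mod_cast h

lemma card_st_mul_le (i : Fin w.n) : (w.st i).card * w.d0 ≤ w.δ i * w.D i := by
  rw [← w.sum_D_N i i]
  have h : ∑ j ∈ (w.st i).image w.idx, w.D j * w.N j i i = (w.st i).card * w.d0 := by
    rw [Finset.sum_image w.idx_injective.injOn, Finset.sum_congr rfl (g := fun _ => w.d0)]
    · simp
    · intro χ hχ
      rw [mem_st] at hχ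
      rw [D_idx, N_idx, hχ, if_pos rfl, mul_one, d0]
  rw [← h]
  exact Finset.sum_le_sum_of_subset (Finset.subset_univ _)

end Wed

end

section

variable {k : Type} [Field k] [CharZero k] {A : Type} [Ring A] [HopfAlgebra k A] [FiniteDimensional k A]
  (w : Wed k A) (d : IntData k A)
local notation "𝒮" => HopfAlgebra.antipode k (A := A)

/-- The idempotent averaging the powers of an element of finite order. -/
lemma exists_average {B : Type} [Ring B] [Algebra k B] {u : B} {q : ℕ} (hq : 0 < q) (hu : u ^ q = 1) :
    IsIdempotentElem ((q : k)⁻¹ • ∑ i ∈ Finset.range q, u ^ i) := by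
  have hq0 : (q : k) ≠ 0 := by exact_mod_cast hq.ne'
  set s := ∑ i ∈ Finset.range q, u ^ i with hs
  have h1 : u * s = s := by
    have := Finset.sum_range_succ (fun i => u ^ i) q
    rw [Finset.sum_range_succ', pow_zero, hu] at this
    rw [hs, Finset.mul_sum]
    simpa [pow_succ'] using this
  have h2 : ∀ i, u ^ i * s = s := by
    intro i
    induction i with
    | zero => simp
    | succ i ih => rw [pow_succ, mul_assoc, h1, ih]
  have h3 : s * s = (q : k) • s := by
    conv_lhs => rw [hs, Finset.sum_mul]
    rw [Finset.sum_congr rfl fun i _ => h2 i]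
    simp [Nat.cast_smul_eq_nsmul]
  rw [IsIdempotentElem, smul_mul_smul_comm, h3, smul_smul]
  congr 1
  field_simp

namespace Wed

lemma D_le_of_orderOf [IsAlgClosed k] {h : GroupLike k A} {q m : ℕ} (hq : 0 < q) (ho : orderOf h = q)
    (hf : Module.finrank k A = m * q) (X : Fin w.n) : w.D X ≤ m := by
  have hq0 : (q : k) ≠ 0 := by exact_mod_cast hq.ne'
  have hv : h.val ^ q = 1 := by rw [← GroupLike.val_pow, ← ho, pow_orderOf_eq_one, GroupLike.val_one]
  obtain ⟨μ, hμ⟩ := Module.End.exists_eigenvalue (w.ρ X h.val)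
  obtain ⟨x, hx⟩ := hμ.exists_hasEigenvector
  have hxp : ∀ i, (w.ρ X h.val ^ i) x = μ ^ i • x := fun i => hx.pow_apply i
  have hμq : μ ^ q = 1 := by
    have := hxp q
    rw [← map_pow, hv, map_one, Module.End.one_apply] at this
    have h2 : (1 - μ ^ q) • x = 0 := by rw [sub_smul, one_smul, ← this, sub_self]
    exact (sub_eq_zero.1 ((smul_eq_zero.1 h2).resolve_right hx.2)).symm
  have hμ0 : μ ≠ 0 := by rintro rfl; rw [zero_pow hq.ne'] at hμq; exact zero_ne_one hμq
  set u : A := μ⁻¹ • h.val with hu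
  have huq : u ^ q = 1 := by rw [hu, smul_pow, hv, inv_pow, hμq, inv_one, one_smul]
  have he := exists_average (k := k) hq huq
  set e := (q : k)⁻¹ • ∑ i ∈ Finset.range q, u ^ i with hedef
  have hρ : ∀ i, w.χ i e = (Module.finrank k (LinearMap.range (w.ρ i e)) : k) := fun i =>
    finrank_range_of_isIdempotentElem (he.map (w.ρ i))
  have hX : 1 ≤ Module.finrank k (LinearMap.range (w.ρ X e)) := by
    rw [Nat.one_le_iff_ne_zero, Ne, Submodule.finrank_eq_zero, LinearMap.range_eq_bot]
    intro h0
    have h1 : w.ρ X e x = x := by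
      rw [hedef, map_smul, map_sum, LinearMap.smul_apply, LinearMap.sum_apply,
        Finset.sum_congr rfl (g := fun _ => x)]
      · rw [Finset.sum_const, Finset.card_range, ← Nat.cast_smul_eq_nsmul k, smul_smul,
          inv_mul_cancel₀ hq0, one_smul]
      · intro i _
        rw [map_pow, hu, map_smul, smul_pow, LinearMap.smul_apply, hxp, smul_smul, ← mul_pow,
          inv_mul_cancel₀ hμ0, one_pow, one_smul]
    rw [h0, LinearMap.zero_apply] at h1
    exact hx.2 h1.symm
  have htr : LinearMap.trace k A (LinearMap.mulLeft k e) = (m : k) := by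
    have h1 : ∀ i ∈ Finset.range q, i ≠ 0 → LinearMap.trace k A (LinearMap.mulLeft k (u ^ i)) = 0 := by
      intro i hi hi0
      have hne : h ^ i ≠ 1 := by
        intro h1
        have := orderOf_dvd_of_pow_eq_one h1
        rw [ho] at this
        exact absurd (Nat.le_of_dvd (Nat.pos_of_ne_zero hi0) this) (by simpa using hi)
      have h2 := chr_lreg_groupLike hne
      rw [GroupLike.val_pow] at h2
      have h3 : LinearMap.mulLeft k (u ^ i) = (μ⁻¹) ^ i • LinearMap.mulLeft k (h.val ^ i) := by
        rw [hu, smul_pow]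
        exact LinearMap.ext fun y => by simp
      rw [h3, map_smul]
      have h4 : LinearMap.trace k A (LinearMap.mulLeft k (h.val ^ i)) = 0 := h2
      rw [h4, smul_zero]
    have h2 : LinearMap.mulLeft k e = (q : k)⁻¹ • ∑ i ∈ Finset.range q, LinearMap.mulLeft k (u ^ i) := by
      refine LinearMap.ext fun y => ?_
      simp [hedef, Finset.sum_mul]
    rw [h2, map_smul, map_sum, Finset.sum_eq_single_of_mem 0 (Finset.mem_range.2 hq) h1, pow_zero,
      LinearMap.mulLeft_one, LinearMap.trace_id, hf, Nat.cast_mul, smul_eq_mul]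
    field_simp
  rw [w.trace_mulLeft] at htr
  simp only [hρ] at htr
  have htr' : ∑ i, w.D i * Module.finrank k (LinearMap.range (w.ρ i e)) = m := by exact_mod_cast htr
  rw [← htr']
  refine le_trans ?_ (Finset.single_le_sum (a := X) (fun _ _ => Nat.zero_le _) (Finset.mem_univ _))
  exact Nat.le_mul_of_pos_right _ hX

end Wed

lemma card_eq_of_dvd {p n : ℕ} (hp : p.Prime) (h : n ∣ 4 * p) (hn : ¬ p ∣ n) : n ∣ 4 :=
  (Nat.Coprime.dvd_mul_right ((hp.coprime_iff_not_dvd.2 hn).symm)).1 h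

end

section

variable {k : Type} [Field k] [CharZero k] {A : Type} [Ring A] [HopfAlgebra k A] [FiniteDimensional k A]
  (w : Wed k A) (d : IntData k A)
local notation "𝒮" => HopfAlgebra.antipode k (A := A)

lemma IntData.SS_pow (r : ℕ) (a : A) : (d.SS ^ r) a = ((𝒮 : Module.End k A) ^ (2 * r)) a := by
  induction r generalizing a with
  | zero => rfl
  | succ r ih =>
    rw [pow_succ, AlgEquiv.mul_apply, ih, mul_add, pow_add, Module.End.mul_apply]
    rfl

namespace Wed
variable [IsAlgClosed k] {p : ℕ} (hp : p.Prime) (hf : Module.finrank k A = 4 * p) {X : Fin w.n}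
include w hp hf

lemma card_groupLike_dvd_four (hX : 4 < w.D X) : Nat.card (GroupLike k A) ∣ 4 := by
  refine card_eq_of_dvd hp (hf ▸ card_groupLike_dvd) fun h => ?_
  have := Fact.mk hp
  obtain ⟨g, hg⟩ := exists_prime_orderOf_dvd_card' p h
  exact absurd (w.D_le_of_orderOf hp.pos hg hf X) (not_le.2 hX)

lemma card_Ch_lt (hX : w.δ X ≠ 1) (hd : 4 ≤ w.d0) : Fintype.card (Ch k A) < p := by
  have h := w.sum_δ_D_eq
  rw [hf] at h
  have h1 : 0 < ∑ i with w.δ i ≠ 1, w.δ i * w.D i :=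
    Finset.sum_pos (fun i _ => Nat.mul_pos (w.δ_pos i) (w.D_pos i)) ⟨X, by simp [hX]⟩
  nlinarith

lemma card_Ch_dvd_four (hX : w.δ X ≠ 1) (hd : 4 ≤ w.d0) : Fintype.card (Ch k A) ∣ 4 := by
  refine card_eq_of_dvd hp ?_ fun h =>
    absurd (Nat.le_of_dvd Fintype.card_pos h) (not_le.2 (w.card_Ch_lt hp hf hX hd))
  rw [← Nat.card_eq_fintype_card, ← hf, ← DualH.finrank_eq (k := k) (A := A)]
  exact card_groupLike_dvd

lemma SS_pow_eight (hX : w.δ X ≠ 1) (hX' : 4 < w.D X) (hd : 4 ≤ w.d0) (a : A) : (d.SS ^ 8) a = a := by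
  rw [d.SS_pow, d.S_pow_of_pow (N := 4), Module.End.one_apply]
  · exact orderOf_dvd_iff_pow_eq_one.1 ((orderOf_dvd_natCard _).trans (w.card_groupLike_dvd_four hp hf hX'))
  · refine orderOf_dvd_iff_pow_eq_one.1 ((orderOf_dvd_card).trans (w.card_Ch_dvd_four hp hf hX hd))

end Wed

end

section

variable {k : Type} [Field k] [CharZero k] {A : Type} [Ring A] [HopfAlgebra k A] [FiniteDimensional k A]
  (w : Wed k A) (d : IntData k A)
local notation "𝒮" => HopfAlgebra.antipode k (A := A)

/-- An endomorphism of finite order commutes with a rank one idempotent. -/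
lemma exists_rank_one_commuting [IsAlgClosed k] {V : Type} [AddCommGroup V] [Module k V]
    [FiniteDimensional k V] [Nontrivial V] {T : Module.End k V} {m : ℕ} (hm : 0 < m) (hT : T ^ m = 1) :
    ∃ f : Module.End k V, IsIdempotentElem f ∧ LinearMap.trace k V f = 1 ∧ T * f = f * T := by
  have hm0 : (m : k) ≠ 0 := by exact_mod_cast hm.ne'
  obtain ⟨μ, hμ⟩ := Module.End.exists_eigenvalue T
  obtain ⟨x, hx⟩ := hμ.exists_hasEigenvector
  have hμm : μ ^ m = 1 := by
    have := hx.pow_apply m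
    rw [hT, Module.End.one_apply] at this
    have h2 : (1 - μ ^ m) • x = 0 := by rw [sub_smul, one_smul, ← this, sub_self]
    exact (sub_eq_zero.1 ((smul_eq_zero.1 h2).resolve_right hx.2)).symm
  have hμ0 : μ ≠ 0 := by rintro rfl; rw [zero_pow hm.ne'] at hμm; exact zero_ne_one hμm
  set s := ∑ i ∈ Finset.range m, (μ⁻¹ • T) ^ i with hs
  have hu : (μ⁻¹ • T) ^ m = 1 := by rw [smul_pow, hT, inv_pow, hμm, inv_one, one_smul]
  have h1 : s * (μ⁻¹ • T) = s := by
    have := Finset.sum_range_succ (fun i => (μ⁻¹ • T) ^ i) m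
    rw [Finset.sum_range_succ', pow_zero, hu] at this
    rw [hs, Finset.sum_mul]
    simpa [pow_succ] using this
  have h2 : s x = (m : k) • x := by
    rw [hs, LinearMap.sum_apply, Finset.sum_congr rfl (g := fun _ => x)]
    · simp [Nat.cast_smul_eq_nsmul]
    · intro i _
      rw [smul_pow, LinearMap.smul_apply, hx.pow_apply, smul_smul, ← mul_pow, inv_mul_cancel₀ hμ0,
        one_pow, one_smul]
  obtain ⟨φ, hφ⟩ := Module.Projective.exists_dual_ne_zero k hx.2
  set ℓ : V →ₗ[k] k := ((m : k)⁻¹ * (φ x)⁻¹) • (φ ∘ₗ s) with hℓ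
  have hℓx : ℓ x = 1 := by
    simp only [hℓ, LinearMap.smul_apply, LinearMap.comp_apply, h2, map_smul, smul_eq_mul]
    field_simp
  have hsT : s * T = μ • s := by
    rw [mul_smul_comm] at h1
    rw [← h1, smul_smul, mul_inv_cancel₀ hμ0, one_smul, h1]
  have hℓT : ∀ v, ℓ (T v) = μ * ℓ v := by
    intro v
    have := LinearMap.congr_fun hsT v
    simp only [Module.End.mul_apply, LinearMap.smul_apply] at this
    simp only [hℓ, LinearMap.smul_apply, LinearMap.comp_apply, this, map_smul, smul_eq_mul]
    ring
  refine ⟨ℓ.smulRight x, ?_, ?_, ?_⟩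
  · refine LinearMap.ext fun v => ?_
    simp [hℓx]
  · rw [LinearMap.trace_smulRight, hℓx]
  · refine LinearMap.ext fun v => ?_
    simp only [Module.End.mul_apply, LinearMap.smulRight_apply, map_smul, hx.apply_eq_smul, hℓT, smul_smul,
      mul_comm]

namespace Wed

/-- A fixed point of the square of the antipode on simple representations has an even multiplicity. -/
lemma even_D [IsAlgClosed k] (hθ : ∀ a, (d.SS ^ 8) a = a) (ht : counit (R := k) d.t = 0) {i : Fin w.n}
    (hi : w.perm d.SS i = i) : Even (w.D i) := by
  classical
  obtain ⟨T, hT, hconj⟩ := w.exists_conj d.SS (by norm_num : 0 < 8) hθ hi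
  obtain ⟨f, hf, hftr, hcomm⟩ := exists_rank_one_commuting (by norm_num : 0 < 8) hT
  obtain ⟨a, ha⟩ := w.surj (Pi.single i f)
  have hTu : T * T ^ 7 = 1 := by rw [← pow_succ', hT]
  have hstep : ∀ x, (∀ j, w.ρ j x = Pi.single (M := fun j => Module.End k (w.V j)) i f j) →
      ∀ j, w.ρ j (d.SS x) = Pi.single (M := fun j => Module.End k (w.V j)) i f j := by
    intro x hx j
    by_cases hj : j = i
    · subst hj
      have h1 := hconj x
      rw [hx, Pi.single_eq_same, hcomm] at h1
      rw [Pi.single_eq_same, ← mul_one (w.ρ j (d.SS x)), ← hTu, ← mul_assoc, h1, mul_assoc, hTu, mul_one]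
    · rw [Pi.single_eq_of_ne hj, ← w.ρ_perm, hx, Pi.single_eq_of_ne]
      intro h
      exact hj (w.perm_injective d.SS (h.trans hi.symm))
  have hpow : ∀ r, ∀ j, w.ρ j ((d.SS ^ r) a) = Pi.single (M := fun j => Module.End k (w.V j)) i f j := by
    intro r
    induction r with
    | zero => exact fun j => ha j
    | succ r ih => intro j; rw [pow_succ', AlgEquiv.mul_apply]; exact hstep _ ih j
  set b : A := (8 : k)⁻¹ • ∑ r ∈ Finset.range 8, (d.SS ^ r) a with hb
  let B : Subalgebra k A := AlgHom.equalizer (d.SS : A →ₐ[k] A) (AlgHom.id k A)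
  have hbB : b ∈ B := by
    change d.SS b = b
    rw [hb, map_smul, map_sum]
    congr 1
    have := Finset.sum_range_succ (fun r => (d.SS ^ r) a) 8
    rw [Finset.sum_range_succ', hθ, pow_zero, AlgEquiv.one_apply] at this
    simp only [pow_succ' d.SS, AlgEquiv.mul_apply] at this
    exact add_right_cancel this
  have hρb : ∀ j, w.ρ j b = Pi.single (M := fun j => Module.End k (w.V j)) i f j := by
    intro j
    rw [hb, map_smul, map_sum, Finset.sum_congr rfl fun r _ => hpow r j, Finset.sum_const, Finset.card_range,
      ← Nat.cast_smul_eq_nsmul k, smul_smul]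
    norm_num
  obtain ⟨e, heB, he, hρ⟩ := w.exists_lift B hbB (fun j => by
    rw [hρb]
    by_cases hj : j = i
    · subst hj; rw [Pi.single_eq_same]; exact hf
    · rw [Pi.single_eq_of_ne hj]; exact .zero)
  have heθ : d.SS e = e := heB
  have htr : LinearMap.trace k A (LinearMap.mulLeft k e) = (w.D i : k) := by
    rw [w.trace_mulLeft, Finset.sum_eq_single i]
    · rw [χ_apply, hρ, hρb, Pi.single_eq_same, hftr, mul_one]
    · intro j _ hj
      rw [χ_apply, hρ, hρb, Pi.single_eq_of_ne hj, map_zero, mul_zero]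
    · simp
  set Θ : Module.End k A := LinearMap.mulLeft k e ∘ₗ 𝒮 ∘ₗ 𝒮 with hΘ
  have hΘa : ∀ x, Θ x = e * d.SS x := fun x => rfl
  have hΘp : ∀ r x, (Θ ^ (r + 1)) x = e * (d.SS ^ (r + 1)) x := by
    intro r
    induction r with
    | zero => intro x; rw [zero_add, pow_one, pow_one]; rfl
    | succ r ih =>
      intro x
      rw [pow_succ', Module.End.mul_apply, ih, hΘa, map_mul, heθ, ← mul_assoc, he, pow_succ' d.SS (r + 1),
        AlgEquiv.mul_apply]
  obtain ⟨r, hr⟩ := exists_trace_eq_two_mul (T := Θ) (E := LinearMap.mulLeft k e)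
    (LinearMap.ext fun x => by
      rw [Module.End.mul_apply, hΘa, LinearMap.mulLeft_apply, map_mul, heθ, ← mul_assoc, he, hΘa])
    (LinearMap.ext fun x => by rw [hΘp 7, hθ]; rfl)
    (by rw [hΘ, d.trace_mulLeft_SS, ht, mul_zero])
  rw [htr] at hr
  exact ⟨r, by rw [← two_mul]; exact_mod_cast hr⟩

lemma perm_pow (φ : A ≃ₐ[k] A) (r : ℕ) (i : Fin w.n) : w.perm (φ ^ r) i = (w.perm φ)^[r] i := by
  induction r generalizing i with
  | zero => exact w.perm_eq _ fun a => rfl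
  | succ r ih =>
    rw [Function.iterate_succ_apply, ← ih]
    exact w.perm_eq _ fun a => by rw [χ_perm, χ_perm, pow_succ', AlgEquiv.mul_apply]

/-- The powers of the duality orbit of a simple representation not isomorphic to its bidual. -/
lemma exists_four (hθ : ∀ a, (d.SS ^ 8) a = a) {i : Fin w.n} (hi : w.perm d.SS i ≠ i) :
    ∃ s : Finset (Fin w.n), s.card = 4 ∧ i ∈ s ∧ ∀ j ∈ s, w.δ j = w.δ i ∧ w.D j = w.D i ∧
      w.perm d.SS j ≠ j := by
  classical
  set σ := w.star d with hσ
  have hinj : Function.Injective σ := w.star_injective d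
  have h2 : σ (σ i) ≠ i := by rw [hσ, star_star]; exact hi
  have h1 : σ i ≠ i := fun h => h2 (by rw [h, h])
  have h8 : (w.perm d.SS)^[8] i = i := by
    rw [← perm_pow]
    exact w.perm_eq _ fun a => by rw [hθ]
  have h3 : σ (σ (σ i)) ≠ i := by
    intro h
    have h16 : (σ^[2])^[8] i = i := by
      have : σ^[2] = w.perm d.SS := funext fun j => w.star_star d j
      rw [this, h8]
    simp only [Function.iterate_succ, Function.iterate_zero, Function.comp_apply, id_eq, h] at h16
    exact h1 h16
  have key : ∀ j, w.perm d.SS j ≠ j → w.perm d.SS (σ j) ≠ σ j := by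
    intro j hj h
    rw [← star_star] at hj h
    exact hj (hinj h)
  have k0 := hi
  have k1 := key _ k0
  have k2 := key _ k1
  have k3 := key _ k2
  have hδ : ∀ j, w.δ (σ j) = w.δ j := fun j => w.δ_star d j
  have hD : ∀ j, w.D (σ j) = w.D j := fun j => w.D_star d j
  refine ⟨{i, σ i, σ (σ i), σ (σ (σ i))}, ?_, by simp, ?_⟩
  · rw [Finset.card_insert_of_notMem, Finset.card_insert_of_notMem, Finset.card_insert_of_notMem,
      Finset.card_singleton]
    · simpa using fun h => h1 (hinj (hinj h)).symm
    · simpa using ⟨fun h => h1 (hinj h).symm, fun h => h2 (hinj h).symm⟩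
    · simpa using ⟨Ne.symm h1, Ne.symm h2, Ne.symm h3⟩
  · intro j hj
    simp only [Finset.mem_insert, Finset.mem_singleton] at hj
    rcases hj with rfl | rfl | rfl | rfl <;> simp [hδ, hD] <;> assumption

end Wed

end

section

variable {k : Type} [Field k] [CharZero k] {A : Type} [Ring A] [HopfAlgebra k A] [FiniteDimensional k A]
  (w : Wed k A) (d : IntData k A)
local notation "𝒮" => HopfAlgebra.antipode k (A := A)

section Intertwine
variable {P V W : Type} [AddCommGroup P] [Module k P] [AddCommGroup V] [Module k V] [AddCommGroup W] [Module k W]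

lemma unop_sum_apply {ι : Type*} (s : Finset ι) (f : ι → (Module.End k P)ᵐᵒᵖ) (F : P) :
    (∑ i ∈ s, f i).unop F = ∑ i ∈ s, (f i).unop F := by
  rw [← LinearMap.sum_apply]
  exact congrArg (fun z : Module.End k P => z F) (map_sum MulOpposite.opAddEquiv.symm f s)

lemma unop_cv_apply {X Y : A →ₗ[k] (Module.End k P)ᵐᵒᵖ} {ι : Type*} {a : A} (r : Repr k a ι) (F : P) :
    (cv X Y a).unop F = ∑ i ∈ r.index, (Y (r.right i)).unop ((X (r.left i)).unop F) := by
  rw [cv_apply r, unop_sum_apply]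
  rfl

lemma unop_apply_of_cv {X Y Z : A →ₗ[k] (Module.End k P)ᵐᵒᵖ} (hYZ : cv Y Z = sc _ (counit (R := k)))
    {F : P} {ψ : Ch k A} (h : ∀ a, (cv X Y a).unop F = ψ.fn a • F) (a : A) :
    (X a).unop F = (Z (ψ.aut a)).unop F := by
  have h1 : cv (cv X Y) Z = X := by rw [cv_assoc, hYZ, cv_counit]
  rw [← h1, unop_cv_apply (ℛ k a), Ch.aut_apply, hitL_apply (ℛ k a), map_sum, unop_sum_apply]
  refine Finset.sum_congr rfl fun i _ => ?_
  rw [h, map_smul, map_smul]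
  rfl

/-- Post-composition, with values in the opposite of an endomorphism algebra. -/
noncomputable def postOp (σ : A →ₗ[k] Module.End k W) : A →ₗ[k] (Module.End k (V →ₗ[k] W))ᵐᵒᵖ :=
  (MulOpposite.opLinearEquiv k).toLinearMap ∘ₗ LinearMap.llcomp k V W W ∘ₗ σ

/-- Pre-composition, with values in the opposite of an endomorphism algebra. -/
noncomputable def preOp (τ : A →ₗ[k] Module.End k V) : A →ₗ[k] (Module.End k (V →ₗ[k] W))ᵐᵒᵖ :=
  (MulOpposite.opLinearEquiv k).toLinearMap ∘ₗ (LinearMap.llcomp k V V W).flip ∘ₗ τ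

lemma postOp_unop (σ : A →ₗ[k] Module.End k W) (a : A) (F : V →ₗ[k] W) :
    (postOp σ a).unop F = σ a ∘ₗ F := rfl

lemma preOp_unop (τ : A →ₗ[k] Module.End k V) (a : A) (F : V →ₗ[k] W) :
    (preOp τ a).unop F = F ∘ₗ τ a := rfl

lemma cv_preOp (τ : A →ₐ[k] Module.End k V) :
    cv (preOp (W := W) (τ.toLinearMap ∘ₗ 𝒮)) (preOp τ.toLinearMap) = sc _ (counit (R := k)) := by
  ext a
  refine MulOpposite.unop_injective (LinearMap.ext fun F => ?_)
  rw [unop_cv_apply (ℛ k a)]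
  have h := LinearMap.congr_fun (cv_S_id (k := k) (A := A)) a
  rw [cv_apply (ℛ k a)] at h
  have h2 := congrArg (fun z => F ∘ₗ τ z) h
  simp only [map_sum, map_mul, sc_apply, AlgHom.commutes] at h2
  simp only [preOp_unop, LinearMap.comp_assoc]
  refine LinearMap.ext fun v => ?_
  have h3 := LinearMap.congr_fun h2 v
  simpa [LinearMap.sum_apply, MulOpposite.algebraMap_apply] using h3

lemma cv_postOp (σ : A →ₐ[k] Module.End k W) :
    cv (postOp (V := V) (σ.toLinearMap ∘ₗ 𝒮)) (postOp (σ.toLinearMap ∘ₗ 𝒮 ∘ₗ 𝒮)) = sc _ (counit (R := k)) := by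
  ext a
  refine MulOpposite.unop_injective (LinearMap.ext fun F => ?_)
  rw [unop_cv_apply (ℛ k a)]
  have h := LinearMap.congr_fun (cv_id_S (k := k) (A := A)) a
  rw [cv_apply (ℛ k a)] at h
  have h2 := congrArg (fun z => σ (𝒮 z) ∘ₗ F) h
  simp only [map_sum, S_mul, map_mul, sc_apply, LinearMap.id_apply] at h2
  simp only [postOp_unop]
  refine LinearMap.ext fun v => ?_
  have h3 := LinearMap.congr_fun h2 v
  simpa [LinearMap.sum_apply, MulOpposite.algebraMap_apply, Algebra.algebraMap_eq_smul_one, S_one] using h3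

variable [FiniteDimensional k V]

lemma hom_of_sub (σ : A →ₐ[k] Module.End k W) (τ : A →ₐ[k] Module.End k V) {ψ : Ch k A}
    {v : W ⊗[k] Module.Dual k V} (hv : ∀ a, tens σ (dualRep τ) a v = ψ.fn a • v) (a : A) :
    σ a ∘ₗ homEquiv W V v = homEquiv W V v ∘ₗ τ (ψ.aut a) := by
  refine unop_apply_of_cv (X := postOp σ.toLinearMap) (cv_preOp (W := W) τ) (fun a => ?_) a
  rw [unop_cv_apply (ℛ k a), ← map_smul, ← hv, homEquiv_tens (ℛ k a)]
  rfl

lemma exists_hom_of_quot (σ : A →ₐ[k] Module.End k W) (τ : A →ₐ[k] Module.End k V) {ψ : Ch k A}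
    {ℓ : W ⊗[k] Module.Dual k V →ₗ[k] k} (hℓ : ∀ a v, ℓ (tens σ (dualRep τ) a v) = ψ.fn a * ℓ v) :
    ∃ G : W →ₗ[k] V, (G = 0 → ℓ = 0) ∧ ∀ a, G ∘ₗ σ a = τ (𝒮 (𝒮 (ψ.aut a))) ∘ₗ G := by
  let G : W →ₗ[k] V := (Module.evalEquiv k V).symm.toLinearMap ∘ₗ TensorProduct.curry ℓ
  have hG : ∀ v (f : Module.Dual k V), f (G v) = ℓ (v ⊗ₜ f) := by
    intro v f
    change f ((Module.evalEquiv k V).symm (TensorProduct.curry ℓ v)) = _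
    rw [Module.apply_evalEquiv_symm_apply]
    rfl
  refine ⟨G, fun h => ?_, ?_⟩
  · refine TensorProduct.ext' fun v f => ?_
    rw [← hG, h]; simp
  · refine fun a => unop_apply_of_cv (F := G) (ψ := ψ) (X := preOp σ.toLinearMap) (cv_postOp (V := W) τ) (fun a => ?_) a
    rw [unop_cv_apply (ℛ k a)]
    refine LinearMap.ext fun v => ?_
    refine (Module.forall_dual_apply_eq_zero_iff k _).1 ?_ |> sub_eq_zero.1
    intro f
    rw [map_sub, sub_eq_zero, LinearMap.smul_apply, map_smul, hG, smul_eq_mul, ← hℓ, tens_apply (ℛ k a),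
      LinearMap.sum_apply, map_sum, LinearMap.sum_apply, map_sum]
    refine Finset.sum_congr rfl fun i _ => ?_
    rw [TensorProduct.map_tmul, ← hG]
    rfl

end Intertwine

namespace Wed

lemma hom_eq_zero {i j : Fin w.n} {φ : A ≃ₐ[k] A} (h : i ≠ w.perm φ j) {F : w.V j →ₗ[k] w.V i}
    (hF : ∀ a, w.ρ i a ∘ₗ F = F ∘ₗ w.ρ j (φ a)) : F = 0 := by
  classical
  obtain ⟨a, ha⟩ := w.surj (Pi.single i 1)
  have h1 := hF a
  rw [ha, Pi.single_eq_same, (w.ρ_perm φ j a).1 (by rw [ha, Pi.single_eq_of_ne (Ne.symm h)])] at h1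
  rw [LinearMap.comp_zero] at h1
  exact h1

lemma hom_eq_zero' {i j : Fin w.n} {φ : A ≃ₐ[k] A} (h : i ≠ w.perm φ j) {F : w.V i →ₗ[k] w.V j}
    (hF : ∀ a, F ∘ₗ w.ρ i a = w.ρ j (φ a) ∘ₗ F) : F = 0 := by
  classical
  obtain ⟨a, ha⟩ := w.surj (Pi.single i 1)
  have h1 := hF a
  rw [ha, Pi.single_eq_same, (w.ρ_perm φ j a).1 (by rw [ha, Pi.single_eq_of_ne (Ne.symm h)])] at h1
  rw [LinearMap.zero_comp] at h1
  exact h1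

/-- The multiplicities in a tensor product with a dual representation. -/
lemma mult_tens_dual (i j l : Fin w.n) : w.mult (tens (w.ρ i) (dualRep (w.ρ j))) l = w.N i (w.star d j) l := by
  have h : chr (dualRep (w.ρ j)) = w.χ (w.star d j) := by
    ext a
    rw [χ_star, chr_apply, dualRep_apply, LinearMap.trace_transpose', χ_apply]
  have h1 := w.mult_cast (tens (w.ρ i) (dualRep (w.ρ j))) l
  rw [← chr_apply, chr_tens, h] at h1
  have h2 := w.mult_cast (tens (w.ρ i) (w.ρ (w.star d j))) l
  rw [← chr_apply, chr_tens] at h2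
  exact_mod_cast h1.trans h2.symm

variable {M : Type} [AddCommGroup M] [Module k M] [FiniteDimensional k M]

lemma one_le_mult {σ : A →ₐ[k] Module.End k M} {i : Fin w.n} {v : M} (h : σ (w.e i) v ≠ 0) :
    1 ≤ w.mult σ i := by
  rw [Nat.one_le_iff_ne_zero, mult, Ne, Submodule.finrank_eq_zero, LinearMap.range_eq_bot]
  rintro h0
  rw [h0] at h
  exact h rfl

lemma two_le_mult {σ : A →ₐ[k] Module.End k M} {i : Fin w.n} {z : A} (hz : z ∈ w.J)
    (h : w.e i * z = z) (h' : z * w.e i = z) {v : M} (hv : σ z v ≠ 0) : 2 ≤ w.mult σ i := by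
  by_contra hn
  have h1 : w.mult σ i = 1 := by
    have := w.one_le_mult (σ := σ) (i := i) (v := σ z v) (by
      rw [← Module.End.mul_apply, ← map_mul, h]; exact hv)
    omega
  have hmem : ∀ m, σ z m ∈ LinearMap.range (σ (w.e i)) := fun m => ⟨σ z m, by
    rw [← Module.End.mul_apply, ← map_mul, h]⟩
  obtain ⟨c, hc⟩ := (finrank_eq_one_iff_of_nonzero' (⟨σ z v, hmem v⟩ : LinearMap.range (σ (w.e i)))
    (by simpa [Subtype.ext_iff] using hv)).1 h1 ⟨σ (w.e i) v, v, rfl⟩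
  have hc' : c • σ z v = σ (w.e i) v := congrArg Subtype.val hc
  have h2 : σ z v = c • σ z (σ z v) := by
    rw [← map_smul, hc', ← Module.End.mul_apply (σ z), ← map_mul, h']
  have h3 : ∀ r, σ z v = c ^ r • (σ (z ^ r)) (σ z v) := by
    intro r
    induction r with
    | zero => simp
    | succ r ih =>
      rw [pow_succ' z, map_mul, Module.End.mul_apply, pow_succ', mul_smul, ← map_smul, ← ih]
      exact h2
  obtain ⟨r, hr⟩ := w.isNilpotent_of_mem hz
  refine hv ?_
  rw [h3 r, hr, map_zero, LinearMap.zero_apply, smul_zero]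

/-- If a one-dimensional constituent is neither a sub nor a quotient, the module is large. -/
lemma five_le_finrank (hE : NoSkew k A) (σ : A →ₐ[k] Module.End k M) {ψ : Ch k A}
    (hsub : ∀ v, (∀ a, σ a v = ψ.fn a • v) → v = 0)
    (hquot : ∀ ℓ : M →ₗ[k] k, (∀ a v, ℓ (σ a v) = ψ.fn a * ℓ v) → ℓ = 0)
    (h : w.mult σ (w.idx ψ) ≠ 0) : 5 ≤ Module.finrank k M := by
  set e := w.e (w.idx ψ) with he
  have hσe : σ e ≠ 0 := by
    intro h0
    rw [mult, ← he, h0, LinearMap.range_zero, finrank_bot] at h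
    exact h rfl
  obtain ⟨m0, hm0⟩ : ∃ m0, σ e m0 ≠ 0 := by
    by_contra! hn
    exact hσe (LinearMap.ext hn)
  obtain ⟨φ, hφ⟩ := Module.Projective.exists_dual_ne_zero k hm0
  set ℓ := φ ∘ₗ σ e with hℓ
  have hℓ0 : ℓ ≠ 0 := fun h0 => hφ (LinearMap.congr_fun h0 m0)
  have hee : σ e * σ e = σ e := by rw [← map_mul, w.e_idem]
  have hℓe : ℓ ∘ₗ σ e = ℓ := by
    rw [hℓ, LinearMap.comp_assoc]
    exact congrArg (φ ∘ₗ ·) hee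
  obtain ⟨j', hj', x', hx', hne⟩ : ∃ j', w.δ j' ≠ 1 ∧ ∃ x ∈ w.J, ℓ ∘ₗ σ (x * w.e j') ≠ 0 := by
    by_contra! hn
    have h1 := fun {x} (hx : x ∈ w.J) => w.comp_eq_zero_of_nonlinear hE σ hℓe hn hx
    refine hℓ0 (hquot ℓ fun a v => ?_)
    have h2 := LinearMap.congr_fun (h1 (w.e_idx_mul ψ a)) v
    rw [map_sub, map_mul, map_smul] at h2
    simp only [LinearMap.comp_apply, LinearMap.sub_apply, LinearMap.smul_apply, Module.End.mul_apply, map_sub,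
      map_smul, LinearMap.zero_apply, sub_eq_zero, smul_eq_mul] at h2
    have h3 := fun u => LinearMap.congr_fun hℓe u
    simp only [LinearMap.comp_apply] at h3
    rwa [← he, h3, h3] at h2
  obtain ⟨m, hm⟩ : ∃ m, ℓ (σ (x' * w.e j') m) ≠ 0 := by
    by_contra! hn
    exact hne (LinearMap.ext hn)
  set v := σ e (σ (x' * w.e j') m) with hv
  have hv0 : v ≠ 0 := fun h0 => hm (by rw [hℓ, LinearMap.comp_apply, ← hv, h0, map_zero])
  have hve : σ e v = v := by rw [hv, ← Module.End.mul_apply, hee]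
  obtain ⟨j, hj, x, hx, hne2⟩ : ∃ j, w.δ j ≠ 1 ∧ ∃ x ∈ w.J, σ (w.e j * x) v ≠ 0 := by
    by_contra! hn
    have h1 := fun {x} (hx : x ∈ w.J) => w.apply_eq_zero_of_nonlinear hE σ hve hn hx
    refine hv0 (hsub v fun a => ?_)
    have h2 := h1 (w.mul_e_idx ψ a)
    rw [map_sub, map_mul, map_smul] at h2
    simp only [LinearMap.sub_apply, LinearMap.smul_apply, Module.End.mul_apply, sub_eq_zero] at h2
    rwa [← he, hve] at h2
  have hz : σ (w.e j * x * e * (x' * w.e j')) m = σ (w.e j * x) v := by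
    rw [hv, map_mul σ (w.e j * x * e), map_mul σ (w.e j * x)]; rfl
  have hδj : 2 ≤ w.δ j := by have := w.δ_pos j; omega
  have hδj' : 2 ≤ w.δ j' := by have := w.δ_pos j'; omega
  have hψ : 1 ≤ w.mult σ (w.idx ψ) := Nat.one_le_iff_ne_zero.2 h
  have hψj : w.idx ψ ≠ j := by rintro h0; rw [← h0, δ_idx] at hj; exact hj rfl
  have hψj' : w.idx ψ ≠ j' := by rintro h0; rw [← h0, δ_idx] at hj'; exact hj' rfl
  rw [← w.sum_δ_mult σ]
  by_cases hjj : j = j'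
  · subst hjj
    have h2 := w.two_le_mult (σ := σ) (i := j) (z := w.e j * x * e * (x' * w.e j)) (v := m)
      (w.mul_mem_J _ (w.mem_J_mul _ hx')) (by simp only [← mul_assoc, w.e_idem])
      (by simp only [mul_assoc, w.e_idem]) (by rw [hz]; exact hne2)
    refine le_trans ?_ (Finset.add_le_sum (fun _ _ => Nat.zero_le _) (Finset.mem_univ _) (Finset.mem_univ _) hψj)
    rw [δ_idx]
    nlinarith
  · have h2 : 1 ≤ w.mult σ j := w.one_le_mult (v := σ x v) (by
      rw [← Module.End.mul_apply, ← map_mul]; exact hne2)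
    have h3 : 1 ≤ w.mult σ j' := w.one_le_mult (v := m) (by
      intro h0
      apply hm
      rw [map_mul, Module.End.mul_apply, h0, map_zero, map_zero])
    have hs : ({w.idx ψ, j, j'} : Finset (Fin w.n)) ⊆ Finset.univ := Finset.subset_univ _
    refine le_trans ?_ (Finset.sum_le_sum_of_subset hs)
    rw [Finset.sum_insert (by simp [hψj, hψj']), Finset.sum_pair hjj, δ_idx]
    nlinarith

/-- Most one-dimensional representations do not occur in `W ⊗ U*`. -/
lemma N_star_idx_eq_zero (hE : NoSkew k A) {i j : Fin w.n} (hi : w.δ i = 2) (hj : w.δ j = 2) {ψ : Ch k A}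
    (h1 : i ≠ w.act ψ j) (h2 : i ≠ w.act ψ (w.perm d.SS j)) : w.N i (w.star d j) (w.idx ψ) = 0 := by
  by_contra h
  rw [← mult_tens_dual] at h
  have h5 := w.five_le_finrank hE (tens (w.ρ i) (dualRep (w.ρ j))) (fun v hv => ?_) (fun ℓ hℓ => ?_) h
  · rw [Module.finrank_tensorProduct, Subspace.dual_finrank_eq] at h5
    simp [hi, hj] at h5
  · have := w.hom_eq_zero (φ := ψ.aut) h1 (F := homEquiv _ _ v) (hom_of_sub _ _ hv)
    simpa using this
  · obtain ⟨G, hG, hGa⟩ := exists_hom_of_quot _ _ hℓ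
    refine hG (w.hom_eq_zero' (φ := ψ.aut.trans d.SS) ?_ (fun a => hGa a))
    convert h2 using 1
    exact w.perm_eq _ fun a => by rw [χ_act, ← Ch.fn_aut, χ_perm]; rfl

end Wed

end

section

variable {k : Type} [Field k] [CharZero k] {A : Type} [Ring A] [HopfAlgebra k A] [FiniteDimensional k A]
  (w : Wed k A) (d : IntData k A)
local notation "𝒮" => HopfAlgebra.antipode k (A := A)

namespace Wed

/-- The simple representations of dimension at least two. -/
def nl : Finset (Fin w.n) := Finset.univ.filter fun i => w.δ i ≠ 1

lemma mem_nl {i : Fin w.n} : i ∈ w.nl ↔ w.δ i ≠ 1 := by simp [nl]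

lemma two_le_of_mem_nl {i : Fin w.n} (h : i ∈ w.nl) : 2 ≤ w.δ i := by
  have := w.δ_pos i
  have := w.mem_nl.1 h
  omega

lemma sum_eq_idx_add_nl {M : Type} [AddCommMonoid M] (f : Fin w.n → M) :
    ∑ i, f i = ∑ χ, f (w.idx χ) + ∑ i ∈ w.nl, f i := by
  rw [← Finset.sum_filter_add_sum_filter_not Finset.univ (fun j => w.δ j = 1)]
  congr 1
  have : (Finset.univ.filter fun j => w.δ j = 1) = Finset.univ.image w.idx := by
    ext j
    simp only [Finset.mem_filter, Finset.mem_univ, true_and, Finset.mem_image]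
    exact ⟨fun h => w.exists_eq_idx h, by rintro ⟨χ, rfl⟩; exact w.δ_idx χ⟩
  rw [this, Finset.sum_image w.idx_injective.injOn]

lemma sum_nl : Fintype.card (Ch k A) * w.d0 + ∑ i ∈ w.nl, w.δ i * w.D i = Module.finrank k A := w.sum_δ_D_eq

lemma sum_D_N' (j l : Fin w.n) : (∑ χ, if l = w.act χ j then w.d0 else 0) + ∑ i ∈ w.nl, w.D i * w.N i j l =
    w.δ j * w.D l := by
  rw [← w.sum_D_N j l, w.sum_eq_idx_add_nl]
  congr 1
  refine Finset.sum_congr rfl fun χ _ => ?_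
  rw [D_idx, N_idx, d0]
  split_ifs <;> simp

/-- The multiplicity of the trivial representation in `U ⊗ U*`. -/
noncomputable def y (U : Fin w.n) : ℕ := w.N U (w.star d U) w.i0

lemma inv_apply {V W : Type} [AddCommGroup V] [Module k V] [AddCommGroup W] [Module k W] [FiniteDimensional k V]
    (τ : A →ₐ[k] Module.End k V) (a : A) :
    tens τ (dualRep τ) a ((homEquiv V V).symm 1) = counit (R := k) a • (homEquiv V V).symm 1 := by
  apply (homEquiv V V).injective
  rw [homEquiv_tens (ℛ k a), map_smul, LinearEquiv.apply_symm_apply]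
  have h := congrArg τ (LinearMap.congr_fun (cv_id_S (k := k) (A := A)) a)
  rw [cv_apply (ℛ k a), map_sum, sc_apply, AlgHom.commutes, Algebra.algebraMap_eq_smul_one] at h
  rw [← h]
  refine Finset.sum_congr rfl fun i _ => ?_
  rw [LinearMap.id_apply, map_mul]
  rfl

lemma counit_e_i0 : counit (R := k) (w.e w.i0) = 1 := by
  have := w.χ_e w.i0 w.i0
  rwa [i0, χ_idx, if_pos rfl, Ch.fn_one'] at this

lemma one_le_y (U : Fin w.n) : 1 ≤ w.y d U := by
  rw [y, ← mult_tens_dual]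
  refine w.one_le_mult (v := (homEquiv _ _).symm 1) ?_
  rw [inv_apply (W := k), counit_e_i0, one_smul, Ne, LinearEquiv.map_eq_zero_iff]
  exact one_ne_zero

lemma N_act (ψ : Ch k A) (i j l : Fin w.n) : w.N (w.act ψ i) j (w.act ψ l) = w.N i j l := by
  have h1 : cv (w.χ (w.act ψ i)) (w.χ j) = cv ψ.fn (cv (w.χ i) (w.χ j)) := by
    rw [← cv_assoc]
    congr 1
    exact LinearMap.ext fun a => w.χ_act ψ i a
  have h2 := w.cv_χ (w.act ψ i) j (w.e (w.act ψ l))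
  rw [h1, ← Ch.fn_aut, cv_χ] at h2
  simp only [Ch.fn_aut, ← χ_act, χ_e, mul_ite, mul_one, mul_zero, Finset.sum_ite_eq', Finset.mem_univ, if_true,
    act, (w.perm_injective _).eq_iff] at h2
  exact_mod_cast h2.symm

lemma N_of_mem_st {ψ : Ch k A} {U : Fin w.n} (h : ψ ∈ w.st U) (j : Fin w.n) : w.N U j (w.idx ψ) = w.N U j w.i0 := by
  have := w.N_act ψ U j w.i0
  rwa [w.mem_st.1 h, i0, act_idx, mul_one] at this

variable {U : Fin w.n} (hE : NoSkew k A) (hU : w.δ U = 2) (hS : w.perm d.SS U = U)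
include hE hU hS

lemma sum_T : (w.st U).card * w.y d U + ∑ l ∈ w.nl, w.δ l * w.N U (w.star d U) l = 4 := by
  classical
  have h := w.sum_δ_N U (w.star d U)
  rw [w.sum_eq_idx_add_nl, δ_star, hU] at h
  refine Eq.trans ?_ h
  congr 1
  rw [← Finset.sum_subset (Finset.subset_univ (w.st U)), Finset.sum_congr rfl (g := fun _ => w.y d U)]
  · simp
  · intro ψ hψ
    rw [δ_idx, one_mul, w.N_of_mem_st hψ, y]
  · intro ψ _ hψ
    rw [mem_st] at hψ
    rw [w.N_star_idx_eq_zero d hE hU hU (Ne.symm hψ) (by rw [hS]; exact Ne.symm hψ), mul_zero]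

lemma sum_T' : w.D U * w.y d U + ∑ i ∈ w.nl.filter (fun i => 3 ≤ w.δ i), w.D i * w.N i (w.star d U) w.i0 =
    2 * w.d0 := by
  classical
  have h := w.sum_D_N' (w.star d U) w.i0
  rw [Finset.sum_eq_zero, zero_add, δ_star, hU] at h
  · rw [d0, ← h, ← Finset.sum_filter_add_sum_filter_not w.nl (fun i => 3 ≤ w.δ i), add_comm]
    congr 1
    rw [Finset.sum_eq_single U]
    · rfl
    · intro i hi hiU
      rw [Finset.mem_filter] at hi
      have := w.two_le_of_mem_nl hi.1
      have h2 : w.δ i = 2 := by omega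
      have := w.N_star_idx_eq_zero d hE (ψ := 1) h2 hU (by rwa [act_one]) (by rwa [act_one, hS])
      rw [i0, this, mul_zero]
    · intro hU'
      refine absurd ?_ hU'
      rw [Finset.mem_filter, mem_nl]
      omega
  · intro χ _
    rw [if_neg]
    intro h
    have h1 := w.δ_act χ (w.star d U)
    rw [← h, i0, δ_idx, δ_star, hU] at h1
    omega

lemma T_ne_four (hn : Fintype.card (Ch k A) ≤ 2) : (w.st U).card * w.y d U ≠ 4 := by
  intro h4
  have hT := w.sum_T d hE hU hS
  have h0 : ∀ l ∈ w.nl, w.mult (tens (w.ρ U) (dualRep (w.ρ U))) l = 0 := by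
    intro l hl
    have h1 : ∑ l ∈ w.nl, w.δ l * w.N U (w.star d U) l = 0 := by omega
    have h2 := Finset.sum_eq_zero_iff.1 h1 l hl
    rw [mult_tens_dual]
    exact (mul_eq_zero.1 h2).resolve_left (w.δ_pos l).ne'
  have hst : (w.st U).card ≤ 2 := (Finset.card_le_univ _).trans hn
  set σ := tens (w.ρ U) (dualRep (w.ρ U)) with hσ
  have hy : w.y d U ≤ 1 := by
    rw [y, ← mult_tens_dual]
    have : NeZero (w.δ U) := inferInstance
    have hsub : LinearMap.range (σ (w.e w.i0)) ≤ Submodule.span k {(homEquiv (w.V U) (w.V U)).symm 1} := by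
      rintro _ ⟨v, rfl⟩
      set m := σ (w.e w.i0) v with hm
      have hme : σ (w.e w.i0) m = m := by
        rw [hm, ← Module.End.mul_apply, ← map_mul, w.e_idem]
      have hinv : ∀ a, σ a m = (1 : Ch k A).fn a • m := by
        intro a
        have h1 := w.apply_eq_zero_of_nonlinear hE σ hme (fun j hj x _ => by
          rw [map_mul, Module.End.mul_apply]
          have := h0 j (w.mem_nl.2 hj)
          rw [mult, Submodule.finrank_eq_zero, LinearMap.range_eq_bot] at this
          rw [this, LinearMap.zero_apply]) (w.mul_e_idx 1 a)
        rw [map_sub, map_mul, map_smul, LinearMap.sub_apply, LinearMap.smul_apply, Module.End.mul_apply,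
          sub_eq_zero] at h1
        change σ a (σ (w.e w.i0) m) = _ • σ (w.e w.i0) m at h1
        rwa [hme] at h1
      obtain ⟨c, hc⟩ := exists_smul_of_central (T := homEquiv (w.V U) (w.V U) m) (fun f => by
        obtain ⟨a, rfl⟩ := w.surjective_ρ U f
        have := hom_of_sub _ _ hinv a
        rw [Ch.aut_one] at this
        exact this.symm)
      refine Submodule.mem_span_singleton.2 ⟨c, ?_⟩
      rw [← map_smul, ← hc, LinearEquiv.symm_apply_apply]
    exact (Submodule.finrank_mono hsub).trans ((finrank_span_le_card _).trans (by simp))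
  nlinarith

lemma T_le_two (hn : Fintype.card (Ch k A) ≤ 2) : (w.st U).card * w.y d U ≤ 2 := by
  have hT := w.sum_T d hE hU hS
  have h4 := w.T_ne_four d hE hU hS hn
  by_contra h
  have h1 : ∑ l ∈ w.nl, w.δ l * w.N U (w.star d U) l = 1 := by omega
  obtain ⟨l, hl, hl0⟩ := Finset.exists_ne_zero_of_sum_ne_zero (h1 ▸ one_ne_zero)
  have h2 := Finset.single_le_sum (f := fun l => w.δ l * w.N U (w.star d U) l) (fun _ _ => Nat.zero_le _) hl
  have h3 := w.two_le_of_mem_nl hl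
  have h5 : 1 ≤ w.N U (w.star d U) l := Nat.one_le_iff_ne_zero.2 fun h => hl0 (by rw [h, mul_zero])
  simp only [h1] at h2
  nlinarith

lemma T_three (h1 : (w.st U).card * w.y d U = 1) : ∃ l, w.δ l = 3 := by
  have hT := w.sum_T d hE hU hS
  by_contra! hn
  have h3 : ∑ l ∈ w.nl, w.δ l * w.N U (w.star d U) l = 3 := by omega
  have : 2 ∣ ∑ l ∈ w.nl, w.δ l * w.N U (w.star d U) l := by
    refine Finset.dvd_sum fun l hl => ?_
    have h2 := Finset.single_le_sum (f := fun l => w.δ l * w.N U (w.star d U) l) (fun _ _ => Nat.zero_le _) hl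
    simp only [h3] at h2
    have h4 := w.two_le_of_mem_nl hl
    have h5 := hn l
    rcases Nat.eq_zero_or_pos (w.N U (w.star d U) l) with h6 | h6
    · rw [h6]; simp
    · have : w.δ l = 2 := by
        have : w.δ l ≤ 3 := by nlinarith
        omega
      rw [this]; exact Dvd.intro _ rfl
  omega

lemma T_two (h1 : (w.st U).card * w.y d U = 2) : ∃ l, w.δ l = 2 ∧ w.N U (w.star d U) l = 1 := by
  have hT := w.sum_T d hE hU hS
  have h3 : ∑ l ∈ w.nl, w.δ l * w.N U (w.star d U) l = 2 := by omega
  obtain ⟨l, hl, hl0⟩ := Finset.exists_ne_zero_of_sum_ne_zero (h3 ▸ two_ne_zero)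
  have h2 := Finset.single_le_sum (f := fun l => w.δ l * w.N U (w.star d U) l) (fun _ _ => Nat.zero_le _) hl
  have h4 := w.two_le_of_mem_nl hl
  have h5 : 1 ≤ w.N U (w.star d U) l := Nat.one_le_iff_ne_zero.2 fun h => hl0 (by rw [h, mul_zero])
  simp only [h3] at h2
  refine ⟨l, ?_, ?_⟩ <;> nlinarith

end Wed

end

section

variable {k : Type} [Field k] [CharZero k] {A : Type} [Ring A] [HopfAlgebra k A] [FiniteDimensional k A]
  (w : Wed k A) (d : IntData k A)

/-- The standing assumptions of the numerical case analysis. -/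
structure Core (M : ℕ) : Prop where
  noSkew : NoSkew k A
  finrank_eq : Module.finrank k A = M
  pow_eight : ∀ a, (d.SS ^ 8) a = a
  even_D : ∀ i, w.perm d.SS i = i → Even (w.D i)

namespace Core
open Wed

variable {w d} {M : ℕ} (h : Core w d M)
include h

lemma budget {S : Finset (Fin w.n)} (hS : S ⊆ w.nl) :
    Fintype.card (Ch k A) * w.d0 + ∑ i ∈ S, w.δ i * w.D i ≤ M := by
  rw [← h.finrank_eq, ← w.sum_nl]
  exact Nat.add_le_add_left (Finset.sum_le_sum_of_subset hS) _

lemma even_d0 : Even w.d0 := by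
  refine h.even_D w.i0 (w.perm_eq _ fun a => ?_)
  rw [i0, χ_idx, Ch.fn_one', d.SS_apply, HopfAlgebra.counit_antipode, HopfAlgebra.counit_antipode]

lemma eq_nl {S : Finset (Fin w.n)} (hS : S ⊆ w.nl)
    (he : Fintype.card (Ch k A) * w.d0 + ∑ i ∈ S, w.δ i * w.D i = M) : S = w.nl := by
  by_contra hne
  obtain ⟨i, hi, hiS⟩ := Finset.exists_of_ssubset (hS.ssubset_of_ne hne)
  have := h.budget (S := insert i S) (Finset.insert_subset hi hS)
  rw [Finset.sum_insert hiS] at this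
  have := Nat.mul_pos (w.δ_pos i) (w.D_pos i)
  omega

lemma exists_new {S : Finset (Fin w.n)}
    (he : Fintype.card (Ch k A) * w.d0 + ∑ i ∈ S, w.δ i * w.D i ≠ M) (hS : S ⊆ w.nl) : ∃ i ∈ w.nl, i ∉ S := by
  by_contra! hne
  rw [hS.antisymm hne, w.sum_nl, h.finrank_eq] at he
  exact he rfl

lemma new_le {S : Finset (Fin w.n)} (hS : S ⊆ w.nl) (hc : ∀ i ∈ S, ∀ χ, w.act χ i ∈ S) {i : Fin w.n} (hi : i ∈ w.nl)
    (hiS : i ∉ S) : Fintype.card (Ch k A) * w.d0 + ∑ i ∈ S, w.δ i * w.D i +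
      (w.orb i).card * (w.δ i * w.D i) ≤ M := by
  have hd : Disjoint S (w.orb i) := by
    refine Finset.disjoint_right.2 fun j hj hjS => hiS ?_
    obtain ⟨χ, rfl⟩ := w.mem_orb.1 hj
    have := hc _ hjS χ⁻¹
    rwa [← act_mul, inv_mul_cancel, act_one] at this
  have hsub : S ∪ w.orb i ⊆ w.nl := by
    refine Finset.union_subset hS fun j hj => ?_
    obtain ⟨χ, rfl⟩ := w.mem_orb.1 hj
    rw [mem_nl, δ_act]
    exact w.mem_nl.1 hi
  have := h.budget hsub
  rw [Finset.sum_union hd, ← add_assoc, Finset.sum_congr rfl (s₁ := w.orb i) (g := fun _ => w.δ i * w.D i)] at this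
  · simpa using this
  · intro j hj
    obtain ⟨χ, rfl⟩ := w.mem_orb.1 hj
    rw [δ_act, D_act]

lemma new_le' {S : Finset (Fin w.n)} (hS : S ⊆ w.nl) (hc : ∀ i ∈ S, ∀ χ, w.act χ i ∈ S) {i : Fin w.n} (hi : i ∈ w.nl)
    (hiS : i ∉ S) : Fintype.card (Ch k A) * w.d0 + ∑ i ∈ S, w.δ i * w.D i + Fintype.card (Ch k A) * w.d0 ≤ M := by
  refine le_trans (Nat.add_le_add_left ?_ _) (h.new_le hS hc hi hiS)
  rw [← w.card_st_mul_card_orb i, mul_assoc]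
  exact Nat.mul_le_mul_left _ (w.card_st_mul_le i)

lemma nonfixed_le {S : Finset (Fin w.n)} (hS : S ⊆ w.nl) (hc : ∀ i ∈ S, w.perm d.SS i = i) {i : Fin w.n}
    (hi : i ∈ w.nl) (hi' : w.perm d.SS i ≠ i) :
    Fintype.card (Ch k A) * w.d0 + ∑ i ∈ S, w.δ i * w.D i + 4 * (w.δ i * w.D i) ≤ M := by
  obtain ⟨s, hs4, -, hs⟩ := w.exists_four d h.pow_eight hi'
  have hd : Disjoint S s := Finset.disjoint_right.2 fun j hj hjS => (hs j hj).2.2 (hc _ hjS)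
  have hsub : S ∪ s ⊆ w.nl := by
    refine Finset.union_subset hS fun j hj => ?_
    rw [mem_nl, (hs j hj).1]
    exact w.mem_nl.1 hi
  have := h.budget hsub
  rw [Finset.sum_union hd, ← add_assoc, Finset.sum_congr rfl (s₁ := s) (g := fun _ => w.δ i * w.D i)] at this
  · simpa [hs4] using this
  · intro j hj
    rw [(hs j hj).1, (hs j hj).2.1]

/-- If the remaining simple representations are two-dimensional with even `D`, the total is determined modulo `4`. -/
lemma dvd_four {S : Finset (Fin w.n)} (hS : S ⊆ w.nl) (h2 : ∀ i ∈ w.nl, i ∉ S → w.δ i = 2 ∧ Even (w.D i)) :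
    ∃ r, Fintype.card (Ch k A) * w.d0 + ∑ i ∈ S, w.δ i * w.D i + 4 * r = M := by
  classical
  have := w.sum_nl
  rw [h.finrank_eq, ← Finset.sum_sdiff hS] at this
  have h4 : 4 ∣ ∑ i ∈ w.nl \ S, w.δ i * w.D i := by
    refine Finset.dvd_sum fun i hi => ?_
    rw [Finset.mem_sdiff] at hi
    obtain ⟨h3, c, hc⟩ := h2 i hi.1 hi.2
    rw [h3, hc]
    exact ⟨c, by ring⟩
  obtain ⟨r, hr⟩ := h4
  exact ⟨r, by omega⟩

end Core

namespace Wed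

lemma closed_singleton {X : Fin w.n} (hs : (w.st X).card = Fintype.card (Ch k A)) (χ : Ch k A) : w.act χ X = X := by
  have := (Finset.card_eq_iff_eq_univ _).1 hs
  exact w.mem_st.1 (this ▸ Finset.mem_univ χ)

lemma star_mem_nl {X : Fin w.n} (hX : X ∈ w.nl) : w.star d X ∈ w.nl := by
  rw [mem_nl, δ_star]
  exact w.mem_nl.1 hX

lemma sum_D_N_self (X : Fin w.n) : (w.st X).card * w.d0 + ∑ i ∈ w.nl, w.D i * w.N i X X = w.δ X * w.D X := by
  classical
  rw [← w.sum_D_N' X X]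
  congr 1
  rw [← Finset.sum_filter, Finset.sum_const, smul_eq_mul]
  congr 2
  ext χ
  simp [mem_st, eq_comm]

lemma exists_sum_D_N (j l : Fin w.n) : ∃ c, c * w.d0 + ∑ i ∈ w.nl, w.D i * w.N i j l = w.δ j * w.D l := by
  classical
  refine ⟨(Finset.univ.filter fun χ => l = w.act χ j).card, ?_⟩
  rw [← w.sum_D_N' j l]
  congr 1
  rw [← Finset.sum_filter, Finset.sum_const, smul_eq_mul]

lemma sum_D_N_i0 {j : Fin w.n} (hj : j ∈ w.nl) : ∑ i ∈ w.nl, w.D i * w.N i j w.i0 = w.δ j * w.d0 := by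
  have := w.sum_D_N' j w.i0
  rwa [Finset.sum_eq_zero, zero_add] at this
  intro χ _
  rw [if_neg]
  intro h
  have h1 := w.δ_act χ j
  rw [← h, i0, δ_idx] at h1
  exact w.mem_nl.1 hj h1.symm

variable {U : Fin w.n} (hE : NoSkew k A) (hU : w.δ U = 2) (hS : w.perm d.SS U = U)
include hE hU hS

lemma D_mul_y (h : ∀ i, w.δ i ≤ 2) : w.D U * w.y d U = 2 * w.d0 := by
  have := w.sum_T' d hE hU hS
  rwa [Finset.filter_false_of_mem, Finset.sum_empty, add_zero] at this
  intro i _ hi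
  have := h i
  omega

lemma exists_D_mul_y {W : Fin w.n} (hW : 3 ≤ w.δ W) (h : ∀ i, 3 ≤ w.δ i → i = W) :
    ∃ t, w.D U * w.y d U + w.D W * t = 2 * w.d0 := by
  have := w.sum_T' d hE hU hS
  rw [Finset.sum_eq_single W] at this
  · exact ⟨_, this⟩
  · intro i hi hiW
    exact absurd (h i (Finset.mem_filter.1 hi).2) hiW
  · intro hn
    refine absurd ?_ hn
    rw [Finset.mem_filter, mem_nl]
    omega

lemma D_eq_of_le_two (hn : Fintype.card (Ch k A) ≤ 2) (h : ∀ i, w.δ i ≤ 2) : w.D U = (w.st U).card * w.d0 := by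
  have h1 := w.D_mul_y d hE hU hS h
  have h2 := w.T_le_two d hE hU hS hn
  have h3 : (w.st U).card * w.y d U ≠ 1 := by
    intro h3
    obtain ⟨l, hl⟩ := w.T_three d hE hU hS h3
    have := h l
    omega
  have h4 : (w.st U).card * w.y d U = 2 := by
    have := Nat.mul_pos (w.one_le_card_st U) (w.one_le_y d U)
    omega
  refine Nat.eq_of_mul_eq_mul_right (w.one_le_y d U) ?_
  rw [h1, mul_right_comm, h4]

lemma d0_le_of_leftover (hs : w.star d U = U) (hN : w.N U (w.star d U) U ≠ 0) : (w.st U).card * w.d0 ≤ w.D U := by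
  have h1 := w.sum_D_N_self U
  rw [hs] at hN
  have hm : U ∈ w.nl := by rw [mem_nl]; omega
  have h2 := Finset.single_le_sum (f := fun i => w.D i * w.N i U U) (fun _ _ => Nat.zero_le _) hm
  have h3 := Nat.le_mul_of_pos_right (w.D U) (Nat.pos_of_ne_zero hN)
  rw [hU] at h1
  omega

end Wed

end

section

variable {k : Type} [Field k] [CharZero k] {A : Type} [Ring A] [HopfAlgebra k A] [FiniteDimensional k A]
  {w : Wed k A} {d : IntData k A}

namespace Core
open Wed

variable {M : ℕ} (h : Core w d M)
include h

/-- A set of simple representations closed under twisting by characters can be enlarged by an orbit until it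
exhausts the available dimension. -/
lemma exists_closed {S : Finset (Fin w.n)} (hS : S ⊆ w.nl) (hc : ∀ i ∈ S, ∀ χ, w.act χ i ∈ S)
    (he : Fintype.card (Ch k A) * w.d0 + ∑ i ∈ S, w.δ i * w.D i ≠ M) :
    ∃ i ∈ w.nl, i ∉ S ∧ ∃ S' ⊆ w.nl, (∀ i ∈ S', ∀ χ, w.act χ i ∈ S') ∧ S ⊆ S' ∧
      ∑ i ∈ S', w.δ i * w.D i = ∑ i ∈ S, w.δ i * w.D i + (w.orb i).card * (w.δ i * w.D i) := by
  obtain ⟨i, hi, hiS⟩ := h.exists_new he hS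
  refine ⟨i, hi, hiS, S ∪ w.orb i, ?_, ?_, Finset.subset_union_left, ?_⟩
  · refine Finset.union_subset hS fun j hj => ?_
    obtain ⟨χ, rfl⟩ := w.mem_orb.1 hj
    rw [mem_nl, δ_act]
    exact w.mem_nl.1 hi
  · intro j hj χ
    rcases Finset.mem_union.1 hj with hj | hj
    · exact Finset.mem_union_left _ (hc j hj χ)
    · obtain ⟨ψ, rfl⟩ := w.mem_orb.1 hj
      exact Finset.mem_union_right _ (w.mem_orb.2 ⟨χ * ψ, w.act_mul _ _ _⟩)
  · have hd : Disjoint S (w.orb i) := by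
      refine Finset.disjoint_right.2 fun j hj hjS => hiS ?_
      obtain ⟨χ, rfl⟩ := w.mem_orb.1 hj
      have := hc _ hjS χ⁻¹
      rwa [← act_mul, inv_mul_cancel, act_one] at this
    rw [Finset.sum_union hd, Finset.sum_congr rfl (s₁ := w.orb i) (g := fun _ => w.δ i * w.D i)]
    · simp
    · intro j hj
      obtain ⟨χ, rfl⟩ := w.mem_orb.1 hj
      rw [δ_act, D_act]

lemma orb_le {X : Fin w.n} (hX : X ∈ w.nl) :
    Fintype.card (Ch k A) * w.d0 + (w.orb X).card * (w.δ X * w.D X) ≤ M := by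
  simpa using h.new_le (S := ∅) (by simp) (by simp) hX (by simp)

lemma nonfixed_le₀ {X : Fin w.n} (hX : X ∈ w.nl) (hX' : w.perm d.SS X ≠ X) :
    Fintype.card (Ch k A) * w.d0 + 4 * (w.δ X * w.D X) ≤ M := by
  simpa using h.nonfixed_le (S := ∅) (by simp) (by simp) hX hX'

lemma nonfixed_le₁ {X U : Fin w.n} (hX : X ∈ w.nl) (hX' : w.perm d.SS X = X) (hU : U ∈ w.nl)
    (hU' : w.perm d.SS U ≠ U) :
    Fintype.card (Ch k A) * w.d0 + w.δ X * w.D X + 4 * (w.δ U * w.D U) ≤ M := by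
  simpa using h.nonfixed_le (S := {X}) (by simpa using hX) (by simpa using hX') hU hU'

lemma nonfixed_le₂ {X W U : Fin w.n} (hX : X ∈ w.nl) (hX' : w.perm d.SS X = X) (hW : W ∈ w.nl)
    (hW' : w.perm d.SS W = W) (hXW : X ≠ W) (hU : U ∈ w.nl) (hU' : w.perm d.SS U ≠ U) :
    Fintype.card (Ch k A) * w.d0 + (w.δ X * w.D X + w.δ W * w.D W) + 4 * (w.δ U * w.D U) ≤ M := by
  have := h.nonfixed_le (S := {X, W}) (Finset.insert_subset hX (by simpa using hW)) (by simp [hX', hW']) hU hU'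
  rwa [Finset.sum_pair hXW] at this

lemma pair_le {X U : Fin w.n} (hX : X ∈ w.nl) (hU : U ∈ w.nl) (hXU : X ≠ U) :
    Fintype.card (Ch k A) * w.d0 + (w.δ X * w.D X + w.δ U * w.D U) ≤ M := by
  have := h.budget (S := {X, U}) (Finset.insert_subset hX (by simpa using hU))
  rwa [Finset.sum_pair hXU] at this

/-- A simple representation fixed by all characters either exhausts the nonlinear representations or leaves room. -/
lemma single_or {X : Fin w.n} (hX : X ∈ w.nl) (hs : (w.st X).card = Fintype.card (Ch k A)) :
    (Fintype.card (Ch k A) * w.d0 + w.δ X * w.D X = M ∧ w.nl = {X}) ∨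
    ∃ U ∈ w.nl, U ≠ X ∧ Fintype.card (Ch k A) * w.d0 + w.δ X * w.D X + (w.orb U).card * (w.δ U * w.D U) ≤ M ∧
      Fintype.card (Ch k A) * w.d0 + w.δ X * w.D X + Fintype.card (Ch k A) * w.d0 ≤ M := by
  have hS : {X} ⊆ w.nl := by simpa using hX
  have hc : ∀ i ∈ ({X} : Finset (Fin w.n)), ∀ χ, w.act χ i ∈ ({X} : Finset (Fin w.n)) := by
    simpa using w.closed_singleton hs
  by_cases he : Fintype.card (Ch k A) * w.d0 + w.δ X * w.D X = M
  · exact Or.inl ⟨he, (h.eq_nl hS (by simpa using he)).symm⟩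
  · obtain ⟨U, hU, hUX⟩ := h.exists_new (by simpa using he) hS
    exact Or.inr ⟨U, hU, by simpa using hUX, by simpa using h.new_le hS hc hU hUX,
      by simpa using h.new_le' hS hc hU hUX⟩

lemma pair_or {X W : Fin w.n} (hX : X ∈ w.nl) (hs : (w.st X).card = Fintype.card (Ch k A)) (hW : W ∈ w.nl)
    (hs' : (w.st W).card = Fintype.card (Ch k A)) (hXW : X ≠ W) :
    (Fintype.card (Ch k A) * w.d0 + (w.δ X * w.D X + w.δ W * w.D W) = M ∧ w.nl = {X, W}) ∨
    ∃ U ∈ w.nl, U ≠ X ∧ U ≠ W ∧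
      Fintype.card (Ch k A) * w.d0 + (w.δ X * w.D X + w.δ W * w.D W) + (w.orb U).card * (w.δ U * w.D U) ≤ M ∧
      Fintype.card (Ch k A) * w.d0 + (w.δ X * w.D X + w.δ W * w.D W) + Fintype.card (Ch k A) * w.d0 ≤ M := by
  have hS : {X, W} ⊆ w.nl := Finset.insert_subset hX (by simpa using hW)
  have hc : ∀ i ∈ ({X, W} : Finset (Fin w.n)), ∀ χ, w.act χ i ∈ ({X, W} : Finset (Fin w.n)) := by
    simp [w.closed_singleton hs, w.closed_singleton hs']
  by_cases he : Fintype.card (Ch k A) * w.d0 + (w.δ X * w.D X + w.δ W * w.D W) = M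
  · exact Or.inl ⟨he, (h.eq_nl hS (by rwa [Finset.sum_pair hXW])).symm⟩
  · obtain ⟨U, hU, hUX⟩ := h.exists_new (by rwa [Finset.sum_pair hXW]) hS
    have h1 := h.new_le hS hc hU hUX
    have h2 := h.new_le' hS hc hU hUX
    rw [Finset.sum_pair hXW] at h1 h2
    simp only [Finset.mem_insert, Finset.mem_singleton, not_or] at hUX
    exact Or.inr ⟨U, hU, hUX.1, hUX.2, h1, h2⟩

lemma orb_or {X : Fin w.n} (hX : X ∈ w.nl) :
    Fintype.card (Ch k A) * w.d0 + (w.orb X).card * (w.δ X * w.D X) = M ∨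
      Fintype.card (Ch k A) * w.d0 + (w.orb X).card * (w.δ X * w.D X) + Fintype.card (Ch k A) * w.d0 ≤ M := by
  have hS : w.orb X ⊆ w.nl := by
    intro j hj
    obtain ⟨χ, rfl⟩ := w.mem_orb.1 hj
    rw [mem_nl, δ_act]
    exact w.mem_nl.1 hX
  have hc : ∀ i ∈ w.orb X, ∀ χ, w.act χ i ∈ w.orb X := by
    intro j hj χ
    obtain ⟨ψ, rfl⟩ := w.mem_orb.1 hj
    exact w.mem_orb.2 ⟨χ * ψ, w.act_mul _ _ _⟩
  have hsum : ∑ i ∈ w.orb X, w.δ i * w.D i = (w.orb X).card * (w.δ X * w.D X) := by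
    rw [Finset.sum_congr rfl (g := fun _ => w.δ X * w.D X)]
    · simp
    · intro j hj
      obtain ⟨χ, rfl⟩ := w.mem_orb.1 hj
      rw [δ_act, D_act]
  rw [← hsum]
  by_cases he : Fintype.card (Ch k A) * w.d0 + ∑ i ∈ w.orb X, w.δ i * w.D i = M
  · exact Or.inl he
  · obtain ⟨U, hU, hUX⟩ := h.exists_new he hS
    exact Or.inr (h.new_le' hS hc hU hUX)

section
variable (hM : M = 12 ∨ M = 20 ∨ M = 28 ∨ M = 44) {X : Fin w.n} (hX : 2 ≤ w.δ X) (hX' : 2 * w.δ X + (w.st X).card ≤ w.D X)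
  (hX0 : w.δ X + 2 ≤ w.d0)
include hM hX hX' hX0

lemma card_ne_four : Fintype.card (Ch k A) ≠ 4 := by
  intro hn
  have hXm : X ∈ w.nl := by rw [mem_nl]; omega
  have h1 := h.orb_le hXm
  have hos := w.card_st_mul_card_orb X
  obtain ⟨c, hc⟩ := h.even_d0
  have hs1 := w.one_le_card_st X
  have ho : 1 ≤ (w.orb X).card := Nat.pos_of_ne_zero fun h0 => by rw [h0] at hos; omega
  have hδ : w.δ X ≤ 3 := by
    by_contra! hδ
    have := Nat.mul_le_mul hδ (show 9 ≤ w.D X by omega)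
    have := Nat.mul_le_mul ho this
    rw [hn] at h1
    omega
  have ho4 : (w.orb X).card ≤ 4 := by nlinarith
  have hs4 : (w.st X).card ≤ 4 := by nlinarith
  rw [hn] at h1 hos
  have hfix : w.perm d.SS X = X := by
    by_contra hfix
    have h2 := h.nonfixed_le₀ hXm hfix
    rw [hn] at h2
    have := Nat.mul_le_mul hX (show 5 ≤ w.D X by omega)
    obtain h3 | h3 : w.D X ≤ 5 ∨ 6 ≤ w.D X := by omega
    · have h5 : (w.st X).card = 1 := by omega
      rw [h5] at hos
      rw [show (w.orb X).card = 4 by omega] at h1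
      omega
    · have := Nat.mul_le_mul hX h3
      omega
  have hev := h.even_D X hfix
  obtain ⟨e, he⟩ := hev
  have h2 : w.δ X = 2 := by
    by_contra h2
    have h2 : w.δ X = 3 := by omega
    rw [h2] at h1
    interval_cases (w.orb X).card <;> omega
  rw [h2] at h1
  have h3 : (w.st X).card = 4 := by
    interval_cases hh : (w.orb X).card
    · omega
    · have : (w.st X).card = 2 := by omega
      have h4 := h.orb_or hXm
      rw [hn, hh, h2] at h4
      omega
    · omega
    · omega
  have hmul := fun hnl : w.nl = {X} => w.D_mul_y d h.noSkew h2 hfix (fun i => by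
    by_contra! hi
    have : i ∈ w.nl := by rw [mem_nl]; omega
    rw [hnl, Finset.mem_singleton] at this
    rw [this] at hi
    omega)
  have hcard : (w.orb X).card = 1 := by rw [h3] at hos; omega
  rw [hcard] at h1
  rcases h.single_or hXm (by rw [h3, hn]) with ⟨h4, h5⟩ | ⟨U, -, -, -, h4⟩
  · have := hmul h5
    have hy := w.one_le_y d X
    rw [hn, h2] at h4
    have : w.y d X ≤ 2 := by
      by_contra! hy3
      have := Nat.mul_le_mul (show 8 ≤ w.D X by omega) (show 3 ≤ w.y d X from hy3)
      omega
    generalize w.y d X = y at *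
    interval_cases y <;> omega
  · rw [hn, h2] at h4
    omega

end
end Core

end

section

variable {k : Type} [Field k] [CharZero k] {A : Type} [Ring A] [HopfAlgebra k A] [FiniteDimensional k A]
  {w : Wed k A} {d : IntData k A}

namespace Wed

lemma card_st_eq_one {X : Fin w.n} (hn : Fintype.card (Ch k A) = 1) : (w.st X).card = 1 :=
  le_antisymm ((Finset.card_le_univ _).trans hn.le) (w.one_le_card_st X)

lemma card_orb_eq_one {X : Fin w.n} (hn : Fintype.card (Ch k A) = 1) : (w.orb X).card = 1 := by
  have := w.card_st_mul_card_orb X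
  rwa [w.card_st_eq_one hn, mul_one, hn] at this

lemma card_st_orb_two (hn : Fintype.card (Ch k A) = 2) (X : Fin w.n) :
    (w.st X).card = 1 ∧ (w.orb X).card = 2 ∨ (w.st X).card = 2 ∧ (w.orb X).card = 1 := by
  have h1 := w.card_st_mul_card_orb X
  have h2 := w.one_le_card_st X
  have h3 : (w.st X).card ≤ 2 := (Finset.card_le_univ _).trans hn.le
  rw [hn] at h1
  interval_cases (w.st X).card <;> omega

end Wed

namespace Core
open Wed

variable {M : ℕ} (h : Core w d M)
include h

variable (hM : M = 12 ∨ M = 20 ∨ M = 28 ∨ M = 44) {X : Fin w.n} (hX : 2 ≤ w.δ X)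
  (hX' : 2 * w.δ X + (w.st X).card ≤ w.D X) (hX0 : w.δ X + 2 ≤ w.d0)
include hM hX hX' hX0

lemma exists_three_of_one (hn : Fintype.card (Ch k A) = 1) : ∃ W, 3 ≤ w.δ W := by
  by_contra! h3
  have h2 : ∀ i, w.δ i ≤ 2 := fun i => Nat.le_of_lt_succ (h3 i)
  have hδ : w.δ X = 2 := le_antisymm (h2 X) hX
  have hXm : X ∈ w.nl := by rw [mem_nl]; omega
  rw [hδ, w.card_st_eq_one hn] at hX'
  obtain ⟨c, hc⟩ := h.even_d0
  by_cases hfix : w.perm d.SS X = X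
  · have hD := w.D_eq_of_le_two d h.noSkew hδ hfix (by omega) h2
    rw [w.card_st_eq_one hn, one_mul] at hD
    have hall : ∀ i ∈ w.nl, w.δ i * w.D i = 2 * w.d0 := by
      intro i hi
      have hi2 : w.δ i = 2 := le_antisymm (h2 i) (w.two_le_of_mem_nl hi)
      by_cases hif : w.perm d.SS i = i
      · have hDi := w.D_eq_of_le_two d h.noSkew hi2 hif (by omega) h2
        rw [w.card_st_eq_one hn, one_mul] at hDi
        rw [hi2, hDi]
      · exfalso
        have h4 := h.nonfixed_le₁ hXm hfix hi hif
        have h5 := w.card_st_mul_le i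
        have h6 := w.D_eq_or_le d i
        rw [w.card_st_eq_one hn] at h5
        rw [hn, hδ, hi2] at h4
        rw [hi2] at h5 h6
        omega
    have hs := w.sum_nl
    rw [h.finrank_eq, hn, Finset.sum_congr rfl hall, Finset.sum_const, smul_eq_mul] at hs
    have hc1 : 1 ≤ w.nl.card := Finset.card_pos.2 ⟨X, hXm⟩
    generalize w.nl.card = j at *
    have hj : j ≤ 3 := by
      by_contra! hj
      have := Nat.mul_le_mul hj (show 10 ≤ 2 * w.d0 by omega)
      have : w.d0 = 6 ∨ w.d0 ≥ 8 := by omega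
      have := Nat.mul_le_mul_right (2 * w.d0) hj
      omega
    interval_cases j <;> omega
  · have h1 := h.nonfixed_le₀ hXm hfix
    have h4 : w.D X = 5 := by rw [hn, hδ] at h1; omega
    obtain ⟨s, hs4, hXs, hs⟩ := w.exists_four d h.pow_eight hfix
    have hsub : s ⊆ w.nl := fun j hj => by
      rw [mem_nl, (hs j hj).1]
      omega
    have hnl : s = w.nl := by
      refine h.eq_nl hsub ?_
      rw [Finset.sum_congr rfl (g := fun _ => 10)]
      · rw [hn, hδ, h4] at h1
        rw [hn, Finset.sum_const, hs4, smul_eq_mul]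
        omega
      · intro j hj
        rw [(hs j hj).1, (hs j hj).2.1, hδ, h4]
    have h5 := w.sum_D_N_i0 hXm
    rw [← hnl, Finset.sum_congr rfl (g := fun i => 5 * w.N i X w.i0), ← Finset.mul_sum] at h5
    · rw [hn, hδ, h4] at h1
      rw [hδ] at h5
      omega
    · intro j hj
      rw [(hs j hj).2.1, h4]

lemma exists_three_of_two (hn : Fintype.card (Ch k A) = 2) : ∃ W, 3 ≤ w.δ W := by
  by_contra! h3
  have h2 : ∀ i, w.δ i ≤ 2 := fun i => Nat.le_of_lt_succ (h3 i)
  have hδ : w.δ X = 2 := le_antisymm (h2 X) hX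
  have hXm : X ∈ w.nl := by rw [mem_nl]; omega
  rw [hδ] at hX'
  obtain ⟨c, hc⟩ := h.even_d0
  have hs1 := w.one_le_card_st X
  have hfix : w.perm d.SS X = X := by
    by_contra hfix
    have h1 := h.nonfixed_le₀ hXm hfix
    rw [hδ, hn] at h1
    omega
  have hD := w.D_eq_of_le_two d h.noSkew hδ hfix (by omega) h2
  have horb := h.orb_or hXm
  rcases w.card_st_orb_two hn X with ⟨h4, h5⟩ | ⟨h4, h5⟩
  · rw [h4] at hD hX'
    rw [h5, hδ, hn] at horb
    omega
  · rw [h4] at hD hX'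
    rw [h5, hδ, hn] at horb
    have h6 : w.d0 = 4 ∧ M = 44 := by omega
    have hV : ∀ V ∈ w.nl, V ≠ X → (w.orb V).card * (w.δ V * w.D V) = 8 ∨
        (w.orb V).card * (w.δ V * w.D V) = 16 := by
      intro V hV hVX
      have hV2 : w.δ V = 2 := le_antisymm (h2 V) (w.two_le_of_mem_nl hV)
      rw [hV2]
      by_cases hVf : w.perm d.SS V = V
      · have hDV := w.D_eq_of_le_two d h.noSkew hV2 hVf (by omega) h2
        rcases w.card_st_orb_two hn V with ⟨h7, h8⟩ | ⟨h7, h8⟩ <;> rw [h7] at hDV <;> rw [h8] <;> omega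
      · have h9 := h.nonfixed_le₁ hXm hfix hV hVf
        have h10 := w.card_st_mul_le V
        rw [hV2] at h9 h10
        rw [hδ, hn] at h9
        rcases w.card_st_orb_two hn V with ⟨h7, h8⟩ | ⟨h7, h8⟩ <;> rw [h7] at h10 <;> rw [h8] <;> omega
    have hS : ({X} : Finset (Fin w.n)) ⊆ w.nl := by simpa using hXm
    have hc0 : ∀ i ∈ ({X} : Finset (Fin w.n)), ∀ χ, w.act χ i ∈ ({X} : Finset (Fin w.n)) := by
      simpa using w.closed_singleton (h4.trans hn.symm)
    have he0 : ∑ i ∈ ({X} : Finset (Fin w.n)), w.δ i * w.D i = 16 := by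
      rw [Finset.sum_singleton, hδ]
      omega
    obtain ⟨V₁, hV₁, hV₁', S₁, hS₁, hc₁, hsub₁, he₁⟩ := h.exists_closed hS hc0 (by rw [hn]; omega)
    have hW₁ := hV V₁ hV₁ (by simpa using hV₁')
    obtain ⟨V₂, hV₂, hV₂', S₂, hS₂, hc₂, hsub₂, he₂⟩ := h.exists_closed hS₁ hc₁ (by rw [hn]; omega)
    have hW₂ := hV V₂ hV₂ (fun hh => hV₂' (hsub₁ (by simp [hh])))
    obtain ⟨V₃, hV₃, hV₃', S₃, hS₃, hc₃, hsub₃, he₃⟩ := h.exists_closed hS₂ hc₂ (by rw [hn]; omega)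
    have hW₃ := hV V₃ hV₃ (fun hh => hV₃' (hsub₂ (hsub₁ (by simp [hh]))))
    have hb := h.budget hS₃
    rw [hn] at hb
    omega

end Core

end

section

variable {k : Type} [Field k] [CharZero k] {A : Type} [Ring A] [HopfAlgebra k A] [FiniteDimensional k A]
  {w : Wed k A} {d : IntData k A}

namespace Core
open Wed

variable {M : ℕ} (h : Core w d M)
include h

/-- The multiplicity equation for a two-dimensional `X` when its only possible companion in `nl` is `W`. -/
lemma leftover {X W : Fin w.n} (hδ : w.δ X = 2) (hfix : w.perm d.SS X = X) (hW : 3 ≤ w.δ W) (hnl : w.nl = {X, W})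
    (hy : (w.st X).card * w.y d X = 2) : (w.st X).card * w.d0 ≤ w.D X := by
  have hmem : ∀ l, w.δ l = 2 → l = X := by
    intro l hl
    have : l ∈ w.nl := by rw [mem_nl]; omega
    rw [hnl, Finset.mem_insert, Finset.mem_singleton] at this
    refine this.resolve_right fun hlW => ?_
    rw [hlW] at hl
    omega
  obtain ⟨l, hl, hN⟩ := w.T_two d h.noSkew hδ hfix hy
  rw [hmem l hl] at hN
  exact w.d0_le_of_leftover d h.noSkew hδ hfix (hmem _ ((w.δ_star d X).trans hδ)) (by omega)

variable (hM : M = 12 ∨ M = 20 ∨ M = 28 ∨ M = 44) {X : Fin w.n}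
  (hX' : 2 * w.δ X + (w.st X).card ≤ w.D X) (hX0 : w.δ X + 2 ≤ w.d0)
include hM hX' hX0

lemma δ_lt_three_of_two (hn : Fintype.card (Ch k A) = 2) : w.δ X < 3 := by
  by_contra! h3
  have hXm : X ∈ w.nl := by rw [mem_nl]; omega
  obtain ⟨c, hc⟩ := h.even_d0
  have h1 := h.orb_le hXm
  have hs1 := w.one_le_card_st X
  have h2 := Nat.mul_le_mul h3 (show 7 ≤ w.D X by omega)
  rcases w.card_st_orb_two hn X with ⟨h4, h5⟩ | ⟨h4, h5⟩
  · rw [h5, hn] at h1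
    omega
  · rw [h4] at hX'
    rw [h5, hn] at h1
    have hδ : w.δ X = 3 := by
      by_contra hδ
      have := Nat.mul_le_mul (show 4 ≤ w.δ X by omega) (show 10 ≤ w.D X by omega)
      omega
    have hfix : w.perm d.SS X = X := by
      by_contra hfix
      have := h.nonfixed_le₀ hXm hfix
      rw [hδ, hn] at this
      omega
    obtain ⟨e, he⟩ := h.even_D X hfix
    rcases h.single_or hXm (h4.trans hn.symm) with ⟨h6, h7⟩ | ⟨U, -, -, -, h6⟩
    · have h8 := w.sum_D_N_i0 hXm
      rw [hδ, hn] at h6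
      rw [h7, Finset.sum_singleton, hδ, show w.d0 = 10 by omega, show w.D X = 8 by omega] at h8
      omega
    · rw [hδ, hn] at h6
      omega

lemma card_ne_two (hX : 2 ≤ w.δ X) : Fintype.card (Ch k A) ≠ 2 := by
  intro hn
  have hδ : w.δ X = 2 := by
    have := h.δ_lt_three_of_two hM hX' hX0 hn
    omega
  obtain ⟨W, hW⟩ := h.exists_three_of_two hM hX hX' hX0 hn
  have hXm : X ∈ w.nl := by rw [mem_nl]; omega
  have hWm : W ∈ w.nl := by rw [mem_nl]; omega
  have hXW : X ≠ W := by
    rintro rfl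
    omega
  rw [hδ] at hX' hX0
  obtain ⟨c, hc⟩ := h.even_d0
  have hs1 := w.one_le_card_st X
  have hfix : w.perm d.SS X = X := by
    by_contra hfix
    have h1 := h.nonfixed_le₀ hXm hfix
    rw [hδ, hn] at h1
    omega
  obtain ⟨e, he⟩ := h.even_D X hfix
  have hDW := w.D_eq_or_le d W
  have hWW : 9 ≤ w.δ W * w.D W := Nat.mul_le_mul hW (show 3 ≤ w.D W by omega)
  have hWfix : w.perm d.SS W = W := by
    by_contra hWfix
    have := h.nonfixed_le₁ hXm hfix hWm hWfix
    rw [hδ, hn] at this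
    omega
  obtain ⟨f, hf⟩ := h.even_D W hWfix
  have hW12 : 16 ≤ w.δ W * w.D W := by
    rcases hDW with h1 | h1
    · exact Nat.mul_le_mul (show 4 ≤ w.δ W by omega) (show 4 ≤ w.D W by omega)
    · exact (by norm_num : 16 ≤ 3 * 6).trans (Nat.mul_le_mul hW (by omega))
  have hpair := h.pair_le hXm hWm hXW
  rw [hn, hδ] at hpair
  obtain rfl : M = 44 := by clear hDW; omega
  clear hM
  rcases w.card_st_orb_two hn X with ⟨h4, h5⟩ | ⟨h4, h5⟩
  · have h6 := h.orb_or hXm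
    have hWX : W ∉ w.orb X := by
      rintro hWX
      obtain ⟨χ, rfl⟩ := w.mem_orb.1 hWX
      rw [δ_act] at hW
      omega
    have hS : w.orb X ⊆ w.nl := fun j hj => by
      obtain ⟨χ, rfl⟩ := w.mem_orb.1 hj
      rw [mem_nl, δ_act]
      omega
    have hb := h.budget (Finset.insert_subset hWm hS)
    rw [Finset.sum_insert hWX, Finset.sum_congr rfl (s₁ := w.orb X) (g := fun _ => 2 * w.D X), Finset.sum_const,
      h5, smul_eq_mul, hn] at hb
    · omega
    · intro j hj
      obtain ⟨χ, rfl⟩ := w.mem_orb.1 hj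
      rw [δ_act, D_act, hδ]
  · rw [h4] at hX'
    have hy : w.y d X = 1 := by
      have h6 := w.T_le_two d h.noSkew hδ hfix hn.le
      have := w.one_le_y d X
      rw [h4] at h6
      omega
    have horbW : (w.st W).card = 2 ∧ (w.orb W).card = 1 := by
      refine (w.card_st_orb_two hn W).resolve_left fun h6 => ?_
      rcases h.single_or hXm (h4.trans hn.symm) with ⟨-, h7⟩ | -
      · rw [h7, Finset.mem_singleton] at hWm
        exact hXW hWm.symm
      · have h7 := h.new_le (S := {X}) (by simpa using hXm) (by simpa using w.closed_singleton (h4.trans hn.symm)) hWm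
          (by simpa using hXW.symm)
        rw [h6.2, hn, Finset.sum_singleton, hδ] at h7
        omega
    have huniq : ∀ V, 3 ≤ w.δ V → V = W := by
      intro V hV
      by_contra hVW
      have hVm : V ∈ w.nl := by rw [mem_nl]; omega
      have hVX : V ≠ X := by
        rintro rfl
        omega
      have hb := h.budget (S := {V, X, W}) (Finset.insert_subset hVm (Finset.insert_subset hXm (by simpa using hWm)))
      rw [Finset.sum_insert (by simp [hVW, hVX]), Finset.sum_pair hXW, hn, hδ] at hb
      have := w.D_eq_or_le d V
      have := Nat.mul_le_mul hV (show 3 ≤ w.D V by omega)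
      omega
    obtain ⟨t, ht⟩ := w.exists_D_mul_y d h.noSkew hδ hfix hW huniq
    rw [hy] at ht
    have hor := h.pair_or hXm (h4.trans hn.symm) hWm (horbW.1.trans hn.symm) hXW
    have hδW : w.δ W ≤ 4 := by
      by_contra! h6
      have := Nat.mul_le_mul h6 (show 5 ≤ w.D W by omega)
      omega
    have hcase : w.δ W = 3 ∧ (w.D W = 6 ∨ w.D W = 8) ∨ w.δ W = 4 ∧ w.D W = 4 := by
      obtain h6 | h6 : w.δ W = 3 ∨ w.δ W = 4 := by omega
      all_goals rw [h6] at hpair hDW; clear hor hWW hW12; omega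
    have hkill : w.nl = {X, W} → 2 * w.d0 ≤ w.D X := fun hnl => by
      have := h.leftover hδ hfix hW hnl (by rw [h4, hy])
      rwa [h4] at this
    rw [hn, hδ] at hor
    clear hDW hW12 hWW hpair
    rcases hcase with ⟨h6, h7 | h7⟩ | ⟨h6, h7⟩
    all_goals
      rw [h6, h7] at hor
      rw [h7] at ht
      rcases hor with ⟨h8, h9⟩ | ⟨-, -, -, -, -, h8⟩
    · omega
    · omega
    · omega
    · omega
    · have := hkill h9
      omega
    · omega

end Core

end

section

variable {k : Type} [Field k] [CharZero k] {A : Type} [Ring A] [HopfAlgebra k A] [FiniteDimensional k A]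
  {w : Wed k A} {d : IntData k A}

namespace Core
open Wed

variable {M : ℕ} (h : Core w d M)
include h

variable (hM : M = 12 ∨ M = 20 ∨ M = 28 ∨ M = 44) {X : Fin w.n} (hX : 2 ≤ w.δ X)
  (hX' : 2 * w.δ X + (w.st X).card ≤ w.D X) (hX0 : w.δ X + 2 ≤ w.d0)
include hM hX hX' hX0

lemma δ_lt_three_of_one (hn : Fintype.card (Ch k A) = 1) : w.δ X < 3 := by
  by_contra! h3
  have hst : ∀ i : Fin w.n, (w.st i).card = 1 := fun i => w.card_st_eq_one hn
  have hXm : X ∈ w.nl := by rw [mem_nl]; omega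
  obtain ⟨c, hc⟩ := h.even_d0
  rw [hst] at hX'
  have h1 := h.budget (S := {X}) (by simpa using hXm)
  rw [Finset.sum_singleton, hn] at h1
  have h2 := Nat.mul_le_mul h3 (show 7 ≤ w.D X by omega)
  have hfix : w.perm d.SS X = X := by
    by_contra hfix
    have := h.nonfixed_le₀ hXm hfix
    omega
  obtain ⟨e, he⟩ := h.even_D X hfix
  have hδ : w.δ X = 3 := by
    by_contra hδ
    have := Nat.mul_le_mul (show 4 ≤ w.δ X by omega) (show 10 ≤ w.D X by omega)
    omega
  rw [hδ] at h1 hX' hX0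
  obtain rfl : M = 44 := by omega
  clear hM
  have hU : ∀ U ∈ w.nl, U ≠ X → w.δ U = 2 ∧ w.perm d.SS U = U ∧ Even (w.D U) ∧ w.d0 ≤ 2 * w.D U := by
    intro U hU hUX
    have h4 := w.card_st_mul_le U
    rw [hst] at h4
    have hUf : w.perm d.SS U = U := by
      by_contra hUf
      have := h.nonfixed_le₁ hXm hfix hU hUf
      rw [hδ, hn] at this
      omega
    have hev := h.even_D U hUf
    obtain ⟨f, hf⟩ := hev
    have hp := h.pair_le hXm hU hUX.symm
    rw [hδ, hn] at hp
    have hU2 : w.δ U = 2 := by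
      by_contra hU2
      have h5 : 3 ≤ w.δ U := by
        have := w.two_le_of_mem_nl hU
        omega
      have : 16 ≤ w.δ U * w.D U := by
        rcases w.D_eq_or_le d U with h6 | h6
        · exact Nat.mul_le_mul (show 4 ≤ w.δ U by omega) (show 4 ≤ w.D U by omega)
        · exact (by norm_num : 16 ≤ 3 * 6).trans (Nat.mul_le_mul h5 (by omega))
      omega
    rw [hU2] at h4
    exact ⟨hU2, hUf, ⟨f, hf⟩, by omega⟩
  obtain ⟨r, hr⟩ := h.dvd_four (S := {X}) (by simpa using hXm) fun i hi hiS =>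
    ⟨(hU i hi (by simpa using hiS)).1, (hU i hi (by simpa using hiS)).2.2.1⟩
  rw [Finset.sum_singleton, hδ, hn] at hr
  rcases h.single_or hXm ((hst X).trans hn.symm) with ⟨h4, h5⟩ | ⟨U, hUm, hUX, h4, -⟩
  · have h6 := w.sum_D_N_self X
    rw [h5, Finset.sum_singleton, hst, hδ] at h6
    rw [hδ, hn] at h4
    have h7 : w.N X X X ≤ 2 := by
      by_contra! h7
      have := Nat.mul_le_mul_left (w.D X) (show 3 ≤ w.N X X X from h7)
      omega
    generalize w.N X X X = a at *
    interval_cases a <;> omega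
  · obtain ⟨hU2, hUf, ⟨f, hf⟩, hdU⟩ := hU U hUm hUX
    obtain ⟨t, ht⟩ := w.exists_D_mul_y d h.noSkew hU2 hUf h3 (fun i hi => by
      by_contra hiX
      have := (hU i (by rw [mem_nl]; omega) hiX).1
      omega)
    have hy1 := w.one_le_y d U
    have hy2 := w.T_le_two d h.noSkew hU2 hUf (by omega)
    rw [hst] at hy2
    have hor := h.pair_or hXm ((hst X).trans hn.symm) hUm ((hst U).trans hn.symm) hUX.symm
    rw [w.card_orb_eq_one hn, hδ, hU2, hn] at h4
    rw [hδ, hU2, hn] at hor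
    have hor' : w.d0 + 3 * w.D X + 2 * w.D U = 44 ∨ w.d0 + 3 * w.D X + 2 * w.D U + w.d0 ≤ 44 := by
      rcases hor with ⟨hh, -⟩ | ⟨-, -, -, -, -, hh⟩
      · left; omega
      · right; omega
    clear hor
    have hcase : w.d0 = 6 ∧ w.D X = 10 ∧ w.D U = 4 ∨ w.d0 = 8 ∧ w.D X = 8 ∧ w.D U = 6 := by
      have h10 : e = 4 ∨ e = 5 := by omega
      rcases h10 with rfl | rfl <;> omega
    clear hor'
    generalize w.y d U = y at *
    rcases hcase with ⟨h7, h8, h9⟩ | ⟨h7, h8, h9⟩ <;> rw [h7, h8, h9] at ht <;> omega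

lemma card_ne_one : Fintype.card (Ch k A) ≠ 1 := by
  intro hn
  have hst : ∀ i : Fin w.n, (w.st i).card = 1 := fun i => w.card_st_eq_one hn
  have hδ : w.δ X = 2 := by
    have := h.δ_lt_three_of_one hM hX hX' hX0 hn
    omega
  obtain ⟨W, hW⟩ := h.exists_three_of_one hM hX hX' hX0 hn
  have hXm : X ∈ w.nl := by rw [mem_nl]; omega
  have hWm : W ∈ w.nl := by rw [mem_nl]; omega
  have hXW : X ≠ W := by
    rintro rfl
    omega
  rw [hδ, hst] at hX'
  rw [hδ] at hX0
  obtain ⟨c, hc⟩ := h.even_d0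
  have hW9 : 9 ≤ w.δ W * w.D W := by
    have := w.D_eq_or_le d W
    exact Nat.mul_le_mul hW (show 3 ≤ w.D W by omega)
  have hfix : w.perm d.SS X = X := by
    by_contra hfix
    obtain ⟨s, hs4, hXs, hs⟩ := w.exists_four d h.pow_eight hfix
    have hsub : insert W s ⊆ w.nl := Finset.insert_subset hWm fun j hj => by
      rw [mem_nl, (hs j hj).1]
      omega
    have hb := h.budget hsub
    rw [Finset.sum_insert fun hWs => by rw [(hs W hWs).1] at hW; omega,
      Finset.sum_congr rfl (s₁ := s) (g := fun _ => 2 * w.D X), Finset.sum_const, hs4, hn, smul_eq_mul] at hb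
    · omega
    · intro j hj
      rw [(hs j hj).1, (hs j hj).2.1, hδ]
  obtain ⟨e, he⟩ := h.even_D X hfix
  have hbig : ∀ V, 3 ≤ w.δ V → w.perm d.SS V = V ∧ 16 ≤ w.δ V * w.D V := by
    intro V hV
    have hVm : V ∈ w.nl := by rw [mem_nl]; omega
    have hDV := w.D_eq_or_le d V
    have hV9 : 9 ≤ w.δ V * w.D V := Nat.mul_le_mul hV (show 3 ≤ w.D V by omega)
    have hVf : w.perm d.SS V = V := by
      by_contra hVf
      have := h.nonfixed_le₁ hXm hfix hVm hVf
      rw [hδ, hn] at this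
      omega
    refine ⟨hVf, ?_⟩
    obtain ⟨f, hf⟩ := h.even_D V hVf
    rcases hDV with h6 | h6
    · exact Nat.mul_le_mul (show 4 ≤ w.δ V by omega) (show 4 ≤ w.D V by omega)
    · exact (by norm_num : 16 ≤ 3 * 6).trans (Nat.mul_le_mul hV (by omega))
  obtain ⟨hWf, hW16⟩ := hbig W hW
  obtain ⟨f, hf⟩ := h.even_D W hWf
  have hpair := h.pair_le hXm hWm hXW
  rw [hδ, hn] at hpair
  obtain rfl : M = 44 := by omega
  clear hM
  have huniq : ∀ V, 3 ≤ w.δ V → V = W := by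
    intro V hV
    by_contra hVW
    have hVX : V ≠ X := by
      rintro rfl
      omega
    have hb := h.budget (S := {V, X, W}) (Finset.insert_subset (by rw [mem_nl]; omega)
      (Finset.insert_subset hXm (by simpa using hWm)))
    rw [Finset.sum_insert (by simp [hVW, hVX]), Finset.sum_pair hXW, hn, hδ] at hb
    have := (hbig V hV).2
    omega
  have hU : ∀ U ∈ w.nl, U ≠ X → U ≠ W → w.δ U = 2 ∧ w.perm d.SS U = U ∧ Even (w.D U) ∧ w.d0 ≤ 2 * w.D U := by
    intro U hU hUX hUW
    have hU2 : w.δ U = 2 := by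
      by_contra hU2
      have := w.two_le_of_mem_nl hU
      exact hUW (huniq U (by omega))
    have h4 := w.card_st_mul_le U
    rw [hst, hU2] at h4
    have hUf : w.perm d.SS U = U := by
      by_contra hUf
      have := h.nonfixed_le₂ hXm hfix hWm hWf hXW hU hUf
      rw [hδ, hn, hU2] at this
      omega
    exact ⟨hU2, hUf, h.even_D U hUf, by omega⟩
  have hsub : {X, W} ⊆ w.nl := Finset.insert_subset hXm (by simpa using hWm)
  obtain ⟨r, hr⟩ := h.dvd_four hsub fun i hi hiS => by
    simp only [Finset.mem_insert, Finset.mem_singleton, not_or] at hiS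
    exact ⟨(hU i hi hiS.1 hiS.2).1, (hU i hi hiS.1 hiS.2).2.2.1⟩
  rw [Finset.sum_pair hXW, hδ, hn] at hr
  have hy1 := w.one_le_y d X
  have hy2 := w.T_le_two d h.noSkew hδ hfix (by omega)
  rw [hst, one_mul] at hy2
  obtain ⟨t, ht⟩ := w.exists_D_mul_y d h.noSkew hδ hfix hW huniq
  have hδW : w.δ W ≤ 4 := by
    by_contra! h6
    have hD6 : 6 ≤ w.D W := by
      have := w.D_eq_or_le d W
      omega
    have := Nat.mul_le_mul h6 hD6
    omega
  have hcase : w.δ W = 3 ∧ (w.D W = 6 ∨ w.D W = 8) ∨ w.δ W = 4 ∧ w.D W = 4 := by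
    have hDW := w.D_eq_or_le d W
    clear hr ht
    obtain h6 | h6 : w.δ W = 3 ∨ w.δ W = 4 := by omega
    all_goals
      rw [h6] at hpair hDW
      omega
  have hstar : w.nl = {X, W} → w.star d X = X := fun hnl => by
    have h1 := w.star_mem_nl d hXm
    rw [hnl, Finset.mem_insert, Finset.mem_singleton] at h1
    refine h1.resolve_right fun h2 => ?_
    have := w.δ_star d X
    rw [h2] at this
    omega
  have hor : (w.d0 + (2 * w.D X + w.δ W * w.D W) = 44 ∧ w.nl = {X, W}) ∨
      ∃ U ∈ w.nl, U ≠ X ∧ U ≠ W ∧ w.d0 + (2 * w.D X + w.δ W * w.D W) + 2 * w.D U ≤ 44 := by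
    rcases h.pair_or hXm ((hst X).trans hn.symm) hWm ((hst W).trans hn.symm) hXW with ⟨h4, h5⟩ |
      ⟨U, hUm, hUX, hUW, h4, -⟩
    · rw [hδ, hn, one_mul] at h4
      exact Or.inl ⟨h4, h5⟩
    · rw [hδ, hn, (hU U hUm hUX hUW).1, w.card_orb_eq_one hn, one_mul, one_mul] at h4
      exact Or.inr ⟨U, hUm, hUX, hUW, h4⟩
  clear hW16 hW9 hpair hbig
  rcases hcase with ⟨h6, h7 | h7⟩ | ⟨h6, h7⟩ <;> rw [h6, h7] at hor hr <;> rw [h7] at ht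
  · rcases hor with ⟨h8, hnl⟩ | ⟨U, hUm, hUX, hUW, h8⟩
    · have hcase : w.d0 = 6 ∧ w.D X = 10 ∨ w.d0 = 10 ∧ w.D X = 8 ∨ w.d0 = 14 ∧ w.D X = 6 := by omega
      have hy : w.d0 = 10 ∧ w.D X = 8 ∧ w.y d X = 1 := by
        generalize w.y d X = y at *
        rcases hcase with ⟨h9, h10⟩ | ⟨h9, h10⟩ | ⟨h9, h10⟩ <;> rw [h9, h10] at ht <;> omega
      obtain ⟨h9, h10, h11⟩ := hy
      have hT := w.sum_T d h.noSkew hδ hfix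
      have h12 := w.sum_D_N_self X
      obtain ⟨c', h13⟩ := w.exists_sum_D_N X W
      rw [hstar hnl, hnl, Finset.sum_pair hXW, h11, hst, hδ, h6] at hT
      rw [hnl, Finset.sum_pair hXW, h9, h10, h7, hst, hδ] at h12
      rw [hnl, Finset.sum_pair hXW, h9, h10, h7, hδ] at h13
      omega
    · obtain ⟨hU2, hUf, ⟨f, hf⟩, hdU⟩ := hU U hUm hUX hUW
      obtain ⟨t', ht'⟩ := w.exists_D_mul_y d h.noSkew hU2 hUf hW huniq
      have hz1 := w.one_le_y d U
      have hz2 := w.T_le_two d h.noSkew hU2 hUf (by omega)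
      rw [hst, one_mul] at hz2
      generalize w.y d U = z at *
      have h9 : w.d0 = 6 ∧ w.D U = 4 := by omega
      rw [h9.1, h9.2, h7] at ht'
      omega
  · rcases hor with ⟨h8, hnl⟩ | ⟨U, hUm, hUX, hUW, h8⟩
    · have hcase : w.d0 = 4 ∧ w.D X = 8 ∨ w.d0 = 8 ∧ w.D X = 6 := by omega
      rcases hcase with ⟨h9, h10⟩ | ⟨h9, h10⟩
      · have h12 := w.sum_D_N_self X
        rw [hnl, Finset.sum_pair hXW, h9, h10, h7, hst, hδ] at h12
        omega
      · rw [h9, h10] at ht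
        omega
    · obtain ⟨hU2, hUf, ⟨f, hf⟩, hdU⟩ := hU U hUm hUX hUW
      have h9 : w.d0 = 4 ∧ w.D X = 6 := by omega
      rw [h9.1, h9.2] at ht
      omega
  · have hy : w.y d X = 2 := by
      by_contra hy
      obtain ⟨l, hl⟩ := w.T_three d h.noSkew hδ hfix (by rw [hst]; omega)
      rw [huniq l (by omega)] at hl
      omega
    rw [hy] at ht
    rcases hor with ⟨h8, hnl⟩ | ⟨U, hUm, hUX, hUW, h8⟩
    · have := h.leftover hδ hfix hW hnl (by rw [hst, hy])
      rw [hst] at this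
      omega
    · obtain ⟨hU2, hUf, ⟨f, hf⟩, hdU⟩ := hU U hUm hUX hUW
      have h9 : w.d0 = 8 ∧ w.D X = 6 ∧ w.D U = 4 := by omega
      obtain ⟨h9, h10, h11⟩ := h9
      have hUXW : U ∉ ({X, W} : Finset (Fin w.n)) := by simp [hUX, hUW]
      have hnl : insert U {X, W} = w.nl := by
        refine h.eq_nl (Finset.insert_subset hUm hsub) ?_
        rw [Finset.sum_insert hUXW, Finset.sum_pair hXW, hδ, hU2, h6, h7, h9, h10, h11, hn]
        norm_num
      have hmem : ∀ l, w.δ l = 2 → l = U ∨ l = X := by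
        intro l hl
        have : l ∈ w.nl := by rw [mem_nl]; omega
        rw [← hnl, Finset.mem_insert, Finset.mem_insert, Finset.mem_singleton, ← or_assoc] at this
        refine this.resolve_right ?_
        rintro rfl
        omega
      have hsX : w.star d X = X := by
        refine (hmem _ ((w.δ_star d X).trans hδ)).resolve_left fun h2 => ?_
        have := w.D_star d X
        rw [h2] at this
        omega
      obtain ⟨l, hl, hN⟩ := w.T_two d h.noSkew hδ hfix (by rw [hst, hy])
      rcases hmem l hl with rfl | rfl
      · rw [hsX] at hN
        obtain ⟨c', h13⟩ := w.exists_sum_D_N X l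
        rw [← hnl, Finset.sum_insert hUXW, Finset.sum_pair hXW, h9, h10, h7, h11, hδ, hN] at h13
        omega
      · have := w.d0_le_of_leftover d h.noSkew hδ hfix hsX (by omega)
        rw [hst] at this
        omega

end Core

end

section

variable {k : Type} [Field k] {A : Type} [Ring A] [HopfAlgebra k A] [FiniteDimensional k A]

theorem not_noSkew [CharZero k] [IsAlgClosed k] {p : ℕ} (hp : p = 3 ∨ p = 5 ∨ p = 7 ∨ p = 11)
    (hf : Module.finrank k A = 4 * p) (hns : ¬ IsSemisimpleRing A) : ¬ NoSkew k A := by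
  intro hE
  have hpp : p.Prime := by rcases hp with rfl | rfl | rfl | rfl <;> norm_num
  have : Nontrivial A := (Module.finrank_pos_iff (R := k)).1 (by have := hpp.pos; omega)
  obtain ⟨w⟩ := exists_wed k A
  obtain ⟨d⟩ := IntData.exists_intData k A
  have ht := d.counit_t_of_not_ss hns
  obtain ⟨X, hX, hX', hX0⟩ := w.exists_linked' hE d ht
  have hst : 0 < (w.st X).card := Finset.card_pos.2 ⟨1, w.mem_st.2 (w.act_one X)⟩
  have hθ := w.SS_pow_eight d hpp hf (X := X) (by omega) (by omega) (by omega)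
  have hcard := w.card_Ch_dvd_four hpp hf (X := X) (by omega) (by omega)
  have h : Core w d (4 * p) := ⟨hE, hf, hθ, fun i hi => w.even_D d hθ ht hi⟩
  have hM : 4 * p = 12 ∨ 4 * p = 20 ∨ 4 * p = 28 ∨ 4 * p = 44 := by omega
  have h1 := h.card_ne_one hM hX hX' hX0
  have h2 := h.card_ne_two hM hX' hX0 hX
  have h4 := h.card_ne_four hM hX hX' hX0
  have hle := Nat.le_of_dvd (by norm_num) hcard
  interval_cases Fintype.card (Ch k A) <;> omega

lemma isDualGroupLikeOf_iff {φ : A →ₗ[k] k} :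
    IsDualGroupLikeOf (LinearMap.mul k A) 1 φ ↔ φ ∈ Set.range (Ch.fn (k := k) (A := A)) := by
  constructor
  · rintro ⟨h1, h2⟩
    exact ⟨Ch.ofAlg (AlgHom.ofLinearMap φ h1 h2), by rw [Ch.fn_ofAlg]; rfl⟩
  · rintro ⟨χ, rfl⟩
    exact ⟨χ.fn_one, χ.fn_mul⟩

lemma dualHasNontrivialSkewPrimitiveOf_of_not_noSkew (h : ¬ NoSkew k A) :
    DualHasNontrivialSkewPrimitiveOf (LinearMap.mul k A) 1 := by
  simp only [NoSkew, not_forall] at h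
  obtain ⟨χ, ψ, f, hf, hn⟩ := h
  refine ⟨f, ψ.fn, χ.fn, isDualGroupLikeOf_iff.2 ⟨ψ, rfl⟩, isDualGroupLikeOf_iff.2 ⟨χ, rfl⟩, hf, ?_⟩
  simpa only [isDualGroupLikeOf_iff, Set.ofPred_mem_eq] using hn

/-- A finite-dimensional Hopf algebra is the linear dual of its dual. -/
noncomputable def bidual : A ≃ₗ[k] (DualH k A →ₗ[k] k) :=
  (Module.evalEquiv k A).trans DualH.eqv.dualMap

lemma bidual_apply (a : A) (f : DualH k A) : bidual a f = f.fn a := rfl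

lemma tensor_ext {x z : A ⊗[k] A}
    (h : ∀ f g : A →ₗ[k] k, TensorProduct.lid k k (TensorProduct.map f g x) =
      TensorProduct.lid k k (TensorProduct.map f g z)) : x = z := by
  let b := Module.finBasis k A
  refine (b.tensorProduct b).ext_elem fun i => ?_
  have e : (b.tensorProduct b).coord i =
      (TensorProduct.lid k k).toLinearMap ∘ₗ TensorProduct.map (b.coord i.1) (b.coord i.2) := by
    ext u v
    simpa [mul_comm] using Module.Basis.tensorProduct_repr_tmul_apply b b u v i.1 i.2
  have := h (b.coord i.1) (b.coord i.2)
  exact (LinearMap.congr_fun e x).trans (this.trans (LinearMap.congr_fun e z).symm)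

lemma lid_map_comul (f g : A →ₗ[k] k) (a : A) :
    TensorProduct.lid k k (TensorProduct.map f g (comul (R := k) a)) = cv f g a := by
  rw [cv_apply (ℛ k a)]
  conv_lhs => rw [← (ℛ k a).eq]
  simp

lemma bidual_mul (a : A) (f g : A →ₗ[k] k) :
    bidual a (DualH.mk f * DualH.mk g) =
      TensorProduct.lid k k (TensorProduct.map f g (comul (R := k) a)) := by
  rw [lid_map_comul]; rfl

lemma isGroupLikeOf_iff {a : A} : IsGroupLikeOf (comul (R := k)) a ↔
    bidual a ∈ Set.range (Ch.fn (k := k) (A := DualH k A)) := by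
  rw [← isDualGroupLikeOf_iff]
  constructor
  · rintro ⟨h0, h⟩
    have hm : ∀ f g : A →ₗ[k] k, cv f g a = f a * g a := fun f g => by
      rw [← lid_map_comul, h]; simp
    refine ⟨?_, fun f g => hm f.fn g.fn⟩
    by_contra h1
    refine h0 ((Module.forall_dual_apply_eq_zero_iff k a).1 fun f => ?_)
    have h2 : bidual a (DualH.mk f * 1) = f a * bidual a 1 := hm f _
    rw [mul_one] at h2
    exact (mul_right_eq_self₀.1 h2.symm).resolve_left h1
  · rintro ⟨h1, h2⟩
    refine ⟨fun h0 => by simp [h0] at h1, tensor_ext fun f g => ?_⟩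
    rw [← bidual_mul]
    exact (h2 (DualH.mk f) (DualH.mk g)).trans (by simp [bidual_apply])

lemma hasNontrivialSkewPrimitiveOf_of_not_noSkew (h : ¬ NoSkew k (DualH k A)) :
    HasNontrivialSkewPrimitiveOf (comul (R := k) (A := A)) := by
  simp only [NoSkew, not_forall] at h
  obtain ⟨χ, ψ, F, hF, hn⟩ := h
  refine ⟨bidual.symm F, bidual.symm ψ.fn, bidual.symm χ.fn, isGroupLikeOf_iff.2 (by simp),
    isGroupLikeOf_iff.2 (by simp), tensor_ext fun f g => ?_, fun hy => hn ?_⟩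
  · have e : ∀ (G : DualH k A →ₗ[k] k) (f : A →ₗ[k] k), f (bidual.symm G) = G (DualH.mk f) :=
      fun G f => by
        conv_rhs => rw [← bidual.apply_symm_apply G]
        rw [bidual_apply, DualH.fn, LinearEquiv.apply_symm_apply]
    rw [← bidual_mul, LinearEquiv.apply_symm_apply, hF]
    simp [e]
  · have := Submodule.mem_map_of_mem (f := bidual.toLinearMap) hy
    rw [Submodule.map_span, LinearEquiv.coe_coe, LinearEquiv.apply_symm_apply] at this
    refine Submodule.span_mono ?_ this
    rintro _ ⟨a, ha, rfl⟩
    exact isGroupLikeOf_iff.1 ha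

end

end HopfFour

/-- a non-semisimple Hopf algebra of dimension `4p`, `p ∈ {3,5,7,11}`, over an
algebraically closed field of characteristic zero, has a non-trivial skew primitive element,
and so does its dual Hopf algebra. -/
theorem nonsemisimple_dim_4p_skew_primitive
    (k : Type) [Field k] [IsAlgClosed k] [CharZero k]
    (p : ℕ) (hp : p ∈ ({3, 5, 7, 11} : Set ℕ))
    (H : Type) [Ring H] [HopfAlgebra k H]
    (hdim : Module.finrank k H = 4 * p)
    (hns : ¬ IsSemisimpleRing H) :
    HasNontrivialSkewPrimitiveOf (Coalgebra.comul (R := k) (A := H)) ∧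
      DualHasNontrivialSkewPrimitiveOf (LinearMap.mul k H) 1 := by
  have hp' : p = 3 ∨ p = 5 ∨ p = 7 ∨ p = 11 := by simpa using hp
  have : FiniteDimensional k H := Module.finite_of_finrank_pos (by omega)
  exact ⟨HopfFour.hasNontrivialSkewPrimitiveOf_of_not_noSkew
      (HopfFour.not_noSkew hp' (HopfFour.DualH.finrank_eq.trans hdim)
        (HopfFour.not_isSemisimpleRing_dualH hns)),
    HopfFour.dualHasNontrivialSkewPrimitiveOf_of_not_noSkew (HopfFour.not_noSkew hp' hdim hns)⟩
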